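/- For every ε ∈ (0, 1/2) there exist a positive constant A₁ and y₀ such that for all y ≥ y₀ and all real x with e ≤ x ≤ (1/2 − ε) log log y, the Lebesgue measure of the set {u ∈ [0, y] : R̃(u) ≥ (3e^γ/π²) x} is at most y · exp(−A₁ e^x / x), where γ is the Euler–Mascheroni constant. -/

import Mathlib

open scoped Classical Real
open Complex MeasureTheory

/-- The sawtooth function `ψ`. -/
noncomputable def saw (x : ℝ) : ℝ := if Int.fract x = 0 then 0 else Int.fract x - 1/2

/-- The error term `R(x)` defined by `∑_{n ≤ x} φ(n) = (3/π²) x² + R(x)`. -/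
noncomputable def Rerr (x : ℝ) : ℝ :=
  (∑ n ∈ Finset.range (⌊x⌋₊ + 1), (Nat.totient n : ℝ)) - 3 / Real.pi ^ 2 * x ^ 2

/-- `R̃(x) = R(x)/x - φ(x)/(2x)`, with the convention `φ(x) = 0` when `x` is not a
positive integer. -/
noncomputable def Rtilde (x : ℝ) : ℝ :=
  Rerr x / x - (if Int.fract x = 0 then (Nat.totient ⌊x⌋₊ : ℝ) else 0) / (2 * x)

/-- Removing one zero of an entire function by a Blaschke factor. -/
lemma exists_blaschke_peel {f : ℂ → ℂ} (hf : Differentiable ℂ f) {R B : ℝ} (hR : 0 < R) {ρ : ℂ}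
    (hρ0 : ρ ≠ 0) (hρ : ‖ρ‖ ≤ R / 2) (hfρ : f ρ = 0) (hB : ∀ z, ‖z‖ ≤ R → ‖f z‖ ≤ B)
    (h0 : f 0 ≠ 0) :
    ∃ g : ℂ → ℂ, Differentiable ℂ g ∧ (∀ z, ‖z‖ ≤ R → ‖g z‖ ≤ B) ∧ 2 * ‖f 0‖ ≤ ‖g 0‖ ∧
      g 0 ≠ 0 ∧ (∀ z, ‖z‖ ≤ R / 2 → g z = 0 → f z = 0) ∧
      (deriv f 0 / f 0).re = (deriv g 0 / g 0).re + (-ρ.re) * (1 / ‖ρ‖ ^ 2 - 1 / R ^ 2) := by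
  have hRc : (R : ℂ) ≠ 0 := by exact_mod_cast hR.ne'
  have hds : Differentiable ℂ (dslope f ρ) := by
    have := (Complex.differentiableOn_dslope (f := f) (c := ρ) (s := Set.univ) Filter.univ_mem).2
      hf.differentiableOn
    exact differentiableOn_univ.1 this
  set q : ℂ → ℂ := fun z => (R ^ 2 - (starRingEnd ℂ) ρ * z) / R with hq
  have hqd : Differentiable ℂ q := by simp only [hq]; fun_prop
  set g : ℂ → ℂ := fun z => dslope f ρ z * q z with hg
  have hgd : Differentiable ℂ g := hds.mul hqd
  have hid : ∀ z, (z - ρ) * g z = f z * q z := by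
    intro z
    have := sub_smul_dslope f ρ z
    simp only [smul_eq_mul, hfρ, sub_zero] at this
    simp only [hg]; rw [← mul_assoc, this]
  have hg0 : -ρ * g 0 = f 0 * R := by
    have := hid 0
    simp only [zero_sub, hq, mul_zero, sub_zero] at this
    rw [this]; field_simp
  have hg0' : g 0 = -(f 0 * R) / ρ := by field_simp; linear_combination -hg0
  have hg00 : g 0 ≠ 0 := by
    rw [hg0']; simp [h0, hR.ne', hρ0]
  have hρn : 0 < ‖ρ‖ := norm_pos_iff.2 hρ0
  have hqn : ∀ z, ‖z‖ = R → ‖q z‖ = ‖z - ρ‖ := by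
    intro z hz
    have h1 : (R : ℂ) ^ 2 = (starRingEnd ℂ) z * z := by
      rw [mul_comm, Complex.mul_conj, Complex.normSq_eq_norm_sq, hz]; push_cast; rfl
    simp only [hq, h1, ← sub_mul, ← map_sub, norm_div, norm_mul, hz, RCLike.norm_conj]
    simp [abs_of_pos hR]; field_simp
  have hbd : ∀ z, ‖z‖ ≤ R → ‖g z‖ ≤ B := by
    intro z hz
    refine Complex.norm_le_of_forall_mem_frontier_norm_le (U := Metric.ball 0 R) Metric.isBounded_ball
      (hgd.diffContOnCl) ?_ ?_
    · intro w hw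
      rw [frontier_ball _ hR.ne'] at hw
      have hw' : ‖w‖ = R := by simpa using hw
      have hne : w - ρ ≠ 0 := by
        intro h
        have : w = ρ := by linear_combination h
        rw [this] at hw'; linarith
      have h2 : ‖g w‖ * ‖w - ρ‖ = ‖f w‖ * ‖w - ρ‖ := by
        rw [mul_comm, ← hqn w hw', ← norm_mul (f w), ← hid w, norm_mul (w - ρ), hqn w hw']
      have h3 : ‖g w‖ = ‖f w‖ := mul_right_cancel₀ (norm_ne_zero_iff.2 hne) h2
      rw [h3]; exact hB w hw'.le
    · rw [closure_ball _ hR.ne']; simpa using hz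
  refine ⟨g, hgd, hbd, ?_, hg00, ?_, ?_⟩
  · rw [hg0', norm_div, norm_neg, norm_mul, Complex.norm_real, Real.norm_of_nonneg hR.le,
      le_div_iff₀ hρn]
    have := norm_nonneg (f 0)
    nlinarith
  · intro z hz hgz
    have h1 := hid z
    rw [hgz, mul_zero] at h1
    rcases mul_eq_zero.1 h1.symm with h | h
    · exact h
    · exfalso
      simp only [hq, div_eq_zero_iff, hRc, or_false] at h
      have h2 : (R : ℂ) ^ 2 = (starRingEnd ℂ) ρ * z := by linear_combination h
      have h3 := congrArg norm h2
      rw [norm_mul, RCLike.norm_conj, norm_pow, Complex.norm_real, Real.norm_of_nonneg hR.le] at h3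
      nlinarith [norm_nonneg z]
  · have hd1 : HasDerivAt (fun z => (z - ρ) * g z) (1 * g 0 + (0 - ρ) * deriv g 0) 0 :=
      ((hasDerivAt_id (0 : ℂ)).sub_const ρ).mul (hgd 0).hasDerivAt
    have hd2 : HasDerivAt (fun z => f z * q z)
        (deriv f 0 * q 0 + f 0 * (-(starRingEnd ℂ) ρ / R)) 0 := by
      refine (hf 0).hasDerivAt.mul ?_
      have := (((hasDerivAt_id (0 : ℂ)).const_mul ((starRingEnd ℂ) ρ)).const_sub ((R : ℂ)^2)).div_const (R : ℂ)
      simpa using this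
    have hfun : (fun z => (z - ρ) * g z) = fun z => f z * q z := funext hid
    rw [hfun] at hd1
    have h := hd1.unique hd2
    have hq0 : q 0 = R := by simp only [hq, mul_zero, sub_zero]; field_simp
    rw [hq0] at h
    have key : deriv f 0 / f 0 = deriv g 0 / g 0 + (-1 / ρ + (starRingEnd ℂ) ρ / R ^ 2) := by
      have hb : deriv g 0 / g 0 = -(ρ * deriv g 0) / (f 0 * R) := by
        rw [hg0']; field_simp
      rw [hb]
      have h' : deriv f 0 = (g 0 - ρ * deriv g 0 + f 0 * ((starRingEnd ℂ) ρ / R)) / R := by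
        rw [eq_div_iff hRc]
        linear_combination -h
      rw [h', hg0']
      field_simp
      ring
    rw [key, Complex.add_re, Complex.add_re]
    congr 1
    have e1 : (-1 / ρ : ℂ) = ((-1 / ‖ρ‖ ^ 2 : ℝ) : ℂ) * (starRingEnd ℂ) ρ := by
      have : (starRingEnd ℂ) ρ * ρ = ((‖ρ‖ ^ 2 : ℝ) : ℂ) := by
        rw [mul_comm, Complex.mul_conj, Complex.normSq_eq_norm_sq]
      rw [div_eq_iff hρ0, mul_assoc, this, ← Complex.ofReal_mul]
      rw [div_mul_cancel₀ _ (by positivity)]; simp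
    have e2 : ((starRingEnd ℂ) ρ / R ^ 2 : ℂ) = ((1 / R ^ 2 : ℝ) : ℂ) * (starRingEnd ℂ) ρ := by
      push_cast; ring
    rw [e1, e2, Complex.re_ofReal_mul, Complex.re_ofReal_mul, Complex.conj_re]
    ring

/-- Bound for the logarithmic derivative at the centre of a zero-free disc. -/
lemma norm_logDeriv_le_of_ne_zero {f : ℂ → ℂ} (hf : Differentiable ℂ f) {r M : ℝ} (hr : 0 < r)
    (hM : 1 ≤ M) (hB : ∀ z, ‖z‖ < r → ‖f z‖ ≤ M * ‖f 0‖) (h0 : ∀ z, ‖z‖ < r → f z ≠ 0) :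
    ∃ L : ℂ → ℂ, DifferentiableOn ℂ L (Metric.ball 0 r) ∧ L 0 = 0 ∧
      (∀ z, ‖z‖ < r → f z = f 0 * cexp (L z)) ∧
      (∀ z, ‖z‖ < r → ∀ A, Real.log M < A → ‖L z‖ ≤ 2 * A * ‖z‖ / (r - ‖z‖)) := by
  have hld : DifferentiableOn ℂ (fun z => deriv f z / f z) (Metric.ball 0 r) := by
    refine DifferentiableOn.div ?_ hf.differentiableOn ?_
    · exact (hf.differentiableOn (s := Set.univ)).deriv isOpen_univ |>.mono (Set.subset_univ _)
    · intro z hz; exact h0 z (by simpa using hz)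
  obtain ⟨G, hG⟩ := hld.isExactOn_ball
  have hGd : ∀ z ∈ Metric.ball (0:ℂ) r, HasDerivAt G (deriv f z / f z) z := hG
  set L : ℂ → ℂ := fun z => G z - G 0 with hL
  have hLd : ∀ z ∈ Metric.ball (0:ℂ) r, HasDerivAt L (deriv f z / f z) z := fun z hz =>
    (hGd z hz).sub_const _
  have h00 : (0:ℂ) ∈ Metric.ball (0:ℂ) r := by simpa using hr
  have hf0 : f 0 ≠ 0 := h0 0 (by simpa using hr)
  have hconst : ∀ z ∈ Metric.ball (0:ℂ) r, f z * cexp (-L z) = f 0 * cexp (-L 0) := by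
    intro z hz
    refine (convex_ball (0:ℂ) r).is_const_of_fderivWithin_eq_zero (𝕜 := ℂ)
      (f := fun z => f z * cexp (-L z)) ?_ ?_ hz h00
    · intro w hw
      exact ((hf w).hasDerivAt.mul ((hLd w hw).neg.cexp)).differentiableAt.differentiableWithinAt
    · intro w hw
      have hd : HasDerivAt (fun z => f z * cexp (-L z)) 0 w := by
        refine ((hf w).hasDerivAt.mul ((hLd w hw).neg.cexp)).congr_deriv ?_
        have h1 := h0 w (by simpa using hw)
        have h2 : f w * (deriv f w / f w) = deriv f w := by field_simp
        simp only [Pi.neg_apply]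
        linear_combination (-cexp (-L w)) * h2
      rw [fderivWithin_of_isOpen Metric.isOpen_ball hw]
      have := hd.hasFDerivAt.fderiv
      rw [this]; ext; simp
  have hfL : ∀ z, ‖z‖ < r → f z = f 0 * cexp (L z) := by
    intro z hz
    have := hconst z (by simpa using hz)
    have hL0 : L 0 = 0 := by simp [hL]
    rw [hL0, neg_zero, Complex.exp_zero, mul_one] at this
    rw [← this, mul_assoc, ← Complex.exp_add]; simp
  have hLdiff : DifferentiableOn ℂ L (Metric.ball 0 r) := fun z hz =>
    (hLd z hz).differentiableAt.differentiableWithinAt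
  refine ⟨L, hLdiff, by simp [hL], hfL, ?_⟩
  intro z hz A hA
  have hA0 : 0 < A := lt_of_le_of_lt (Real.log_nonneg hM) hA
  refine Complex.borelCaratheodory_zero hA0 hLdiff ?_ hr (by simpa using hz) (by simp [hL])
  intro w hw
  have hw' : ‖w‖ < r := by simpa using hw
  have h1 := hB w hw'
  rw [hfL w hw', norm_mul, Complex.norm_exp, mul_comm] at h1
  have h2 : Real.exp (L w).re ≤ M := le_of_mul_le_mul_right h1 (norm_pos_iff.2 hf0)
  have h3 := Real.log_le_log (Real.exp_pos _) h2
  rw [Real.log_exp] at h3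
  exact (h3.trans hA.le)

lemma norm_deriv_div_le_of_ne_zero {f : ℂ → ℂ} (hf : Differentiable ℂ f) {r M : ℝ} (hr : 0 < r)
    (hM : 1 ≤ M) (hB : ∀ z, ‖z‖ < r → ‖f z‖ ≤ M * ‖f 0‖) (h0 : ∀ z, ‖z‖ < r → f z ≠ 0) :
    ‖deriv f 0 / f 0‖ ≤ 2 * Real.log M / r := by
  obtain ⟨L, hL, hL0, hfL, hbd⟩ := norm_logDeriv_le_of_ne_zero hf hr hM hB h0
  have hf0 : f 0 ≠ 0 := h0 0 (by simpa using hr)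
  have hLat : DifferentiableAt ℂ L 0 := hL.differentiableAt (Metric.ball_mem_nhds 0 hr)
  have hder : deriv f 0 / f 0 = deriv L 0 := by
    have h1 : HasDerivAt (fun z => f 0 * cexp (L z)) (f 0 * (cexp (L 0) * deriv L 0)) 0 :=
      (hLat.hasDerivAt.cexp).const_mul _
    have h2 : f =ᶠ[nhds 0] fun z => f 0 * cexp (L z) := by
      filter_upwards [Metric.ball_mem_nhds (0:ℂ) hr] with z hz
      exact hfL z (by simpa using hz)
    rw [h2.deriv_eq, h1.deriv, hL0, Complex.exp_zero, one_mul, mul_comm, mul_div_assoc, div_self hf0,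
      mul_one]
  rw [hder]
  have key : ∀ A, Real.log M < A → ‖deriv L 0‖ ≤ 2 * A / r := by
    intro A hA
    have hA0 : 0 < A := lt_of_le_of_lt (Real.log_nonneg hM) hA
    have hev : ∀ᶠ z in nhdsWithin (0:ℂ) {0}ᶜ, ‖slope L 0 z‖ ≤ 2 * A / (r - ‖z‖) := by
      filter_upwards [mem_nhdsWithin_of_mem_nhds (Metric.ball_mem_nhds (0:ℂ) hr),
        self_mem_nhdsWithin] with z hz hz0
      have hz' : ‖z‖ < r := by simpa using hz
      have := hbd z hz' A hA
      rw [slope_def_field, hL0, sub_zero, sub_zero, norm_div,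
        div_le_iff₀ (norm_pos_iff.2 (by simpa using hz0))]
      refine this.trans (le_of_eq (by ring))
    have ht1 : Filter.Tendsto (fun z => ‖slope L 0 z‖) (nhdsWithin (0:ℂ) {0}ᶜ) (nhds ‖deriv L 0‖) :=
      (hasDerivAt_iff_tendsto_slope.1 hLat.hasDerivAt).norm
    have ht2 : Filter.Tendsto (fun z : ℂ => 2 * A / (r - ‖z‖)) (nhdsWithin (0:ℂ) {0}ᶜ)
        (nhds (2 * A / r)) := by
      have : ContinuousAt (fun z : ℂ => 2 * A / (r - ‖z‖)) 0 := by
        refine ContinuousAt.div continuousAt_const (by fun_prop) (by simpa using hr.ne')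
      have h := this.tendsto
      simp only [norm_zero, sub_zero] at h
      exact h.mono_left nhdsWithin_le_nhds
    exact le_of_tendsto_of_tendsto ht1 ht2 hev
  refine le_of_forall_pos_le_add ?_
  intro e he
  refine (key (Real.log M + e * r / 2) (by have := mul_pos he hr; linarith)).trans (le_of_eq ?_)
  field_simp

/-- Landau's lemma: zeros to the left only help. -/
lemma landau_lower (n : ℕ) : ∀ {f : ℂ → ℂ}, Differentiable ℂ f → ∀ {R : ℝ}, 0 < R → f 0 ≠ 0 →
    (∀ z, ‖z‖ ≤ R → ‖f z‖ ≤ 2 ^ n * ‖f 0‖) → (∀ z, ‖z‖ ≤ R / 2 → f z = 0 → z.re < 0) →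
    -(4 * n * Real.log 2 / R) ≤ (deriv f 0 / f 0).re := by
  induction n with
  | zero =>
    intro f hf R hR hf0 hB hz
    have hconst : ∀ z, ‖z‖ < R / 2 → f z ≠ 0 := by
      intro ρ hρ h
      have hρ0 : ρ ≠ 0 := by rintro rfl; exact hf0 h
      obtain ⟨g, -, hgB, hg2, -, -, -⟩ := exists_blaschke_peel hf hR hρ0 hρ.le h hB hf0
      have := hgB 0 (by simpa using hR.le)
      have := norm_pos_iff.2 hf0
      simp only [pow_zero, one_mul] at *
      linarith
    have := norm_deriv_div_le_of_ne_zero hf (half_pos hR) (le_refl (1:ℝ))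
      (fun z hz => by simpa using hB z (by linarith)) hconst
    have h2 := Complex.abs_re_le_norm (deriv f 0 / f 0)
    rw [Real.log_one] at this
    have h3 := neg_abs_le (deriv f 0 / f 0).re
    simp only [Nat.cast_zero, mul_zero, zero_mul, zero_div, neg_zero] at *
    linarith
  | succ n ih =>
    intro f hf R hR hf0 hB hz
    have hlog : 0 ≤ 4 * Real.log 2 / R := by positivity
    by_cases hex : ∃ ρ, ‖ρ‖ ≤ R / 2 ∧ f ρ = 0
    · obtain ⟨ρ, hρ, hfρ⟩ := hex
      have hρ0 : ρ ≠ 0 := by rintro rfl; exact hf0 hfρ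
      obtain ⟨g, hg, hgB, hg2, hg0, hgz, hre⟩ := exists_blaschke_peel hf hR hρ0 hρ hfρ hB hf0
      have h1 := ih hg hR hg0 (fun z hzR => (hgB z hzR).trans (by
        rw [pow_succ]; nlinarith [pow_pos (two_pos (α := ℝ)) n]))
        (fun z hzR h => hz z hzR (hgz z hzR h))
      rw [hre]
      have h2 : 0 ≤ (-ρ.re) * (1 / ‖ρ‖ ^ 2 - 1 / R ^ 2) := by
        refine mul_nonneg (by linarith [hz ρ hρ hfρ]) (sub_nonneg.2 ?_)
        have hρn : 0 < ‖ρ‖ := norm_pos_iff.2 hρ0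
        refine one_div_le_one_div_of_le (by positivity) ?_
        exact pow_le_pow_left₀ hρn.le (by linarith) 2
      have h3 : -(4 * ((n + 1 : ℕ) : ℝ) * Real.log 2 / R) =
        -(4 * n * Real.log 2 / R) - 4 * Real.log 2 / R := by push_cast; ring
      rw [h3]; linarith
    · push Not at hex
      have := norm_deriv_div_le_of_ne_zero hf (half_pos hR) (M := 2 ^ (n + 1))
        (one_le_pow₀ (by norm_num)) (fun z hz => hB z (by linarith)) (fun z hz => hex z hz.le)
      have h2 := Complex.abs_re_le_norm (deriv f 0 / f 0)
      have h3 := neg_abs_le (deriv f 0 / f 0).re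
      rw [Real.log_pow] at this
      have h4 : 2 * (((n + 1 : ℕ) : ℝ) * Real.log 2) / (R / 2) =
        4 * ((n + 1 : ℕ) : ℝ) * Real.log 2 / R := by field_simp; ring
      linarith

lemma landau_lower_with_zero (n : ℕ) {f : ℂ → ℂ} (hf : Differentiable ℂ f) {R : ℝ} (hR : 0 < R)
    (hf0 : f 0 ≠ 0) (hB : ∀ z, ‖z‖ ≤ R → ‖f z‖ ≤ 2 ^ n * ‖f 0‖)
    (hz : ∀ z, ‖z‖ ≤ R / 2 → f z = 0 → z.re < 0) {a : ℝ} (ha : 0 < a) (haR : a ≤ R / 2)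
    (hfa : f (-a : ℂ) = 0) :
    1 / a - a / R ^ 2 - 4 * n * Real.log 2 / R ≤ (deriv f 0 / f 0).re := by
  have hac : (-a : ℂ) ≠ 0 := by simp [ha.ne']
  have hna : ‖(-a : ℂ)‖ = a := by simp [abs_of_pos ha]
  obtain ⟨g, hg, hgB, hg2, hg0, hgz, hre⟩ := exists_blaschke_peel hf hR hac
    (by rw [hna]; exact haR) hfa hB hf0
  have h1 := landau_lower n hg hR hg0 (fun z hzR => (hgB z hzR).trans (by
    have := norm_nonneg (f 0)
    exact mul_le_mul_of_nonneg_left (by linarith) (by positivity)))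
    (fun z hzR h => hz z hzR (hgz z hzR h))
  rw [hre, hna]
  have : (-(-a : ℂ).re) * (1 / a ^ 2 - 1 / R ^ 2) = 1 / a - a / R ^ 2 := by
    simp; field_simp
  linarith

/-- The integral `∫_1^∞ {t} t^{-s-1} dt` as a Mellin transform at `-s`. -/
noncomputable def fractTail (t : ℝ) : ℂ := (Set.Ioi (1:ℝ)).indicator (fun t => ((Int.fract t : ℝ) : ℂ)) t

lemma norm_fractTail_le (t : ℝ) : ‖fractTail t‖ ≤ 1 := by
  unfold fractTail Set.indicator
  split_ifs
  · rw [Complex.norm_real, Real.norm_of_nonneg (Int.fract_nonneg _)]; exact (Int.fract_lt_one t).le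
  · simp

lemma measurable_fractTail : Measurable fractTail := by
  unfold fractTail
  exact (Complex.measurable_ofReal.comp measurable_fract).indicator measurableSet_Ioi

lemma mellin_fractTail_eq (s : ℂ) :
    mellin fractTail (-s) = ∫ t in Set.Ioi (1:ℝ), ((Int.fract t : ℝ) : ℂ) * (t : ℂ) ^ (-(s+1)) := by
  unfold mellin
  have h : ∀ t : ℝ, (t : ℂ) ^ (-s - 1) • fractTail t = (Set.Ioi (1:ℝ)).indicator
      (fun t : ℝ => ((Int.fract t : ℝ) : ℂ) * (t : ℂ) ^ (-(s+1))) t := by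
    intro t
    unfold fractTail
    simp only [Set.indicator_apply, smul_eq_mul]
    split_ifs
    · rw [mul_comm]; congr 2; ring
    · simp
  simp_rw [h]
  rw [setIntegral_indicator measurableSet_Ioi]
  congr 2
  ext t; simp only [Set.mem_inter_iff, Set.mem_Ioi]
  exact ⟨fun h => h.2, fun h => ⟨by linarith, h⟩⟩

lemma differentiableAt_mellin_fractTail {s : ℂ} (hs : 0 < s.re) :
    DifferentiableAt ℂ (mellin fractTail) (-s) := by
  refine mellin_differentiableAt_of_isBigO_rpow (a := 0) (b := -s.re - 1) ?_ ?_ (by simpa using hs) ?_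
    (by simp)
  · refine LocallyIntegrable.locallyIntegrableOn ?_ _
    refine (locallyIntegrable_const (1:ℂ)).mono measurable_fractTail.aestronglyMeasurable ?_
    exact Filter.Eventually.of_forall fun t => by simpa using norm_fractTail_le t
  · simp only [neg_zero, Real.rpow_zero]
    exact Asymptotics.IsBigO.of_bound 1 (Filter.Eventually.of_forall fun t => by
      simpa using norm_fractTail_le t)
  · refine Asymptotics.IsBigO.of_bound 1 ?_
    filter_upwards [mem_nhdsWithin_of_mem_nhds (Iio_mem_nhds (show (0:ℝ) < 1 by norm_num))] with t ht
    have : fractTail t = 0 := by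
      unfold fractTail
      exact Set.indicator_of_notMem (by simpa using (le_of_lt ht)) _
    rw [this, norm_zero]; positivity

lemma integrableOn_cpow_Ioi_one {s : ℂ} (hs : 0 < s.re) :
    IntegrableOn (fun t : ℝ => ((Int.fract t : ℝ) : ℂ) * (t : ℂ) ^ (-(s+1))) (Set.Ioi 1) := by
  have h := integrableOn_Ioi_rpow_of_lt (a := -s.re - 1) (by linarith) (zero_lt_one)
  refine h.mono' ?_ ?_
  · refine ((Complex.measurable_ofReal.comp measurable_fract).mul ?_).aestronglyMeasurable
    exact Complex.measurable_ofReal.pow_const _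
  · filter_upwards [ae_restrict_mem measurableSet_Ioi] with t ht
    have ht0 : 0 < t := lt_trans one_pos ht
    rw [norm_mul, Complex.norm_cpow_eq_rpow_re_of_pos ht0, Complex.norm_real,
      Real.norm_of_nonneg (Int.fract_nonneg _)]
    have : (-(s+1)).re = -s.re - 1 := by simp; ring
    rw [this]
    exact mul_le_of_le_one_left (Real.rpow_nonneg ht0.le _) (Int.fract_lt_one t).le

lemma norm_mellin_fractTail_le {s : ℂ} (hs : 0 < s.re) : ‖mellin fractTail (-s)‖ ≤ 1 / s.re := by
  rw [mellin_fractTail_eq]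
  have h := integrableOn_Ioi_rpow_of_lt (a := -s.re - 1) (by linarith) (zero_lt_one)
  refine (norm_integral_le_of_norm_le h ?_).trans (le_of_eq ?_)
  · filter_upwards [ae_restrict_mem measurableSet_Ioi] with t ht
    have ht0 : 0 < t := lt_trans one_pos ht
    rw [norm_mul, Complex.norm_cpow_eq_rpow_re_of_pos ht0, Complex.norm_real,
      Real.norm_of_nonneg (Int.fract_nonneg _)]
    have : (-(s+1)).re = -s.re - 1 := by simp; ring
    rw [this]
    exact mul_le_of_le_one_left (Real.rpow_nonneg ht0.le _) (Int.fract_lt_one t).le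
  · rw [integral_Ioi_rpow_of_lt (by linarith) zero_lt_one]
    simp only [Real.one_rpow, sub_add_cancel]
    rw [neg_div_neg_eq]

lemma riemannZeta₀_eq_of_one_lt {s : ℂ} (hs : 1 < s.re) :
    riemannZeta₀ s = 1 - s * mellin fractTail (-s) := by
  have hs0 : 0 < s.re := by linarith
  have hs1 : s ≠ 1 := by rintro rfl; simp at hs
  have hs1' : s - 1 ≠ 0 := sub_ne_zero.2 hs1
  have h1 := LSeries_eq_mul_integral (1 : ℕ → ℂ) (r := 1) zero_le_one hs
    (LSeriesSummable_one_iff.2 hs) (by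
      simp only [Pi.one_apply, Finset.sum_const, Nat.card_Icc, add_tsub_cancel_right, nsmul_eq_mul,
        mul_one, Real.rpow_one]
      exact Asymptotics.IsBigO.of_bound 1 (Filter.Eventually.of_forall fun n => by simp))
  rw [LSeries_one_eq_riemannZeta hs] at h1
  have h2 : ∫ t in Set.Ioi (1:ℝ), (∑ k ∈ Finset.Icc 1 ⌊t⌋₊, (1 : ℕ → ℂ) k) * (t:ℂ) ^ (-(s + 1)) =
      1 / (s - 1) - mellin fractTail (-s) := by
    rw [mellin_fractTail_eq]
    have hInt : IntegrableOn (fun t : ℝ => (t : ℂ) ^ (-s)) (Set.Ioi 1) :=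
      integrableOn_Ioi_cpow_of_lt (by simpa using hs) zero_lt_one
    have h3 : ∫ t in Set.Ioi (1:ℝ), (t : ℂ) ^ (-s) = 1 / (s - 1) := by
      rw [integral_Ioi_cpow_of_lt (by simpa using hs) zero_lt_one]
      simp only [Complex.ofReal_one, Complex.one_cpow]
      rw [show -s + 1 = -(s - 1) by ring, neg_div_neg_eq]
    rw [← h3, ← integral_sub hInt (integrableOn_cpow_Ioi_one hs0)]
    refine setIntegral_congr_fun measurableSet_Ioi fun t ht => ?_
    have ht0 : 0 < t := lt_trans one_pos ht
    have htc : (t : ℂ) ≠ 0 := by exact_mod_cast ht0.ne'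
    simp only [Pi.one_apply, Finset.sum_const, Nat.card_Icc, add_tsub_cancel_right, nsmul_eq_mul,
      mul_one]
    have hfl : ((⌊t⌋₊ : ℕ) : ℂ) = (t : ℂ) - ((Int.fract t : ℝ) : ℂ) := by
      rw [← Complex.ofReal_sub, Int.self_sub_fract]
      have := natCast_floor_eq_intCast_floor (R := ℝ) ht0.le
      rw [← this]; simp
    have hp : (t : ℂ) ^ (-s) = t * (t : ℂ) ^ (-(s+1)) := by
      have : -s = 1 + -(s+1) := by ring
      rw [this, Complex.cpow_add _ _ htc, Complex.cpow_one]
    rw [hfl, hp]; ring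
  have h4 : riemannZeta s = riemannZeta₀ s + 1 / (s - 1) := by
    rw [riemannZeta_eq_inv_sub_add hs1]; ring
  have h5 : riemannZeta₀ s = riemannZeta s - 1 / (s-1) := by rw [h4]; ring
  rw [h5, h1, h2]
  field_simp
  ring

lemma riemannZeta₀_eq {s : ℂ} (hs : 0 < s.re) : riemannZeta₀ s = 1 - s * mellin fractTail (-s) := by
  have hopen : IsOpen {s : ℂ | 0 < s.re} := isOpen_lt continuous_const Complex.continuous_re
  have hf : AnalyticOnNhd ℂ riemannZeta₀ {s : ℂ | 0 < s.re} :=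
    (differentiable_riemannZeta₀.differentiableOn).analyticOnNhd hopen
  have hg : AnalyticOnNhd ℂ (fun s => 1 - s * mellin fractTail (-s)) {s : ℂ | 0 < s.re} := by
    refine DifferentiableOn.analyticOnNhd (fun s hs => ?_) hopen
    have h1 : DifferentiableAt ℂ (fun s => mellin fractTail (-s)) s :=
      (differentiableAt_mellin_fractTail hs).comp s differentiableAt_id.neg
    exact ((differentiableAt_const _).sub (differentiableAt_id.mul h1)).differentiableWithinAt
  have hpre : IsPreconnected {s : ℂ | 0 < s.re} :=
    (convex_halfSpace_re_gt 0).isPreconnected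
  refine hf.eqOn_of_preconnected_of_eventuallyEq hg hpre (z₀ := 2) (by simp) ?_ hs
  have : {s : ℂ | 1 < s.re} ∈ nhds (2:ℂ) :=
    (isOpen_lt continuous_const Complex.continuous_re).mem_nhds (by simp)
  filter_upwards [this] with s hs using riemannZeta₀_eq_of_one_lt hs

lemma norm_riemannZeta₀_le {s : ℂ} (hs : 1/2 ≤ s.re) : ‖riemannZeta₀ s‖ ≤ 1 + 2 * ‖s‖ := by
  have hs0 : 0 < s.re := by linarith
  rw [riemannZeta₀_eq hs0]
  refine (norm_sub_le _ _).trans ?_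
  rw [norm_mul, norm_one]
  have h := norm_mellin_fractTail_le hs0
  have h2 : 1 / s.re ≤ 2 := by rw [div_le_iff₀ hs0]; linarith
  have h3 : ‖s‖ * ‖mellin fractTail (-s)‖ ≤ ‖s‖ * 2 :=
    mul_le_mul_of_nonneg_left (h.trans h2) (norm_nonneg _)
  linarith

lemma norm_riemannZeta₁_le {s : ℂ} (hs : 1/2 ≤ s.re) : ‖riemannZeta₁ s‖ ≤ 3 * (1 + ‖s‖) ^ 2 := by
  unfold riemannZeta₁
  refine (norm_add_le _ _).trans ?_
  rw [norm_mul, norm_one]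
  have h := norm_riemannZeta₀_le hs
  have h2 : ‖s - 1‖ ≤ ‖s‖ + 1 := (norm_sub_le _ _).trans (by simp)
  have h3 : ‖s - 1‖ * ‖riemannZeta₀ s‖ ≤ (‖s‖+1) * (1 + 2 * ‖s‖) :=
    mul_le_mul h2 h (norm_nonneg _) (by positivity)
  nlinarith [norm_nonneg s]

lemma norm_riemannZeta_real_le {σ : ℝ} (h1 : 1 < σ) (h2 : σ ≤ 2) : ‖riemannZeta σ‖ ≤ 6 / (σ - 1) := by
  have hne : (σ : ℂ) ≠ 1 := by exact_mod_cast h1.ne'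
  have hpos : 0 < σ - 1 := by linarith
  rw [riemannZeta_eq_inv_sub_add hne]
  have h0 := norm_riemannZeta₀_le (s := (σ : ℂ)) (by simp; linarith)
  rw [Complex.norm_real, Real.norm_of_nonneg (by linarith)] at h0
  have h3 : ‖(σ - 1 : ℂ)⁻¹‖ = 1 / (σ - 1) := by
    rw [norm_inv, ← Complex.ofReal_one, ← Complex.ofReal_sub, Complex.norm_real,
      Real.norm_of_nonneg hpos.le, one_div]
  refine (norm_add_le _ _).trans ?_
  have h4 : 1 + 2 * σ ≤ 5 / (σ - 1) := by rw [le_div_iff₀ hpos]; nlinarith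
  have h5 : 6 / (σ - 1) = 1 / (σ - 1) + 5 / (σ - 1) := by ring
  rw [h3]; linarith

lemma norm_LSeries_moebius_le {s : ℂ} (hs : 1 < s.re) :
    ‖LSeries (fun n => ((ArithmeticFunction.moebius n : ℤ) : ℂ)) s‖ ≤ ‖riemannZeta s.re‖ := by
  have hre : 1 < ((s.re : ℝ) : ℂ).re := by simpa using hs
  have hsum := LSeriesSummable_one_iff.2 hre
  set r : ℕ → ℝ := fun n => ‖LSeries.term (1 : ℕ → ℂ) (s.re : ℂ) n‖ with hr
  have hr_sum : Summable r := hsum.norm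
  have hterm : ∀ n, LSeries.term (1 : ℕ → ℂ) (s.re : ℂ) n = ((r n : ℝ) : ℂ) := by
    intro n
    simp only [hr]
    rcases eq_or_ne n 0 with rfl | hn
    · simp
    · rw [LSeries.norm_term_eq, LSeries.term_of_ne_zero hn, if_neg hn]
      simp only [Pi.one_apply, norm_one, Complex.ofReal_re]
      have : (n : ℂ) = ((n : ℝ) : ℂ) := by simp
      rw [this, ← Complex.ofReal_cpow (Nat.cast_nonneg n)]
      push_cast; rfl
  have hz : ‖riemannZeta s.re‖ = ∑' n, r n := by
    rw [← LSeries_one_eq_riemannZeta hre]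
    unfold LSeries
    simp_rw [hterm]
    rw [← Complex.ofReal_tsum, Complex.norm_real, Real.norm_of_nonneg]
    exact tsum_nonneg fun n => norm_nonneg _
  rw [hz]
  unfold LSeries
  refine tsum_of_norm_bounded hr_sum.hasSum ?_
  intro n
  simp only [hr, LSeries.norm_term_eq]
  split_ifs with hn
  · exact le_rfl
  · simp only [Pi.one_apply, norm_one, Complex.ofReal_re]
    gcongr
    rw [Complex.norm_intCast]
    exact_mod_cast ArithmeticFunction.abs_moebius_le_one

lemma inv_riemannZeta_bound {s : ℂ} (hs : 1 < s.re) (hs2 : s.re ≤ 2) :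
    (s.re - 1) / 6 ≤ ‖riemannZeta s‖ := by
  have h1 := LSeries_one_mul_Lseries_moebius hs
  rw [LSeries_one_eq_riemannZeta hs] at h1
  have h2 := congrArg norm h1
  rw [norm_mul, norm_one] at h2
  have h3 := (norm_LSeries_moebius_le hs).trans (norm_riemannZeta_real_le hs hs2)
  have h4 : 1 ≤ ‖riemannZeta s‖ * (6 / (s.re - 1)) := by
    exact h2.symm.le.trans (mul_le_mul_of_nonneg_left h3 (norm_nonneg _))
  have : 0 < s.re - 1 := by linarith
  rw [mul_div_assoc', le_div_iff₀ this] at h4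
  linarith

lemma riemannZeta₁_eq (s : ℂ) (hs : s ≠ 1) : riemannZeta₁ s = (s - 1) * riemannZeta s := by
  rw [riemannZeta_eq_inv_sub_mul hs]
  have : s - 1 ≠ 0 := sub_ne_zero.2 hs
  field_simp

lemma riemannZeta₁_lower {s : ℂ} (hs : 1 < s.re) (hs2 : s.re ≤ 2) :
    ‖s - 1‖ * ((s.re - 1) / 6) ≤ ‖riemannZeta₁ s‖ := by
  rw [riemannZeta₁_eq s (by rintro rfl; simp at hs), norm_mul]
  exact mul_le_mul_of_nonneg_left (inv_riemannZeta_bound hs hs2) (norm_nonneg _)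

lemma riemannZeta₁_ne_zero_of_one_le_re {s : ℂ} (hs : 1 ≤ s.re) : riemannZeta₁ s ≠ 0 := by
  rcases eq_or_ne s 1 with rfl | h
  · simp
  · rw [riemannZeta₁_eq s h]
    exact mul_ne_zero (sub_ne_zero.2 h) (riemannZeta_ne_zero_of_one_le_re hs)

lemma logDeriv_riemannZeta₁ {s : ℂ} (hs : 1 < s.re) :
    deriv riemannZeta₁ s / riemannZeta₁ s = 1 / (s - 1) + deriv riemannZeta s / riemannZeta s := by
  have hs1 : s ≠ 1 := by rintro rfl; simp at hs
  have hz := riemannZeta_ne_zero_of_one_le_re hs.le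
  have hsub : s - 1 ≠ 0 := sub_ne_zero.2 hs1
  have hev : riemannZeta₁ =ᶠ[nhds s] fun s => (s - 1) * riemannZeta s := by
    filter_upwards [isOpen_ne.mem_nhds hs1] with w hw using riemannZeta₁_eq w hw
  have hd : HasDerivAt (fun s => (s - 1) * riemannZeta s)
      (1 * riemannZeta s + (s - 1) * deriv riemannZeta s) s :=
    ((hasDerivAt_id s).sub_const 1).mul (differentiableAt_riemannZeta hs1).hasDerivAt
  rw [hev.deriv_eq, hd.deriv, riemannZeta₁_eq s hs1]
  field_simp

/-- The `3-4-1` inequality for the logarithmic derivative of `ζ`. -/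
lemma three_four_one {σ t : ℝ} (hσ : 1 < σ) :
    0 ≤ 3 * (-deriv riemannZeta σ / riemannZeta σ).re
      + 4 * (-deriv riemannZeta (σ + t * I) / riemannZeta (σ + t * I)).re
      + (-deriv riemannZeta (σ + (2 * t : ℝ) * I) / riemannZeta (σ + (2 * t : ℝ) * I)).re := by
  have key : ∀ u : ℝ, HasSum (fun n : ℕ => ArithmeticFunction.vonMangoldt n / (n : ℝ) ^ σ *
      Real.cos (u * Real.log n))
      (-deriv riemannZeta (σ + u * I) / riemannZeta (σ + u * I)).re := by
    intro u
    have hre : 1 < ((σ : ℂ) + u * I).re := by simpa using hσ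
    have h1 := (ArithmeticFunction.LSeriesSummable_vonMangoldt hre).hasSum
    have h2 : ∑' n, LSeries.term (fun n => ((ArithmeticFunction.vonMangoldt n : ℝ) : ℂ)) (σ + u * I) n =
      -deriv riemannZeta (σ + u * I) / riemannZeta (σ + u * I) :=
      ArithmeticFunction.LSeries_vonMangoldt_eq_deriv_riemannZeta_div hre
    rw [h2] at h1
    have h3 := Complex.hasSum_re h1
    convert h3 using 2 with n
    rcases eq_or_ne n 0 with rfl | hn
    · simp
    · have hn0 : 0 < (n : ℝ) := by exact_mod_cast Nat.pos_of_ne_zero hn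
      have hq : ((ArithmeticFunction.vonMangoldt n : ℝ) : ℂ) / (n : ℂ) ^ ((σ : ℂ) + u * I) =
          ((ArithmeticFunction.vonMangoldt n : ℝ) : ℂ) * (n : ℂ) ^ (-((σ : ℂ) + u * I)) := by
        rw [Complex.cpow_neg, div_eq_mul_inv]
      rw [LSeries.term_of_ne_zero hn, hq]
      have hc : (n : ℂ) ^ (-((σ : ℂ) + u * I)) = (((n : ℝ) ^ (-σ) : ℝ) : ℂ) *
          cexp ((-(u * Real.log n) : ℝ) * I) := by
        have hnc : (n : ℂ) ≠ 0 := by exact_mod_cast hn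
        rw [neg_add, Complex.cpow_add _ _ hnc]
        congr 1
        · have : (n : ℂ) = ((n : ℝ) : ℂ) := by simp
          rw [this, ← Complex.ofReal_neg, ← Complex.ofReal_cpow hn0.le]
        · rw [Complex.cpow_def_of_ne_zero hnc, ← Complex.natCast_log]
          congr 1; push_cast; ring
      rw [hc, ← mul_assoc, ← Complex.ofReal_mul, Complex.re_ofReal_mul, Complex.exp_ofReal_mul_I_re,
        Real.cos_neg, Real.rpow_neg hn0.le, div_eq_mul_inv]
  have h0 := key 0
  have h1 := key t
  have h2 := key (2 * t)
  simp only [Complex.ofReal_zero, zero_mul, add_zero, Real.cos_zero, mul_one] at h0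
  have hs := ((h0.mul_left 3).add (h1.mul_left 4)).add h2
  refine hs.nonneg ?_
  intro n
  have hL : 0 ≤ ArithmeticFunction.vonMangoldt n / (n : ℝ) ^ σ :=
    div_nonneg ArithmeticFunction.vonMangoldt_nonneg (Real.rpow_nonneg (Nat.cast_nonneg n) _)
  have hcos : Real.cos (2 * t * Real.log n) = 2 * Real.cos (t * Real.log n) ^ 2 - 1 := by
    rw [← Real.cos_two_mul]; congr 1; ring
  rw [hcos]
  have : 3 * (ArithmeticFunction.vonMangoldt n / (n : ℝ) ^ σ) + 4 * (ArithmeticFunction.vonMangoldt n / (n : ℝ) ^ σ *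
    Real.cos (t * Real.log n)) + ArithmeticFunction.vonMangoldt n / (n : ℝ) ^ σ * (2 * Real.cos (t * Real.log n) ^ 2 - 1)
    = 2 * (ArithmeticFunction.vonMangoldt n / (n : ℝ) ^ σ) * (Real.cos (t * Real.log n) + 1) ^ 2 := by ring
  rw [this]; positivity

lemma riemannZeta₁_growth_ratio {σ t T : ℝ} (hT : 4 ≤ T) (h1 : 1 + 1 / T ≤ σ) (h2 : σ ≤ 2)
    (ht : |t| ≤ T) (hd : 1 / T ≤ ‖(σ + t * I - 1 : ℂ)‖) {z : ℂ} (hz : ‖z‖ ≤ 1 / 2) :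
    ‖riemannZeta₁ (σ + t * I + z)‖ ≤ 72 * T ^ 4 * ‖riemannZeta₁ (σ + t * I)‖ := by
  have hT0 : 0 < T := by linarith
  have hT1 : 0 < 1 / T := by positivity
  have hre : ((σ : ℂ) + t * I).re = σ := by simp
  have hlow := riemannZeta₁_lower (s := σ + t * I) (by rw [hre]; linarith) (by rw [hre]; exact h2)
  rw [hre] at hlow
  have hlow2 : 1 / T * (1 / T / 6) ≤ ‖riemannZeta₁ (σ + t * I)‖ :=
    (mul_le_mul hd (by linarith) (by positivity) (norm_nonneg _)).trans hlow
  have hzre : -(1/2) ≤ z.re := by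
    have := Complex.abs_re_le_norm z
    have := neg_abs_le z.re
    linarith
  have hup := norm_riemannZeta₁_le (s := σ + t * I + z) (by simp; linarith)
  have hn : ‖(σ + t * I + z : ℂ)‖ ≤ T + 5 / 2 := by
    refine (norm_add_le _ _).trans ?_
    have : ‖(σ + t * I : ℂ)‖ ≤ 2 + T := by
      refine (norm_add_le _ _).trans ?_
      rw [Complex.norm_real, norm_mul, Complex.norm_real, Complex.norm_I, mul_one,
        Real.norm_of_nonneg (by linarith)]
      have : ‖t‖ = |t| := rfl
      linarith
    linarith
  have h3 : 3 * (1 + ‖(σ + t * I + z : ℂ)‖) ^ 2 ≤ 12 * T ^ 2 := by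
    have : (1 + ‖(σ + t * I + z : ℂ)‖) ^ 2 ≤ (2 * T) ^ 2 :=
      pow_le_pow_left₀ (by positivity) (by linarith) 2
    nlinarith
  refine hup.trans (h3.trans ?_)
  calc 12 * T ^ 2 = 72 * T ^ 4 * (1 / T * (1 / T / 6)) := by field_simp; ring
    _ ≤ _ := by gcongr

lemma exists_pow_two_bound {T : ℝ} (hT : 4 ≤ T) :
    ∃ n : ℕ, 72 * T ^ 4 ≤ 2 ^ n ∧ n * Real.log 2 ≤ 8 * Real.log T := by
  have hT0 : 0 < T := by linarith
  have hl2 : 0 < Real.log 2 := Real.log_pos one_lt_two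
  refine ⟨⌈Real.log (72 * T ^ 4) / Real.log 2⌉₊, ?_, ?_⟩
  · rw [← Real.log_le_log_iff (by positivity) (by positivity), Real.log_pow, ← div_le_iff₀ hl2]
    exact Nat.le_ceil _
  · have h1 : (⌈Real.log (72 * T ^ 4) / Real.log 2⌉₊ : ℝ) ≤ Real.log (72 * T ^ 4) / Real.log 2 + 1 := by
      refine (Nat.ceil_lt_add_one ?_).le
      exact div_nonneg (Real.log_nonneg (by nlinarith [one_le_pow₀ (n := 4) (show 1 ≤ T by linarith)])) hl2.le
    have h2 : (⌈Real.log (72 * T ^ 4) / Real.log 2⌉₊ : ℝ) * Real.log 2 ≤ Real.log (72 * T ^ 4) + Real.log 2 := by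
      calc _ ≤ (Real.log (72 * T ^ 4) / Real.log 2 + 1) * Real.log 2 := by gcongr
        _ = _ := by field_simp
    refine h2.trans ?_
    rw [← Real.log_mul (by positivity) (by norm_num)]
    have : 8 * Real.log T = Real.log (T ^ 8) := by rw [Real.log_pow]; push_cast; ring
    rw [this]
    refine Real.log_le_log (by positivity) ?_
    have : (4:ℝ) ^ 4 ≤ T ^ 4 := pow_le_pow_left₀ (by norm_num) hT 4
    nlinarith [pow_pos hT0 4]

lemma hasDerivAt_shift (s₀ : ℂ) : deriv (fun z => riemannZeta₁ (s₀ + z)) 0 = deriv riemannZeta₁ s₀ := by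
  rw [deriv_comp_const_add, add_zero]

/-- Landau bounds for the logarithmic derivative of `(s-1)ζ(s)` to the right of the line `Re s = 1`. -/
lemma re_logDeriv_lower {σ t T : ℝ} (hT : 4 ≤ T) (h1 : 1 + 1 / T ≤ σ) (h2 : σ ≤ 2)
    (ht : |t| ≤ T) (ht1 : 1 / T ≤ |t|) :
    -(64 * Real.log T) ≤ (deriv riemannZeta₁ (σ + t * I) / riemannZeta₁ (σ + t * I)).re ∧
    ∀ β : ℝ, β < σ → σ - β ≤ 1 / 4 → riemannZeta₁ (β + t * I) = 0 →
      1 / (σ - β) - 1 - 64 * Real.log T ≤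
        (deriv riemannZeta₁ (σ + t * I) / riemannZeta₁ (σ + t * I)).re := by
  have hT0 : 0 < T := by linarith
  have hT1 : 0 < 1 / T := by positivity
  obtain ⟨n, hn1, hn2⟩ := exists_pow_two_bound hT
  have hd : 1 / T ≤ ‖(σ + t * I - 1 : ℂ)‖ := by
    have := Complex.abs_im_le_norm (σ + t * I - 1 : ℂ)
    simp at this
    rw [one_div] at ht1 ⊢
    exact ht1.trans this
  have hf : Differentiable ℂ (fun z => riemannZeta₁ (σ + t * I + z)) :=
    differentiable_riemannZeta₁.comp (differentiable_id.const_add _)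
  have hf0 : (fun z => riemannZeta₁ (σ + t * I + z)) 0 ≠ 0 := by
    simp only [add_zero]
    exact riemannZeta₁_ne_zero_of_one_le_re (by simp; linarith)
  have hB : ∀ z, ‖z‖ ≤ 1 / 2 → ‖(fun z => riemannZeta₁ (σ + t * I + z)) z‖ ≤
      2 ^ n * ‖(fun z => riemannZeta₁ (σ + t * I + z)) 0‖ := by
    intro z hz
    simp only [add_zero]
    exact (riemannZeta₁_growth_ratio hT h1 h2 ht hd hz).trans (by gcongr)
  have hz : ∀ z : ℂ, ‖z‖ ≤ 1 / 2 / 2 → (fun z => riemannZeta₁ (σ + t * I + z)) z = 0 → z.re < 0 := by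
    intro z _ h
    by_contra hc
    exact riemannZeta₁_ne_zero_of_one_le_re (by simp; linarith) h
  have e : 4 * (n : ℝ) * Real.log 2 / (1/2) = 8 * (n * Real.log 2) := by ring
  constructor
  · have := landau_lower n hf (R := 1/2) (by norm_num) hf0 hB hz
    rw [e, hasDerivAt_shift] at this
    simp only [add_zero] at this
    linarith
  · intro β hβ hβ2 hzero
    have hfa : (fun z => riemannZeta₁ (σ + t * I + z)) (-((σ - β : ℝ) : ℂ)) = 0 := by
      simp only
      rw [← hzero]; congr 1; push_cast; ring
    have := landau_lower_with_zero n hf (R := 1/2) (by norm_num) hf0 hB hz (a := σ - β) (by linarith)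
      (by linarith) hfa
    rw [e, hasDerivAt_shift] at this
    simp only [add_zero] at this
    have h4 : (σ - β) / (1/2)^2 ≤ 1 := by
      rw [div_le_one (by norm_num)]; linarith
    linarith

lemma exists_neg_logDeriv_real_le : ∃ C : ℝ, 0 < C ∧ ∀ σ : ℝ, 1 < σ → σ ≤ 2 →
    (-deriv riemannZeta σ / riemannZeta σ).re ≤ 1 / (σ - 1) + C := by
  have hcont : ContinuousOn (fun σ : ℝ => ‖deriv riemannZeta₁ σ / riemannZeta₁ σ‖) (Set.Icc 1 2) := by
    have hd : Continuous (deriv riemannZeta₁) := by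
      have := differentiable_riemannZeta₁.contDiff (n := 1)
      exact this.continuous_deriv le_rfl
    refine ContinuousOn.norm (ContinuousOn.div ?_ ?_ ?_)
    · exact (hd.comp Complex.continuous_ofReal).continuousOn
    · exact (differentiable_riemannZeta₁.continuous.comp Complex.continuous_ofReal).continuousOn
    · intro σ hσ
      exact riemannZeta₁_ne_zero_of_one_le_re (by simpa using hσ.1)
  obtain ⟨C, hC⟩ := isCompact_Icc.bddAbove_image hcont
  refine ⟨max C 1, by positivity, fun σ h1 h2 => ?_⟩
  have h3 : ‖deriv riemannZeta₁ σ / riemannZeta₁ σ‖ ≤ C := hC ⟨σ, ⟨h1.le, h2⟩, rfl⟩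
  have h4 := logDeriv_riemannZeta₁ (s := (σ : ℂ)) (by simpa using h1)
  have h5 : -deriv riemannZeta σ / riemannZeta σ = 1 / (σ - 1 : ℂ) -
      deriv riemannZeta₁ σ / riemannZeta₁ σ := by rw [h4, neg_div]; ring
  rw [h5, Complex.sub_re]
  have h6 : (1 / (σ - 1 : ℂ)).re = 1 / (σ - 1) := by
    have : (1 / (σ - 1 : ℂ)) = ((1 / (σ - 1) : ℝ) : ℂ) := by push_cast; rfl
    rw [this, Complex.ofReal_re]
  rw [h6]
  have h7 := Complex.abs_re_le_norm (deriv riemannZeta₁ σ / riemannZeta₁ σ)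
  have h8 := neg_abs_le (deriv riemannZeta₁ σ / riemannZeta₁ σ).re
  have := le_max_left C 1
  linarith

lemma neg_logDeriv_le {σ t : ℝ} (hσ : 1 < σ) (ht : 1 ≤ |t|) :
    (-deriv riemannZeta (σ + t * I) / riemannZeta (σ + t * I)).re ≤
      1 - (deriv riemannZeta₁ (σ + t * I) / riemannZeta₁ (σ + t * I)).re := by
  have h4 := logDeriv_riemannZeta₁ (s := (σ + t * I : ℂ)) (by simpa using hσ)
  have h5 : -deriv riemannZeta (σ + t * I) / riemannZeta (σ + t * I) = 1 / (σ + t * I - 1 : ℂ) -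
      deriv riemannZeta₁ (σ + t * I) / riemannZeta₁ (σ + t * I) := by rw [h4, neg_div]; ring
  rw [h5, Complex.sub_re]
  have h6 : (1 / (σ + t * I - 1 : ℂ)).re ≤ 1 := by
    refine (Complex.re_le_norm _).trans ?_
    rw [norm_div, norm_one]
    have := Complex.abs_im_le_norm (σ + t * I - 1 : ℂ)
    simp at this
    rw [div_le_one (by linarith)]; linarith
  linarith

/-- The classical zero-free region, for ordinates bounded away from zero. -/
lemma zero_free_high : ∃ T₀ : ℝ, 4 ≤ T₀ ∧ ∀ T, T₀ ≤ T → ∀ β t : ℝ, 1 ≤ |t| → 2 * |t| ≤ T →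
    1 - 1 / (8400 * Real.log T) ≤ β → riemannZeta₁ (β + t * I) ≠ 0 := by
  obtain ⟨C, hC0, hC⟩ := exists_neg_logDeriv_real_le
  have ev : ∀ᶠ T : ℝ in Filter.atTop, 4 ≤ T ∧ 3 * C + 9 ≤ 160 * 1 * (Real.log T / 100) ∧ 600 * Real.log T ≤ T := by
    have h1 : Filter.Tendsto (fun T => 160 * 1 * (Real.log T / 100)) Filter.atTop Filter.atTop :=
      (Real.tendsto_log_atTop.atTop_div_const (by norm_num)).const_mul_atTop (by norm_num)
    have h2 := Real.isLittleO_log_id_atTop.bound (c := 1/600) (by norm_num)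
    filter_upwards [Filter.eventually_ge_atTop 4, h1.eventually_ge_atTop _, h2] with T h3 h4 h5
    refine ⟨h3, h4, ?_⟩
    simp only [id, Real.norm_of_nonneg (show 0 ≤ T by linarith)] at h5
    have := Real.le_norm_self (Real.log T)
    linarith
  obtain ⟨T₀, hT₀⟩ := Filter.eventually_atTop.1 ev
  refine ⟨max T₀ 4, le_max_right _ _, fun T hT β t ht1 htT hβ h => ?_⟩
  obtain ⟨hT4, hlogC, hlogT⟩ := hT₀ T (le_trans (le_max_left _ _) hT)
  have hβ1 : β < 1 := by
    by_contra hc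
    exact riemannZeta₁_ne_zero_of_one_le_re (by simpa using hc) h
  set Lg := Real.log T with hLg
  have hLg1 : 1 ≤ Lg := by
    rw [hLg, Real.le_log_iff_exp_le (by linarith)]
    have := Real.exp_one_lt_d9; linarith
  have hT0 : 0 < T := by linarith
  set σ := 1 + 1 / (600 * Lg) with hσ
  have hδ : 0 < 1 / (600 * Lg) := by positivity
  have hδ2 : 1 / (600 * Lg) ≤ 1 / 600 := by
    apply one_div_le_one_div_of_le <;> linarith
  have hδT : 1 / T ≤ 1 / (600 * Lg) := one_div_le_one_div_of_le (by positivity) hlogT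
  have hT4' : 1 / T ≤ 1 := by rw [div_le_one hT0]; linarith
  have hb2 : 1 / (8400 * Lg) ≤ 1 / 8400 := by
    apply one_div_le_one_div_of_le <;> linarith
  have hA := (re_logDeriv_lower hT4 (σ := σ) (t := t) (by linarith) (by linarith) (by
    have := abs_nonneg t; linarith) (by linarith)).2 β (by linarith) (by linarith) h
  have hBd := (re_logDeriv_lower hT4 (σ := σ) (t := 2 * t) (by linarith) (by linarith) (by
    rw [abs_mul, abs_two]; linarith) (by rw [abs_mul, abs_two]; linarith)).1
  have h341 := three_four_one (σ := σ) (t := t) (by linarith)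
  have e1 := hC σ (by linarith) (by linarith)
  have e2 := neg_logDeriv_le (σ := σ) (t := t) (by linarith) ht1
  have e3 := neg_logDeriv_le (σ := σ) (t := 2 * t) (by linarith) (by rw [abs_mul, abs_two]; linarith)
  have e4 : 1 / (σ - 1) = 600 * Lg := by
    rw [hσ, add_sub_cancel_left, one_div_one_div]
  rw [e4] at e1
  have h5 : 4 / (σ - β) ≤ 2140 * Lg := by
    have : 4 / (σ - β) = 4 * (1 / (σ - β)) := by ring
    rw [this]
    rw [← hLg] at hA hBd
    linarith
  have hpos : 0 < σ - β := by linarith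
  rw [div_le_iff₀ hpos] at h5
  have h6 : σ - β ≤ 1 / (600 * Lg) + 1 / (8400 * Lg) := by linarith
  have h7 : 2140 * Lg * (σ - β) ≤ 2140 * Lg * (1 / (600 * Lg) + 1 / (8400 * Lg)) := by gcongr
  have h8 : 2140 * Lg * (1 / (600 * Lg) + 1 / (8400 * Lg)) = 2140/600 + 2140/8400 := by
    field_simp
  rw [h8] at h7
  norm_num at h7
  linarith

lemma zero_free_low : ∃ η : ℝ, 0 < η ∧ ∀ s : ℂ, |s.im| ≤ 1 → 1 - η ≤ s.re → riemannZeta₁ s ≠ 0 := by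
  set K : Set ℂ := (Set.Icc (0:ℝ) 1 ×ℂ Set.Icc (-1:ℝ) 1) ∩ {s | riemannZeta₁ s = 0} with hK
  have hcpt : IsCompact K := by
    refine (isCompact_Icc.reProdIm isCompact_Icc).inter_right ?_
    exact isClosed_eq differentiable_riemannZeta₁.continuous continuous_const
  have hlt : ∀ s : ℂ, riemannZeta₁ s = 0 → s.re < 1 := by
    intro s hs; by_contra hc; exact riemannZeta₁_ne_zero_of_one_le_re (not_lt.1 hc) hs
  by_cases hne : K.Nonempty
  · obtain ⟨m, hm, hmax⟩ := hcpt.exists_isMaxOn hne Complex.continuous_re.continuousOn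
    have hm1 := hlt m hm.2
    have hm0 : 0 ≤ m.re := hm.1.1.1
    refine ⟨(1 - m.re) / 2, by linarith, fun s him hre h => ?_⟩
    have h1 := hlt s h
    have hsK : s ∈ K := ⟨⟨⟨by linarith, h1.le⟩, abs_le.1 him⟩, h⟩
    have : s.re ≤ m.re := hmax hsK
    linarith
  · refine ⟨1, one_pos, fun s him hre h => hne ⟨s, ⟨⟨⟨by linarith, (hlt s h).le⟩, abs_le.1 him⟩, h⟩⟩⟩

lemma zero_free : ∃ T₀ : ℝ, 4 ≤ T₀ ∧ ∀ T, T₀ ≤ T → ∀ s : ℂ, 2 * |s.im| ≤ T →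
    1 - 1 / (8400 * Real.log T) ≤ s.re → riemannZeta₁ s ≠ 0 := by
  obtain ⟨η, hη, hlow⟩ := zero_free_low
  obtain ⟨T₀, hT4, hhigh⟩ := zero_free_high
  have ev := (Real.tendsto_log_atTop.eventually_ge_atTop (1 / (8400 * η)))
  obtain ⟨T₁, hT₁⟩ := Filter.eventually_atTop.1 ev
  refine ⟨max T₀ T₁, hT4.trans (le_max_left _ _), fun T hT s him hre => ?_⟩
  by_cases h1 : |s.im| ≤ 1
  · refine hlow s h1 ?_
    have h2 := hT₁ T (le_trans (le_max_right _ _) hT)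
    have h3 : 0 < 1 / (8400 * η) := by positivity
    have h4 : 1 / (8400 * Real.log T) ≤ η := by
      rw [div_le_iff₀ (by linarith)]
      rw [div_le_iff₀ (by positivity)] at h2
      linarith
    linarith
  · have := hhigh T (le_trans (le_max_left _ _) hT) s.re s.im (not_le.1 h1).le him hre
    rwa [Complex.re_add_im] at this

lemma inv_riemannZeta₁_bound : ∃ U₀ : ℝ, 4 ≤ U₀ ∧ ∀ U, U₀ ≤ U → ∀ s : ℂ, 4 * |s.im| ≤ U →
    |s.re - 1| ≤ 1 / (1680000 * Real.log U) →
    riemannZeta₁ s ≠ 0 ∧ max 1 |s.im| * ‖riemannZeta₁ s‖⁻¹ ≤ U ^ (1 / 2 : ℝ) := by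
  obtain ⟨T₀, hT4, hzf⟩ := zero_free
  have ev : ∀ᶠ U : ℝ in Filter.atTop, Real.log U ≤ (1 / 100000000) * U ^ (1 / 16 : ℝ) := by
    have h := (isLittleO_log_rpow_atTop (show (0:ℝ) < 1/16 by norm_num)).bound
      (c := 1 / 100000000) (by norm_num)
    filter_upwards [h, Filter.eventually_ge_atTop 0] with U hU hU0
    rw [Real.norm_of_nonneg (Real.rpow_nonneg hU0 _)] at hU
    exact (Real.le_norm_self _).trans hU
  obtain ⟨U₁, hU₁⟩ := Filter.eventually_atTop.1 ev
  refine ⟨max T₀ U₁, hT4.trans (le_max_left _ _), fun U hU s him hre => ?_⟩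
  have hUT : T₀ ≤ U := le_trans (le_max_left _ _) hU
  have hU4 : 4 ≤ U := hT4.trans hUT
  have hU0 : 0 < U := by linarith
  have hlog := hU₁ U (le_trans (le_max_right _ _) hU)
  set Lg := Real.log U with hLg
  have hLg1 : 1 ≤ Lg := by
    rw [hLg, Real.le_log_iff_exp_le hU0]
    have := Real.exp_one_lt_d9; linarith
  set r := 1 / (8400 * Lg) with hr
  set θ := 1 / (1680000 * Lg) with hθ
  have hr0 : 0 < r := by positivity
  have hrθ : r = 200 * θ := by rw [hr, hθ]; field_simp; norm_num
  have hθ0 : 0 < θ := by positivity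
  have hr1 : r ≤ 1 / 8400 := by
    apply one_div_le_one_div_of_le <;> linarith
  have hX : U ^ (1/16 : ℝ) ≤ U := by
    conv_rhs => rw [← Real.rpow_one U]
    exact Real.rpow_le_rpow_of_exponent_le (by linarith) (by norm_num)
  have hθU : 1 / U ≤ θ := by
    apply one_div_le_one_div_of_le (by positivity); linarith
  have hsr := abs_le.1 hre
  have hzfree : ∀ z : ℂ, ‖z‖ < r → riemannZeta₁ (((1 + θ : ℝ) : ℂ) + s.im * I + z) ≠ 0 := by
    intro z hz
    have h1 := Complex.abs_re_le_norm z
    have h2 := Complex.abs_im_le_norm z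
    have h3 := neg_abs_le z.re
    refine hzf U hUT _ ?_ ?_
    · have : (((1 + θ : ℝ) : ℂ) + s.im * I + z).im = s.im + z.im := by simp
      rw [this]
      have := abs_add_le s.im z.im
      linarith
    · have : (((1 + θ : ℝ) : ℂ) + s.im * I + z).re = 1 + θ + z.re := by simp
      rw [this]; linarith
  have hd : max θ |s.im| ≤ ‖(((1 + θ : ℝ) : ℂ) + s.im * I - 1 : ℂ)‖ := by
    have h1 := Complex.abs_im_le_norm (((1 + θ : ℝ) : ℂ) + s.im * I - 1)
    have h2 := Complex.abs_re_le_norm (((1 + θ : ℝ) : ℂ) + s.im * I - 1)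
    have e1 : (((1 + θ : ℝ) : ℂ) + s.im * I - 1).im = s.im := by simp
    have e2 : (((1 + θ : ℝ) : ℂ) + s.im * I - 1).re = θ := by simp
    rw [e1] at h1; rw [e2, abs_of_pos hθ0] at h2
    exact max_le h2 h1
  have hB : ∀ z, ‖z‖ < r → ‖(fun z => riemannZeta₁ (((1 + θ : ℝ) : ℂ) + s.im * I + z)) z‖ ≤
      72 * U ^ 4 * ‖(fun z => riemannZeta₁ (((1 + θ : ℝ) : ℂ) + s.im * I + z)) 0‖ := by
    intro z hz
    simp only [add_zero]
    exact riemannZeta₁_growth_ratio hU4 (by linarith) (by linarith)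
      (by have := abs_nonneg s.im; linarith)
      (hθU.trans ((le_max_left _ _).trans hd)) (by linarith)
  have hU44 : (256 : ℝ) ≤ U ^ 4 := by
    have : (4:ℝ) ^ 4 ≤ U ^ 4 := pow_le_pow_left₀ (by norm_num) hU4 4
    norm_num at this; exact this
  have hf : Differentiable ℂ (fun z => riemannZeta₁ (((1 + θ : ℝ) : ℂ) + s.im * I + z)) :=
    differentiable_riemannZeta₁.comp (differentiable_id.const_add _)
  obtain ⟨L, -, -, hL, hLb⟩ := norm_logDeriv_le_of_ne_zero hf hr0 (M := 72 * U ^ 4)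
    (by linarith) hB hzfree
  have hlogM : Real.log (72 * U ^ 4) < 8 * Lg := by
    have : 8 * Lg = Real.log (U ^ 8) := by rw [Real.log_pow]; push_cast; ring
    rw [this]
    refine Real.log_lt_log (by positivity) ?_
    nlinarith
  set z : ℂ := ((s.re - 1 - θ : ℝ) : ℂ) with hz
  have hzn : ‖z‖ ≤ 2 * θ := by
    rw [hz, Complex.norm_real, Real.norm_eq_abs, abs_le]
    constructor <;> linarith
  have hzr : ‖z‖ < r := by rw [hrθ]; linarith
  have hs : (((1 + θ : ℝ) : ℂ) + s.im * I + z) = s := by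
    rw [hz]
    apply Complex.ext <;> simp
  have e1 := hL z hzr
  simp only [add_zero, hs] at e1
  have hLz : ‖L z‖ ≤ Lg / 4 := by
    refine (hLb z hzr _ hlogM).trans ?_
    have h1 : 2 * (8 * Lg) * ‖z‖ / (r - ‖z‖) ≤ 2 * (8 * Lg) * (2 * θ) / (198 * θ) := by
      gcongr
      · rw [hrθ]; linarith
    refine h1.trans ?_
    have : 2 * (8 * Lg) * (2 * θ) / (198 * θ) = 32 / 198 * Lg := by field_simp; ring
    rw [this]; linarith
  refine ⟨by have := hzfree z hzr; rwa [hs] at this, ?_⟩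
  have hlow := riemannZeta₁_lower (s := ((1 + θ : ℝ) : ℂ) + s.im * I) (by simpa using hθ0)
    (by simp; linarith)
  have e2 : (((1 + θ : ℝ) : ℂ) + s.im * I).re - 1 = θ := by simp
  rw [e2] at hlow
  have hexp : U ^ (-(1/4) : ℝ) ≤ ‖cexp (L z)‖ := by
    rw [Complex.norm_exp, Real.rpow_def_of_pos hU0, ← hLg]
    apply Real.exp_le_exp.2
    have := Complex.abs_re_le_norm (L z)
    have := neg_abs_le (L z).re
    linarith
  have hmax : θ * max 1 |s.im| ≤ max θ |s.im| := by
    rcases le_total 1 |s.im| with h | h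
    · rw [max_eq_right h]
      refine le_trans ?_ (le_max_right _ _)
      have : θ ≤ 1 := by linarith
      nlinarith [abs_nonneg s.im]
    · rw [max_eq_left h, mul_one]; exact le_max_left _ _
  have hm0 : 0 < max 1 |s.im| := lt_of_lt_of_le one_pos (le_max_left _ _)
  have hfin : θ * max 1 |s.im| * (θ / 6) * U ^ (-(1/4) : ℝ) ≤ ‖riemannZeta₁ s‖ := by
    rw [e1, norm_mul]
    refine mul_le_mul ?_ hexp (Real.rpow_nonneg hU0.le _) (norm_nonneg _)
    refine le_trans ?_ hlow
    exact mul_le_mul_of_nonneg_right (hmax.trans hd) (by positivity)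
  have hpos : 0 < θ * max 1 |s.im| * (θ / 6) * U ^ (-(1/4) : ℝ) := by positivity
  rw [← div_eq_mul_inv]
  rw [div_le_iff₀ (lt_of_lt_of_le hpos hfin)]
  refine le_trans ?_ (mul_le_mul_of_nonneg_left hfin (Real.rpow_nonneg hU0.le _))
  have hUp : U ^ (1/2 : ℝ) * U ^ (-(1/4) : ℝ) = (U ^ (1/16 : ℝ)) ^ 4 := by
    rw [← Real.rpow_add hU0, ← Real.rpow_natCast, ← Real.rpow_mul hU0.le]; norm_num
  have hX1 : 1 ≤ U ^ (1/16 : ℝ) := Real.one_le_rpow (by linarith) (by norm_num)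
  set X := U ^ (1/16 : ℝ) with hXdef
  have hθX : 1 / (X / 50) ≤ θ := by
    apply one_div_le_one_div_of_le (by positivity); linarith
  have hkey : 1 ≤ X ^ 4 * θ ^ 2 / 6 := by
    have h1 : (1 / (X / 50)) ^ 2 ≤ θ ^ 2 := pow_le_pow_left₀ (by positivity) hθX 2
    have h2 : X ^ 4 * (1 / (X / 50)) ^ 2 = 2500 * X ^ 2 := by field_simp; norm_num
    have h3 : X ^ 4 * (1 / (X / 50)) ^ 2 ≤ X ^ 4 * θ ^ 2 := by gcongr
    nlinarith
  calc max 1 |s.im| = max 1 |s.im| * 1 := by ring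
    _ ≤ max 1 |s.im| * (X ^ 4 * θ ^ 2 / 6) := by gcongr
    _ = _ := by rw [← hUp]; ring

/-- The hat kernel `max (1 - t) 0`. -/
noncomputable def hatKernel (t : ℝ) : ℂ := ((max (1 - t) 0 : ℝ) : ℂ)

lemma hasMellin_hatKernel {s : ℂ} (hs : 0 < s.re) : HasMellin hatKernel s (1 / (s * (s + 1))) := by
  have h1 := hasMellin_one_Ioc hs
  have h2 := hasMellin_cpow_Ioc (a := 1) (s := s) (by simp; linarith)
  have h3 := hasMellin_sub h1.1 h2.1
  have hs0 : s ≠ 0 := by rintro rfl; simp at hs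
  have hs1 : s + 1 ≠ 0 := by
    intro h
    have := congrArg Complex.re h
    simp at this; linarith
  rw [h1.2, h2.2] at h3
  have e : 1 / s - 1 / (s + 1) = 1 / (s * (s + 1)) := by field_simp; ring
  rw [e] at h3
  have hEq : Set.EqOn (fun t => (Set.Ioc 0 1).indicator (fun _ => (1:ℂ)) t -
      (Set.Ioc 0 1).indicator (fun t : ℝ => (t:ℂ) ^ (1:ℂ)) t) hatKernel (Set.Ioi 0) := by
    intro t ht
    have ht0 : (0:ℝ) < t := ht
    simp only [Set.indicator_apply, hatKernel, Set.mem_Ioc, ht0, true_and, Complex.cpow_one]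
    split_ifs with h
    · rw [max_eq_left (by linarith)]; push_cast; rfl
    · rw [max_eq_right (by linarith)]; simp
  have hcong : ∀ t ∈ Set.Ioi (0:ℝ), (t:ℂ) ^ (s - 1) • ((Set.Ioc 0 1).indicator (fun _ => (1:ℂ)) t -
      (Set.Ioc 0 1).indicator (fun t : ℝ => (t:ℂ) ^ (1:ℂ)) t) = (t:ℂ) ^ (s - 1) • hatKernel t := by
    intro t ht
    rw [← hEq ht]
  constructor
  · exact IntegrableOn.congr_fun (μ := volume) h3.1 hcong measurableSet_Ioi
  · rw [← h3.2]
    exact (setIntegral_congr_fun measurableSet_Ioi hcong).symm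

lemma norm_inv_kernel_le {σ : ℝ} (hσ : 0 < σ) (hσ1 : σ ≤ 1) (y : ℝ) :
    ‖(1 / ((σ + y * I) * (σ + y * I + 1)) : ℂ)‖ ≤ σ⁻¹ * (1 + y ^ 2)⁻¹ := by
  rw [norm_div, norm_one, norm_mul, ← mul_inv, one_div]
  apply inv_anti₀ (by positivity)
  have h1 : ‖(σ + y * I : ℂ)‖ = √(σ ^ 2 + y ^ 2) := Complex.norm_add_mul_I σ y
  have h2 : ‖(σ + y * I + 1 : ℂ)‖ = √((σ + 1) ^ 2 + y ^ 2) := by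
    rw [← Complex.norm_add_mul_I]; congr 1; push_cast; ring
  rw [h1, h2]
  have h3 : σ * √(1 + y ^ 2) ≤ √(σ ^ 2 + y ^ 2) := by
    apply Real.le_sqrt_of_sq_le
    rw [mul_pow, Real.sq_sqrt (by positivity)]
    nlinarith [sq_nonneg y, mul_nonneg (sq_nonneg y) (show 0 ≤ 1 - σ ^ 2 by nlinarith)]
  have h4 : √(1 + y ^ 2) ≤ √((σ + 1) ^ 2 + y ^ 2) := Real.sqrt_le_sqrt (by nlinarith)
  calc σ * (1 + y ^ 2) = (σ * √(1 + y ^ 2)) * √(1 + y ^ 2) := by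
        rw [mul_assoc, Real.mul_self_sqrt (by positivity)]
    _ ≤ _ := by gcongr

lemma integrable_inv_kernel {σ : ℝ} (hσ : 0 < σ) (hσ1 : σ ≤ 1) :
    Integrable (fun y : ℝ => (1 / ((σ + y * I) * (σ + y * I + 1)) : ℂ)) := by
  refine (integrable_inv_one_add_sq.const_mul σ⁻¹).mono' ?_ (Filter.Eventually.of_forall
    (norm_inv_kernel_le hσ hσ1))
  apply Measurable.aestronglyMeasurable
  fun_prop

lemma hatKernel_inversion {σ : ℝ} (hσ : 0 < σ) (hσ1 : σ ≤ 1) {v : ℝ} (hv : 0 < v) :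
    hatKernel v = (1 / (2 * π) : ℝ) • ∫ y : ℝ, (v : ℂ) ^ (-(σ + y * I : ℂ)) *
      (1 / ((σ + y * I) * (σ + y * I + 1))) := by
  have hm : ∀ y : ℝ, mellin hatKernel (σ + y * I) = 1 / ((σ + y * I) * (σ + y * I + 1)) := fun y =>
    (hasMellin_hatKernel (by simpa using hσ)).2
  have hc : ContinuousAt hatKernel v := by
    unfold hatKernel
    fun_prop
  have h := mellinInv_mellin_eq σ hatKernel hv (hasMellin_hatKernel (by simpa using hσ)).1
    (by
      unfold VerticalIntegrable
      simp_rw [hm]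
      exact integrable_inv_kernel hσ hσ1) hc
  rw [← h, mellinInv]
  simp_rw [hm]
  simp [smul_eq_mul]

/-- The smoothed sum `∑ μ(n)/n (1 - n/x)_+`. -/
noncomputable def smoothMoebius (x : ℝ) : ℝ :=
  ∑ n ∈ Finset.range (⌊x⌋₊ + 1), (ArithmeticFunction.moebius n : ℝ) / n * (1 - n / x)

lemma smoothMoebius_eq_tsum {x : ℝ} (hx : 0 < x) :
    HasSum (fun n : ℕ => ((ArithmeticFunction.moebius n : ℝ) / n : ℂ) * hatKernel (n / x))
      (smoothMoebius x : ℂ) := by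
  have h : HasSum (fun n : ℕ => ((ArithmeticFunction.moebius n : ℝ) / n : ℂ) * hatKernel (n / x))
      (∑ n ∈ Finset.range (⌊x⌋₊ + 1),
        ((ArithmeticFunction.moebius n : ℝ) / n : ℂ) * hatKernel (n / x)) := by
    refine hasSum_sum_of_ne_finset_zero fun n hn => ?_
    have hn' : ⌊x⌋₊ < n := by simpa [Nat.lt_succ_iff] using hn
    have : x < n := (Nat.floor_lt hx.le).1 hn'
    have h1 : 1 ≤ (n : ℝ) / x := (one_le_div hx).2 this.le
    unfold hatKernel
    rw [max_eq_right (by linarith)]; simp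
  · convert h using 1
    unfold smoothMoebius hatKernel
    push_cast
    refine Finset.sum_congr rfl fun n hn => ?_
    have hn' : n ≤ ⌊x⌋₊ := by simpa [Nat.lt_succ_iff] using hn
    have : (n : ℝ) ≤ x := (Nat.le_floor_iff hx.le).1 hn'
    have h1 : (n : ℝ) / x ≤ 1 := (div_le_one hx).2 this
    rw [max_eq_left (by linarith)]
    push_cast; rfl

/-- The integrand of the Perron formula. -/
noncomputable def perronKernel (x : ℝ) (s : ℂ) : ℂ := (x : ℂ) ^ s / ((s + 1) * riemannZeta₁ (1 + s))

lemma perronKernel_eq_tsum {x : ℝ} (hx : 0 < x) {s : ℂ} (hs : 0 < s.re) :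
    ∑' n : ℕ, ((ArithmeticFunction.moebius n : ℝ) / n : ℂ) * (((n / x : ℝ) : ℂ) ^ (-s) *
      (1 / (s * (s + 1)))) = perronKernel x s := by
  have hs1 : 1 < (1 + s).re := by simpa using hs
  have hs0 : s ≠ 0 := by rintro rfl; simp at hs
  have h1 := LSeries_one_mul_Lseries_moebius hs1
  rw [LSeries_one_eq_riemannZeta hs1] at h1
  have hz := riemannZeta_ne_zero_of_one_le_re hs1.le
  have h2 : LSeries (fun n => ((ArithmeticFunction.moebius n : ℤ) : ℂ)) (1 + s) = 1 / riemannZeta (1 + s) := by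
    field_simp; rw [mul_comm]; exact h1
  have h3 : riemannZeta₁ (1 + s) = s * riemannZeta (1 + s) := by
    rw [riemannZeta₁_eq (1 + s) (by simpa using hs0)]; ring
  have hxc : (x : ℂ) ≠ 0 := by exact_mod_cast hx.ne'
  have hterm : ∀ n : ℕ, ((ArithmeticFunction.moebius n : ℝ) / n : ℂ) * (((n / x : ℝ) : ℂ) ^ (-s) *
      (1 / (s * (s + 1)))) = ((x : ℂ) ^ s * (1 / (s * (s + 1)))) *
        LSeries.term (fun n => ((ArithmeticFunction.moebius n : ℤ) : ℂ)) (1 + s) n := by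
    intro n
    rcases eq_or_ne n 0 with rfl | hn
    · simp
    · have hn0 : (0:ℝ) < n := by exact_mod_cast Nat.pos_of_ne_zero hn
      have hnc : (n : ℂ) ≠ 0 := by exact_mod_cast hn
      rw [LSeries.term_of_ne_zero hn, Complex.cpow_add _ _ hnc, Complex.cpow_one]
      have : ((n / x : ℝ) : ℂ) ^ (-s) = (x : ℂ) ^ s / (n : ℂ) ^ s := by
        rw [Complex.ofReal_div, Complex.div_cpow_ofReal_nonneg hn0.le hx.le, Complex.cpow_neg,
          Complex.cpow_neg, Complex.ofReal_natCast]
        field_simp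
      rw [this]
      push_cast
      have : (n : ℂ) ^ s ≠ 0 := by simp [Complex.cpow_eq_zero_iff, hnc]
      field_simp
  simp_rw [hterm]
  rw [tsum_mul_left]
  have h4 : ∑' n, LSeries.term (fun n => ((ArithmeticFunction.moebius n : ℤ) : ℂ)) (1 + s) n =
    1 / riemannZeta (1 + s) := h2
  rw [h4, perronKernel, h3]
  have hs1' : s + 1 ≠ 0 := by
    intro h
    have := congrArg Complex.re h
    simp at this; linarith
  field_simp

lemma smoothMoebius_perron {x σ : ℝ} (hx : 0 < x) (hσ : 0 < σ) (hσ1 : σ ≤ 1) :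
    (smoothMoebius x : ℂ) = (1 / (2 * π) : ℝ) • ∫ y : ℝ, perronKernel x (σ + y * I) := by
  set F : ℕ → ℝ → ℂ := fun n y => ((ArithmeticFunction.moebius n : ℝ) / n : ℂ) *
    (((n / x : ℝ) : ℂ) ^ (-(σ + y * I : ℂ)) * (1 / ((σ + y * I) * (σ + y * I + 1)))) with hF
  have hnorm : ∀ n y, ‖F n y‖ = (‖((ArithmeticFunction.moebius n : ℝ) / n : ℂ)‖ * ((n / x : ℝ)) ^ (-σ)) *
      ‖(1 / ((σ + y * I) * (σ + y * I + 1)) : ℂ)‖ := by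
    intro n y
    simp only [hF, norm_mul]
    rcases eq_or_ne n 0 with rfl | hn
    · simp
    · have hn0 : (0:ℝ) < n / x := div_pos (by exact_mod_cast Nat.pos_of_ne_zero hn) hx
      rw [Complex.norm_cpow_eq_rpow_re_of_pos hn0]
      have : (-(σ + y * I : ℂ)).re = -σ := by simp
      rw [this]; ring
  have hInt0 := integrable_inv_kernel hσ hσ1
  have hFint : ∀ n, Integrable (F n) := by
    intro n
    refine (hInt0.norm.const_mul
      (‖((ArithmeticFunction.moebius n : ℝ) / n : ℂ)‖ * ((n / x : ℝ)) ^ (-σ))).mono' ?_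
      (Filter.Eventually.of_forall fun y => (hnorm n y).le)
    apply Measurable.aestronglyMeasurable
    simp only [hF]
    fun_prop
  have hsum : Summable fun n => ∫ y, ‖F n y‖ := by
    simp_rw [hnorm, integral_const_mul]
    refine Summable.mul_right _ ?_
    have h1 : Summable fun n : ℕ => x ^ σ * ((n : ℝ) ^ (1 + σ))⁻¹ :=
      (Real.summable_nat_rpow_inv.2 (by linarith)).mul_left _
    refine Summable.of_nonneg_of_le (fun n => by positivity) (fun n => ?_) h1
    rcases eq_or_ne n 0 with rfl | hn
    · simp; positivity
    · have hn0 : (0:ℝ) < n := by exact_mod_cast Nat.pos_of_ne_zero hn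
      have hm : ‖((ArithmeticFunction.moebius n : ℝ) / n : ℂ)‖ ≤ 1 / n := by
        rw [norm_div, Complex.norm_natCast, Complex.norm_real, Real.norm_eq_abs]
        gcongr
        exact_mod_cast ArithmeticFunction.abs_moebius_le_one
      refine (mul_le_mul_of_nonneg_right hm (by positivity)).trans (le_of_eq ?_)
      rw [Real.div_rpow hn0.le hx.le, Real.rpow_neg hn0.le, Real.rpow_neg hx.le, Real.rpow_add hn0,
        Real.rpow_one]
      field_simp
  have h := hasSum_integral_of_summable_integral_norm hFint hsum
  have h2 : ∀ y : ℝ, ∑' n, F n y = perronKernel x (σ + y * I) := fun y =>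
    perronKernel_eq_tsum hx (by simpa using hσ)
  simp_rw [h2] at h
  have h3 := h.const_smul (1 / (2 * π) : ℝ)
  refine (smoothMoebius_eq_tsum hx).unique ?_
  have hfun : (fun n : ℕ => ((ArithmeticFunction.moebius n : ℝ) / n : ℂ) * hatKernel (n / x)) =
      fun n => (1 / (2 * π) : ℝ) • ∫ y, F n y := by
    funext n
    rcases eq_or_ne n 0 with rfl | hn
    · simp [hF]
    · have hn0 : (0:ℝ) < n / x := div_pos (by exact_mod_cast Nat.pos_of_ne_zero hn) hx
      rw [hatKernel_inversion hσ hσ1 hn0]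
      simp only [hF]
      rw [integral_const_mul, mul_smul_comm]
  rw [hfun]
  exact h3

lemma perronKernel_integrable {x σ : ℝ} (hx : 0 < x) (hσ : 0 < σ) (hσ1 : σ ≤ 1) :
    (∀ y : ℝ, ‖perronKernel x (σ + y * I)‖ ≤ x ^ σ * (6 / σ) * ‖(1 / ((σ + y * I) * (σ + y * I + 1)) : ℂ)‖) ∧
    Integrable (fun y : ℝ => perronKernel x (σ + y * I)) := by
  have hb : ∀ y : ℝ, ‖perronKernel x (σ + y * I)‖ ≤
      x ^ σ * (6 / σ) * ‖(1 / ((σ + y * I) * (σ + y * I + 1)) : ℂ)‖ := by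
    intro y
    have hre : (1 + (σ + y * I : ℂ)).re = 1 + σ := by simp
    have h1 := inv_riemannZeta_bound (s := 1 + (σ + y * I)) (by rw [hre]; linarith) (by rw [hre]; linarith)
    rw [hre, add_sub_cancel_left] at h1
    have hs0 : (σ + y * I : ℂ) ≠ 0 := by
      intro h; have := congrArg Complex.re h; simp at this; linarith
    rw [perronKernel, riemannZeta₁_eq _ (by simpa using hs0), add_sub_cancel_left, norm_div, norm_mul,
      norm_mul, Complex.norm_cpow_eq_rpow_re_of_pos hx, norm_div, norm_one, norm_mul]
    have e : (σ + y * I : ℂ).re = σ := by simp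
    rw [e]
    have hs1 : (σ + y * I + 1 : ℂ) ≠ 0 := by
      intro h; have := congrArg Complex.re h; simp at this; linarith
    have p1 := norm_pos_iff.2 hs0
    have p2 := norm_pos_iff.2 hs1
    have p3 : 0 < ‖riemannZeta (1 + (σ + y * I))‖ := lt_of_lt_of_le (by positivity) h1
    have h2 : 1 / ‖riemannZeta (1 + (σ + y * I))‖ ≤ 6 / σ := by
      rw [div_le_div_iff₀ p3 hσ]; linarith
    calc x ^ σ / (‖(σ + y * I + 1 : ℂ)‖ * (‖(σ + y * I : ℂ)‖ * ‖riemannZeta (1 + (σ + y * I))‖))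
        = x ^ σ * (1 / ‖riemannZeta (1 + (σ + y * I))‖) *
          (1 / (‖(σ + y * I : ℂ)‖ * ‖(σ + y * I + 1 : ℂ)‖)) := by field_simp
      _ ≤ _ := by gcongr
  refine ⟨hb, ((integrable_inv_kernel hσ hσ1).norm.const_mul (x ^ σ * (6 / σ))).mono' ?_
    (Filter.Eventually.of_forall hb)⟩
  apply Continuous.aestronglyMeasurable
  unfold perronKernel
  have hxc : (x : ℂ) ≠ 0 := by exact_mod_cast hx.ne'
  refine Continuous.div ?_ ?_ ?_
  · exact Continuous.const_cpow (by fun_prop) (Or.inl hxc)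
  · exact Continuous.mul (by fun_prop) (differentiable_riemannZeta₁.continuous.comp (by fun_prop))
  · intro y
    refine mul_ne_zero ?_ (riemannZeta₁_ne_zero_of_one_le_re (by simp; linarith))
    intro h; have := congrArg Complex.re h; simp at this; linarith

lemma norm_integral_Ioi_le_of_inv_sq {f : ℝ → ℂ} {M Y : ℝ} (hY : 0 < Y)
    (h : ∀ y, Y < y → ‖f y‖ ≤ M * y ^ (-2 : ℝ)) : ‖∫ y in Set.Ioi Y, f y‖ ≤ M / Y := by
  have h1 := norm_integral_le_of_norm_le (μ := volume.restrict (Set.Ioi Y)) (f := f)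
    ((integrableOn_Ioi_rpow_of_lt (show (-2:ℝ) < -1 by norm_num) hY).const_mul M)
    ((ae_restrict_iff' measurableSet_Ioi).2 (Filter.Eventually.of_forall h))
  refine h1.trans (le_of_eq ?_)
  rw [integral_const_mul, integral_Ioi_rpow_of_lt (by norm_num) hY]
  have : Y ^ (-2 + 1 : ℝ) = Y⁻¹ := by rw [← Real.rpow_neg_one]; norm_num
  rw [this]; norm_num; rfl

lemma norm_integral_sub_interval_le {f : ℝ → ℂ} (hf : Integrable f) {M Y : ℝ} (hY : 0 < Y)
    (h : ∀ y, Y < |y| → ‖f y‖ ≤ M * |y| ^ (-2 : ℝ)) :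
    ‖(∫ y, f y) - ∫ y in (-Y)..Y, f y‖ ≤ 2 * M / Y := by
  have h1 := intervalIntegral.integral_Iic_add_Ioi (b := -Y) hf.integrableOn hf.integrableOn
  have h2 := intervalIntegral.integral_interval_add_Ioi (a := -Y) (b := Y) hf.integrableOn hf.integrableOn
  have h3 : (∫ y, f y) - ∫ y in (-Y)..Y, f y = (∫ y in Set.Iic (-Y), f y) + ∫ y in Set.Ioi Y, f y := by
    rw [← h1, ← h2]; ring
  have h4 : ∫ y in Set.Iic (-Y), f y = ∫ y in Set.Ioi Y, f (-y) := by
    rw [integral_comp_neg_Ioi]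
  rw [h3, h4]
  refine (norm_add_le _ _).trans ?_
  have b1 : ‖∫ y in Set.Ioi Y, f (-y)‖ ≤ M / Y := norm_integral_Ioi_le_of_inv_sq hY fun y hy => by
    have := h (-y) (by rw [abs_neg, abs_of_pos (hY.trans hy)]; exact hy)
    rwa [abs_neg, abs_of_pos (hY.trans hy)] at this
  have b2 : ‖∫ y in Set.Ioi Y, f y‖ ≤ M / Y := norm_integral_Ioi_le_of_inv_sq hY fun y hy => by
    have := h y (by rw [abs_of_pos (hY.trans hy)]; exact hy)
    rwa [abs_of_pos (hY.trans hy)] at this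
  calc _ ≤ M / Y + M / Y := add_le_add b1 b2
    _ = _ := by ring

lemma norm_inv_kernel_le_rpow {σ y : ℝ} (hy : 0 < |y|) :
    ‖(1 / ((σ + y * I) * (σ + y * I + 1)) : ℂ)‖ ≤ |y| ^ (-2 : ℝ) := by
  have e : |y| ^ (-2 : ℝ) = (|y| * |y|)⁻¹ := by
    rw [Real.rpow_neg hy.le]; norm_num [sq]
  rw [norm_div, norm_one, norm_mul, one_div, e]
  apply inv_anti₀ (by positivity)
  gcongr
  · simpa using Complex.abs_im_le_norm (σ + y * I : ℂ)
  · simpa using Complex.abs_im_le_norm (σ + y * I + 1 : ℂ)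

/-- Contour shift: bound for the smoothed sum from a bound for `1/ζ` on a rectangle. -/
lemma smoothMoebius_contour {x σ θ U : ℝ} (hx : 1 ≤ x) (hσ : 0 < σ) (hσθ : σ ≤ θ) (hθ : θ ≤ 1 / 2)
    (hU : 4 ≤ U) (H : ∀ s : ℂ, 4 * |s.im| ≤ U → |s.re - 1| ≤ θ →
      riemannZeta₁ s ≠ 0 ∧ max 1 |s.im| * ‖riemannZeta₁ s‖⁻¹ ≤ U ^ (1 / 2 : ℝ)) :
    |smoothMoebius x| ≤ 48 * x ^ σ / (σ * U) + 64 * x ^ σ / U + U * U ^ (1 / 2 : ℝ) * x ^ (-θ) := by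
  have hx0 : 0 < x := by linarith
  set Y := U / 4 with hYdef
  have hY1 : 1 ≤ Y := by rw [hYdef]; linarith
  have hY : 0 < Y := by linarith
  have hB : ∀ s : ℂ, |s.im| ≤ Y → |s.re| ≤ θ → s + 1 ≠ 0 ∧ riemannZeta₁ (1 + s) ≠ 0 ∧
      ‖perronKernel x s‖ ≤ 2 * x ^ s.re * U ^ (1 / 2 : ℝ) / (max 1 |s.im|) ^ 2 := by
    intro s h1 h2
    have h3 := H (1 + s) (by simp; linarith) (by simpa using h2)
    have him : (1 + s).im = s.im := by simp
    rw [him] at h3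
    set m := max 1 |s.im| with hm
    have hm1 : 1 ≤ m := le_max_left _ _
    have h4 : m / 2 ≤ ‖s + 1‖ := by
      have a1 := Complex.abs_re_le_norm (s + 1)
      have a2 := Complex.abs_im_le_norm (s + 1)
      have a3 : (1:ℝ) / 2 ≤ |(s + 1).re| := by
        have := (abs_le.1 h2).1
        simp only [add_re, one_re]
        rw [abs_of_nonneg (by linarith)]; linarith
      have a4 : |(s + 1).im| = |s.im| := by simp
      rcases le_total 1 |s.im| with h | h
      · rw [hm, max_eq_right h]; linarith
      · rw [hm, max_eq_left h]; linarith
    have h5 : 0 < ‖s + 1‖ := by linarith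
    refine ⟨norm_pos_iff.1 h5, h3.1, ?_⟩
    rw [perronKernel, norm_div, norm_mul, Complex.norm_cpow_eq_rpow_re_of_pos hx0]
    have h6 : 0 < ‖riemannZeta₁ (1 + s)‖ := norm_pos_iff.2 h3.1
    have h7 : ‖riemannZeta₁ (1 + s)‖⁻¹ ≤ U ^ (1 / 2 : ℝ) / m := by
      rw [le_div_iff₀ (by linarith), mul_comm]; exact h3.2
    have h8 : ‖s + 1‖⁻¹ ≤ 2 / m := by
      rw [inv_le_comm₀ h5 (by positivity), inv_div]; exact h4
    calc x ^ s.re / (‖s + 1‖ * ‖riemannZeta₁ (1 + s)‖)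
        = x ^ s.re * (‖s + 1‖⁻¹ * ‖riemannZeta₁ (1 + s)‖⁻¹) := by field_simp
      _ ≤ x ^ s.re * (2 / m * (U ^ (1 / 2 : ℝ) / m)) := by gcongr
      _ = _ := by field_simp
  have hdiff : DifferentiableOn ℂ (perronKernel x) (Set.uIcc (-θ) σ ×ℂ Set.uIcc (-Y) Y) := by
    intro s hs
    have hs' := mem_reProdIm.1 hs
    rw [Set.uIcc_of_le (by linarith), Set.uIcc_of_le (by linarith)] at hs'
    obtain ⟨b1, b2, -⟩ := hB s (abs_le.2 hs'.2) (abs_le.2 ⟨hs'.1.1, hs'.1.2.trans hσθ⟩)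
    apply DifferentiableAt.differentiableWithinAt
    unfold perronKernel
    refine DifferentiableAt.div ?_ ?_ (mul_ne_zero b1 b2)
    · exact DifferentiableAt.const_cpow differentiableAt_id (Or.inl (by exact_mod_cast hx0.ne'))
    · exact DifferentiableAt.mul (by fun_prop)
        (differentiable_riemannZeta₁.differentiableAt.comp s (by fun_prop))
  have hrect := integral_boundary_rect_eq_zero_of_differentiableOn (perronKernel x) ⟨-θ, -Y⟩ ⟨σ, Y⟩ hdiff
  simp only at hrect
  set A := ∫ t : ℝ in (-θ)..σ, perronKernel x (t + (-Y : ℝ) * I)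
  set B := ∫ t : ℝ in (-θ)..σ, perronKernel x (t + (Y : ℝ) * I)
  set R := ∫ y : ℝ in (-Y)..Y, perronKernel x (σ + y * I)
  set L := ∫ y : ℝ in (-Y)..Y, perronKernel x ((-θ : ℝ) + y * I)
  have hh : ∀ Z : ℝ, |Z| = Y → ‖∫ t : ℝ in (-θ)..σ, perronKernel x (t + Z * I)‖ ≤
      2 * x ^ σ * U ^ (1 / 2 : ℝ) / Y ^ 2 * 1 := by
    intro Z hZ
    refine (intervalIntegral.norm_integral_le_of_norm_le_const (C := 2 * x ^ σ * U ^ (1 / 2 : ℝ) / Y ^ 2)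
      fun t ht => ?_).trans ?_
    · rw [Set.uIoc_of_le (by linarith)] at ht
      have hr : (t + Z * I : ℂ).re = t := by simp
      have hi : (t + Z * I : ℂ).im = Z := by simp
      have := (hB (t + Z * I) (by rw [hi, hZ]) (by rw [hr]; exact abs_le.2 ⟨ht.1.le, ht.2.trans hσθ⟩)).2.2
      rw [hr, hi, hZ, max_eq_right hY1] at this
      refine this.trans ?_
      gcongr
      exact ht.2
    · gcongr
      rw [abs_of_nonneg (by linarith)]; linarith
  have hA := hh (-Y) (by rw [abs_neg, abs_of_pos hY])
  have hBn := hh Y (abs_of_pos hY)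
  have hL : ‖L‖ ≤ 2 * x ^ (-θ) * U ^ (1 / 2 : ℝ) * |Y - -Y| := by
    refine intervalIntegral.norm_integral_le_of_norm_le_const fun y hy => ?_
    rw [Set.uIoc_of_le (by linarith)] at hy
    have hr : ((-θ : ℝ) + y * I : ℂ).re = -θ := by simp
    have hi : ((-θ : ℝ) + y * I : ℂ).im = y := by simp
    have := (hB ((-θ : ℝ) + y * I) (by rw [hi]; exact abs_le.2 ⟨hy.1.le, hy.2⟩)
      (by rw [hr, abs_neg, abs_of_nonneg (by linarith)])).2.2
    rw [hr, hi] at this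
    refine this.trans (div_le_self (by positivity) ?_)
    exact one_le_pow₀ (le_max_left _ _)
  have hR : ‖R‖ ≤ ‖A‖ + ‖B‖ + ‖L‖ := by
    have e : I * R = B - A + I * L := by
      simp only [smul_eq_mul] at hrect
      linear_combination hrect
    have : ‖R‖ = ‖I * R‖ := by simp
    rw [this, e]
    refine (norm_add_le _ _).trans ?_
    have := norm_sub_le B A
    simp only [norm_mul, norm_I, one_mul]
    linarith
  obtain ⟨hk1, hk2⟩ := perronKernel_integrable hx0 hσ (by linarith)
  have htail := norm_integral_sub_interval_le hk2 hY (M := x ^ σ * (6 / σ)) fun y hy =>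
    (hk1 y).trans (mul_le_mul_of_nonneg_left (norm_inv_kernel_le_rpow (hY.trans hy)) (by positivity))
  have hperron := smoothMoebius_perron hx0 hσ (by linarith)
  set P := ∫ y : ℝ, perronKernel x (σ + y * I)
  have hP : ‖P‖ ≤ ‖P - R‖ + ‖R‖ := by
    calc ‖P‖ = ‖(P - R) + R‖ := by ring_nf
      _ ≤ _ := norm_add_le _ _
  have hnorm : |smoothMoebius x| = 1 / (2 * π) * ‖P‖ := by
    rw [← Real.norm_eq_abs, ← Complex.norm_real, hperron, norm_smul, Real.norm_of_nonneg (by positivity)]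
  have hpi : 1 / (2 * π) ≤ 1 := by
    rw [div_le_one (by positivity)]; linarith [Real.pi_gt_three]
  have hUU : U ^ (1 / 2 : ℝ) ≤ U := by
    calc U ^ (1 / 2 : ℝ) ≤ U ^ (1:ℝ) := Real.rpow_le_rpow_of_exponent_le (by linarith) (by norm_num)
      _ = U := Real.rpow_one U
  have e1 : 2 * (x ^ σ * (6 / σ)) / Y = 48 * x ^ σ / (σ * U) := by rw [hYdef]; field_simp; norm_num
  have e2 : 2 * x ^ σ * U ^ (1 / 2 : ℝ) / Y ^ 2 * 1 ≤ 32 * x ^ σ / U := by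
    calc 2 * x ^ σ * U ^ (1 / 2 : ℝ) / Y ^ 2 * 1 ≤ 2 * x ^ σ * U / Y ^ 2 * 1 := by gcongr
      _ = _ := by rw [hYdef]; field_simp; norm_num
  have e3 : 2 * x ^ (-θ) * U ^ (1 / 2 : ℝ) * |Y - -Y| = U * U ^ (1 / 2 : ℝ) * x ^ (-θ) := by
    rw [abs_of_nonneg (by linarith), hYdef]; ring
  have e4 : 64 * x ^ σ / U = 32 * x ^ σ / U + 32 * x ^ σ / U := by ring
  calc |smoothMoebius x| = 1 / (2 * π) * ‖P‖ := hnorm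
    _ ≤ ‖P‖ := mul_le_of_le_one_left (norm_nonneg _) hpi
    _ ≤ _ := by linarith

lemma smoothMoebius_bound : ∃ x₀ : ℝ, Real.exp 1 ≤ x₀ ∧ ∀ x, x₀ ≤ x →
    |smoothMoebius x| ≤ Real.exp (-(√(Real.log x) / 5000)) := by
  obtain ⟨U₀, hU4, hU⟩ := inv_riemannZeta₁_bound
  have ev1 : ∀ᶠ r : ℝ in Filter.atTop, U₀ ≤ Real.exp (r / 2000) :=
    (Real.tendsto_exp_atTop.comp (Filter.tendsto_id.atTop_div_const (by norm_num))).eventually_ge_atTop U₀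
  have ev2 : ∀ᶠ r : ℝ in Filter.atTop, r ^ 2 * Real.exp (-(3 / 10000) * r) ≤ 1 / 1000 := by
    have h := Real.tendsto_pow_mul_exp_neg_atTop_nhds_zero 2
    have h2 := h.comp (Filter.tendsto_id.const_mul_atTop (show (0:ℝ) < 3 / 10000 by norm_num))
    filter_upwards [h2.eventually_le_const (show (0:ℝ) < 1 / 1000 * (3 / 10000) ^ 2 by norm_num)] with r hr
    simp only [Function.comp, id] at hr
    rw [mul_pow, mul_assoc, mul_comm, ← neg_mul] at hr
    exact le_of_mul_le_mul_right hr (by norm_num)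
  have ev3 : ∀ᶠ r : ℝ in Filter.atTop, 840 ≤ r := Filter.eventually_ge_atTop 840
  have ev4 := (Real.tendsto_sqrt_atTop.comp Real.tendsto_log_atTop).eventually (ev1.and (ev2.and ev3))
  obtain ⟨x₁, hx₁⟩ := Filter.eventually_atTop.1 ev4
  refine ⟨max x₁ (Real.exp 1), le_max_right _ _, fun x hx => ?_⟩
  obtain ⟨h1, h2, h3⟩ := hx₁ x ((le_max_left _ _).trans hx)
  have hxe : Real.exp 1 ≤ x := (le_max_right _ _).trans hx
  have hx1 : 1 ≤ x := (Real.one_le_exp (by norm_num)).trans hxe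
  have hx0 : 0 < x := by linarith
  have hL : 1 ≤ Real.log x := by rw [Real.le_log_iff_exp_le hx0]; exact hxe
  simp only [Function.comp] at h1 h2 h3
  set r := √(Real.log x) with hr
  have hr2 : r ^ 2 = Real.log x := Real.sq_sqrt (by linarith)
  have hr0 : 0 < r := by linarith
  have hlU : Real.log (Real.exp (r / 2000)) = r / 2000 := Real.log_exp _
  have hθ : 1 / (1680000 * Real.log (Real.exp (r / 2000))) = 1 / (840 * r) := by
    rw [hlU]; congr 1; ring
  have key := smoothMoebius_contour (x := x) (σ := 1 / r ^ 2) (θ := 1 / (840 * r))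
    (U := Real.exp (r / 2000)) hx1 (by positivity)
    (by apply one_div_le_one_div_of_le (by positivity); nlinarith)
    (by apply one_div_le_one_div_of_le (by positivity); nlinarith)
    (hU4.trans h1) (by rw [← hθ]; exact hU _ h1)
  have x1 : x ^ (1 / r ^ 2) = Real.exp 1 := by
    rw [Real.rpow_def_of_pos hx0, ← hr2]; congr 1; field_simp
  have x2 : x ^ (-(1 / (840 * r))) = Real.exp (-(r / 840)) := by
    rw [Real.rpow_def_of_pos hx0, ← hr2]; congr 1; field_simp
  have x3 : Real.exp (r / 2000) ^ (1 / 2 : ℝ) = Real.exp (r / 4000) := by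
    rw [← Real.exp_mul]; congr 1; ring
  rw [x1, x2, x3] at key
  have e1 : Real.exp 1 < 2.7182818286 := Real.exp_one_lt_d9
  set E := Real.exp (-(r / 5000))
  have hE : 0 < E := Real.exp_pos _
  have y0 : (Real.exp (r / 2000))⁻¹ = E * Real.exp (-(3 / 10000) * r) := by
    rw [← Real.exp_neg, ← Real.exp_add]; congr 1; ring
  set G := Real.exp (-(3 / 10000) * r)
  have hG : 0 < G := Real.exp_pos _
  have y1 : 48 * Real.exp 1 / (1 / r ^ 2 * Real.exp (r / 2000)) = 48 * Real.exp 1 * E * (r ^ 2 * G) := by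
    calc _ = 48 * Real.exp 1 * r ^ 2 * (Real.exp (r / 2000))⁻¹ := by field_simp
      _ = _ := by rw [y0]; ring
  have y2 : 64 * Real.exp 1 / Real.exp (r / 2000) = 64 * Real.exp 1 * E * G := by
    rw [div_eq_mul_inv, y0]; ring
  have hG2 : G ≤ 1 / 100000000 := by
    have : 840 ^ 2 * G ≤ r ^ 2 * G := by gcongr
    have h5 : G ≤ 1 / 1000 / 840 ^ 2 := by linarith
    linarith
  have y3 : Real.exp (r / 2000) * Real.exp (r / 4000) * Real.exp (-(r / 840)) ≤ E * (1 / 2) := by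
    rw [← Real.exp_add, ← Real.exp_add]
    have z : Real.exp (-(r / 5000)  + -(r/ 5000)) ≤ E * (1 / 2) := by
      rw [Real.exp_add]
      have : Real.exp (-(r / 5000)) ≤ 1 / 2 := by
        have hh : G ≤ 1/100000000 := hG2
        have : Real.exp (-(r / 5000)) ^ 3 = G ^ 2 := by
          rw [← Real.exp_nat_mul, ← Real.exp_nat_mul]; congr 1; push_cast; ring
        by_contra hc
        push Not at hc
        have h6 : (1/2:ℝ) ^ 3 < Real.exp (-(r / 5000)) ^ 3 := by gcongr
        rw [this] at h6
        nlinarith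
      exact mul_le_mul_of_nonneg_left this hE.le
    refine le_trans (Real.exp_le_exp.2 ?_) z
    linarith
  rw [y1, y2] at key
  have w1 : 48 * Real.exp 1 * E * (r ^ 2 * G) ≤ E * (1 / 4) := by
    calc 48 * Real.exp 1 * E * (r ^ 2 * G) ≤ 48 * 2.7182818286 * E * (1 / 1000) := by gcongr
      _ ≤ E * (1 / 4) := by linarith
  have w2 : 64 * Real.exp 1 * E * G ≤ E * (1 / 4) := by
    calc 64 * Real.exp 1 * E * G ≤ 64 * 2.7182818286 * E * (1 / 100000000) := by gcongr
      _ ≤ E * (1 / 4) := by linarith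
  linarith

/-- The summatory function `∑_{n ≤ x} μ(n)/n`. -/
noncomputable def moebiusSum (x : ℝ) : ℝ :=
  ∑ n ∈ Finset.range (⌊x⌋₊ + 1), (ArithmeticFunction.moebius n : ℝ) / n

lemma abs_moebius_div_le (n : ℕ) : |(ArithmeticFunction.moebius n : ℝ) / n| ≤ 1 / n := by
  rw [abs_div, Nat.abs_cast]
  gcongr
  exact_mod_cast ArithmeticFunction.abs_moebius_le_one

lemma abs_moebiusSum_le {x : ℝ} (hx : 0 ≤ x) : |moebiusSum x| ≤ x + 1 := by
  refine (Finset.abs_sum_le_sum_abs _ _).trans ?_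
  calc _ ≤ ∑ n ∈ Finset.range (⌊x⌋₊ + 1), (1:ℝ) := by
        refine Finset.sum_le_sum fun n _ => (abs_moebius_div_le n).trans ?_
        rcases n.eq_zero_or_pos with rfl | hn
        · simp
        · rw [div_le_one (by exact_mod_cast hn)]; exact_mod_cast hn
    _ = ⌊x⌋₊ + 1 := by simp
    _ ≤ _ := by linarith [Nat.floor_le hx]

lemma mul_smoothMoebius {x : ℝ} (hx : 0 < x) : x * smoothMoebius x =
    ∑ n ∈ Finset.range (⌊x⌋₊ + 1), (ArithmeticFunction.moebius n : ℝ) / n * (x - n) := by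
  rw [smoothMoebius, Finset.mul_sum]
  refine Finset.sum_congr rfl fun n _ => ?_
  field_simp

lemma smoothMoebius_diff {x h : ℝ} (hx : 1 ≤ x) (hh : 0 ≤ h) :
    |(x + h) * smoothMoebius (x + h) - x * smoothMoebius x - h * moebiusSum x| ≤ h * (h + 1) / x := by
  have hx0 : 0 < x := by linarith
  have hfl : ⌊x⌋₊ ≤ ⌊x + h⌋₊ := Nat.floor_le_floor (by linarith)
  rw [mul_smoothMoebius hx0, mul_smoothMoebius (by linarith), moebiusSum, Finset.mul_sum]
  rw [← Finset.sum_range_add_sum_Ico _ (Nat.succ_le_succ hfl : ⌊x⌋₊ + 1 ≤ ⌊x + h⌋₊ + 1)]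
  have e : ∑ k ∈ Finset.range (⌊x⌋₊ + 1), (ArithmeticFunction.moebius k : ℝ) / k * (x + h - k) =
      ∑ k ∈ Finset.range (⌊x⌋₊ + 1), (ArithmeticFunction.moebius k : ℝ) / k * (x - k) +
      ∑ k ∈ Finset.range (⌊x⌋₊ + 1), h * ((ArithmeticFunction.moebius k : ℝ) / k) := by
    rw [← Finset.sum_add_distrib]
    exact Finset.sum_congr rfl fun n _ => by ring
  rw [e]
  have e2 : ∀ a b c : ℝ, a + b + c - a - b = c := fun a b c => by ring
  rw [e2]
  refine (Finset.abs_sum_le_sum_abs _ _).trans ?_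
  calc _ ≤ ∑ n ∈ Finset.Ico (⌊x⌋₊ + 1) (⌊x + h⌋₊ + 1), h / x := by
        refine Finset.sum_le_sum fun n hn => ?_
        rw [Finset.mem_Ico] at hn
        have h1 : x < n := (Nat.floor_lt hx0.le).1 hn.1
        have h2 : (n:ℝ) ≤ x + h := (Nat.le_floor_iff (by linarith)).1 (by omega)
        rw [abs_mul, abs_of_nonneg (show 0 ≤ x + h - n by linarith)]
        calc _ ≤ 1 / (n:ℝ) * h := by
              apply mul_le_mul (abs_moebius_div_le n) (by linarith) (by linarith) (by positivity)
          _ ≤ 1 / x * h := by gcongr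
          _ = h / x := by ring
    _ = ((⌊x + h⌋₊ - ⌊x⌋₊ : ℕ) : ℝ) * (h / x) := by simp
    _ ≤ (h + 1) * (h / x) := by
        gcongr
        rw [Nat.cast_sub hfl]
        linarith [Nat.floor_le (show 0 ≤ x + h by linarith), Nat.lt_floor_add_one x]
    _ = _ := by ring

lemma moebiusSum_bound : ∃ C : ℝ, 0 < C ∧ ∀ x, 1 ≤ x →
    |moebiusSum x| ≤ C * Real.exp (-(√(Real.log x) / 10000)) := by
  obtain ⟨x₀, hx₀, hF⟩ := smoothMoebius_bound
  have hx₀1 : 1 ≤ x₀ := (Real.one_le_exp (by norm_num)).trans hx₀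
  refine ⟨6 + (x₀ + 1) * Real.exp (√(Real.log x₀) / 10000), by positivity, fun x hx => ?_⟩
  rcases le_total x x₀ with hxx | hxx
  · have h1 : |moebiusSum x| ≤ x₀ + 1 := (abs_moebiusSum_le (by linarith)).trans (by linarith)
    have h2 : Real.exp (-(√(Real.log x₀) / 10000)) ≤ Real.exp (-(√(Real.log x) / 10000)) := by
      gcongr
    have h3 : Real.exp (√(Real.log x₀) / 10000) * Real.exp (-(√(Real.log x₀) / 10000)) = 1 := by
      rw [← Real.exp_add]; simp
    calc |moebiusSum x| ≤ (x₀ + 1) := h1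
      _ = (x₀ + 1) * (Real.exp (√(Real.log x₀) / 10000) * Real.exp (-(√(Real.log x₀) / 10000))) := by
          rw [h3, mul_one]
      _ = ((x₀ + 1) * Real.exp (√(Real.log x₀) / 10000)) * Real.exp (-(√(Real.log x₀) / 10000)) := by ring
      _ ≤ _ := by gcongr; linarith
  · have hx0 : 0 < x := by linarith
    have hL : 1 ≤ Real.log x := by rw [Real.le_log_iff_exp_le hx0]; exact hx₀.trans hxx
    set r := √(Real.log x) with hr
    have hr2 : r ^ 2 = Real.log x := Real.sq_sqrt (by linarith)
    have hr1 : 1 ≤ r := Real.one_le_sqrt.2 hL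
    set q := Real.exp (-(r / 10000)) with hq
    have hq0 : 0 < q := Real.exp_pos _
    have hq1 : q ≤ 1 := Real.exp_le_one_iff.2 (by linarith)
    have hqq : Real.exp (-(r / 5000)) = q ^ 2 := by
      rw [hq, ← Real.exp_nat_mul]; congr 1; push_cast; ring
    have hd := smoothMoebius_diff hx (h := x * q) (by positivity)
    have f1 := hF x hxx
    have f2 : |smoothMoebius (x + x * q)| ≤ q ^ 2 := by
      refine (hF _ (by nlinarith)).trans ?_
      rw [← hqq]
      gcongr
      rw [hr]
      exact Real.sqrt_le_sqrt (Real.log_le_log hx0 (by nlinarith [mul_pos hx0 hq0]))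
    rw [← hr, hqq] at f1
    have hxinv : 1 / x ≤ q := by
      have : x = Real.exp (r ^ 2) := by rw [hr2, Real.exp_log hx0]
      rw [one_div, this, ← Real.exp_neg, hq]
      apply Real.exp_le_exp.2
      nlinarith
    have g1 : |x * q * moebiusSum x| ≤ (x + x * q) * q ^ 2 + x * q ^ 2 + x * q * (x * q + 1) / x := by
      have t1 : |(x + x * q) * smoothMoebius (x + x * q)| ≤ (x + x * q) * q ^ 2 := by
        rw [abs_mul, abs_of_nonneg (by positivity)]; gcongr
      have t2 : |x * smoothMoebius x| ≤ x * q ^ 2 := by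
        rw [abs_mul, abs_of_nonneg hx0.le]; gcongr
      rw [abs_le] at *
      constructor <;> linarith [hd.1, hd.2, t1.1, t1.2, t2.1, t2.2]
    rw [abs_mul, abs_of_nonneg (by positivity)] at g1
    have g2 : (x + x * q) * q ^ 2 + x * q ^ 2 + x * q * (x * q + 1) / x ≤ x * q * (6 * q) := by
      have : x * q * (x * q + 1) / x = x * q * (q + 1 / x) := by field_simp
      rw [this]
      have a1 : x * q * (q + 1 / x) ≤ x * q * (q + q) := by gcongr
      have a2 : x * q * q ^ 2 ≤ x * q ^ 2 := by
        have : q * q ^ 2 ≤ 1 * q ^ 2 := by gcongr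
        nlinarith
      nlinarith
    have g3 := le_of_mul_le_mul_left (g1.trans g2) (by positivity)
    refine g3.trans ?_
    have : 0 ≤ (x₀ + 1) * Real.exp (√(Real.log x₀) / 10000) := by positivity
    nlinarith

lemma abs_sum_mul_le_of_antitone {a g : ℕ → ℝ} {K : ℝ} {m n : ℕ} (hmn : m < n)
    (hD : ∀ j, m ≤ j → j ≤ n → |∑ i ∈ Finset.Ioc m j, a i| ≤ K)
    (hg : ∀ i, m < i → i < n → g (i + 1) ≤ g i) (hg0 : 0 ≤ g n) :
    |∑ i ∈ Finset.Ioc m n, a i * g i| ≤ K * g (m + 1) := by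
  set D : ℕ → ℝ := fun j => ∑ i ∈ Finset.Ioc m j, a i with hDdef
  have key : ∀ j, m + 1 ≤ j → j ≤ n →
      |(∑ i ∈ Finset.Ioc m j, a i * g i) - D j * g j| ≤ K * (g (m + 1) - g j) := by
    intro j hj
    induction j, hj using Nat.le_induction with
    | base => intro _; simp [hDdef]
    | succ j hj ih =>
      intro hjn
      have h1 := ih (by omega)
      have h2 : D (j + 1) = D j + a (j + 1) := by
        simp only [hDdef]; rw [Finset.sum_Ioc_succ_top (by omega)]
      rw [Finset.sum_Ioc_succ_top (by omega), h2]
      have h3 := hg j (by omega) (by omega)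
      have h4 : |D j * (g j - g (j + 1))| ≤ K * (g j - g (j + 1)) := by
        rw [abs_mul, abs_of_nonneg (show 0 ≤ g j - g (j + 1) by linarith)]
        exact mul_le_mul_of_nonneg_right (hD j (by omega) (by omega)) (by linarith)
      rw [abs_le] at *
      constructor <;> linarith [h1.1, h1.2, h4.1, h4.2]
  have h1 := key n hmn le_rfl
  have h2 : |D n * g n| ≤ K * g n := by
    rw [abs_mul, abs_of_nonneg hg0]
    exact mul_le_mul_of_nonneg_right (hD n hmn.le le_rfl) hg0
  rw [abs_le] at *
  constructor <;> linarith [h1.1, h1.2, h2.1, h2.2]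

lemma log_four_le : Real.log 4 ≤ 2 := by
  have : Real.log 4 = 2 * Real.log 2 := by
    rw [show (4:ℝ) = 2 ^ 2 by norm_num, Real.log_pow]; norm_num
  rw [this]; linarith [Real.log_two_lt_d9]

open ArithmeticFunction in
lemma mertens_first {N : ℕ} (hN : 1 ≤ N) :
    Real.log N - 1 ≤ ∑ n ∈ Finset.Ioc 0 N, vonMangoldt n / n ∧
    ∑ n ∈ Finset.Ioc 0 N, vonMangoldt n / n ≤ Real.log N + 6 := by
  have hN0 : (0:ℝ) < N := by exact_mod_cast hN
  have e1 : ∑ n ∈ Finset.Ioc 0 N, vonMangoldt n * ((N / n : ℕ) : ℝ) = Real.log (N.factorial) := by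
    rw [← sum_Ioc_mul_zeta_eq_sum, vonMangoldt_mul_zeta]
    clear hN hN0
    induction N with
    | zero => simp
    | succ k ih =>
      rw [Finset.sum_Ioc_succ_top (by omega), ih, Nat.factorial_succ, Nat.cast_mul,
        Real.log_mul (by positivity) (by positivity), log_apply]
      push_cast; ring
  have lo : N * Real.log N - N ≤ Real.log (N.factorial) := by
    have := Stirling.le_log_factorial_stirling (n := N) (by omega)
    have h2 : 0 ≤ Real.log N := Real.log_nonneg (by exact_mod_cast hN)
    have h3 : 0 ≤ Real.log (2 * π) := Real.log_nonneg (by linarith [Real.pi_gt_three])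
    linarith
  have hi : Real.log (N.factorial) ≤ N * Real.log N := by
    rw [← Real.log_pow]
    apply Real.log_le_log (by positivity)
    exact_mod_cast Nat.factorial_le_pow N
  have up : ∑ n ∈ Finset.Ioc 0 N, vonMangoldt n * ((N / n : ℕ) : ℝ) ≤
      N * ∑ n ∈ Finset.Ioc 0 N, vonMangoldt n / n := by
    rw [Finset.mul_sum]
    refine Finset.sum_le_sum fun n hn => ?_
    have : ((N / n : ℕ) : ℝ) ≤ N / n := Nat.cast_div_le
    calc _ ≤ vonMangoldt n * (N / n : ℝ) := by gcongr
      _ = _ := by ring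
  have dn : N * (∑ n ∈ Finset.Ioc 0 N, vonMangoldt n / n) - Chebyshev.psi N ≤
      ∑ n ∈ Finset.Ioc 0 N, vonMangoldt n * ((N / n : ℕ) : ℝ) := by
    rw [Chebyshev.psi, Nat.floor_natCast, Finset.mul_sum, ← Finset.sum_sub_distrib]
    refine Finset.sum_le_sum fun n hn => ?_
    have hn0 : (0:ℝ) < n := by exact_mod_cast (Finset.mem_Ioc.1 hn).1
    have : (N / n : ℝ) - 1 ≤ ((N / n : ℕ) : ℝ) := by
      have := Nat.lt_floor_add_one ((N:ℝ) / n)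
      rw [Nat.floor_div_eq_div] at this
      linarith
    calc _ = vonMangoldt n * ((N / n : ℝ) - 1) := by field_simp
      _ ≤ _ := by gcongr
  have ps := Chebyshev.psi_le_const_mul_self hN0.le
  have ps2 : (Real.log 4 + 4) * (N:ℝ) ≤ 6 * N := by nlinarith [log_four_le]
  constructor
  · refine le_of_mul_le_mul_left ?_ hN0
    linarith
  · refine le_of_mul_le_mul_left ?_ hN0
    linarith

/-- The sum `∑_{n ≤ N} Λ(n)/(n log n)`. -/
noncomputable def mangoldtLogSum (N : ℕ) : ℝ :=
  ∑ n ∈ Finset.Ioc 0 N, ArithmeticFunction.vonMangoldt n / (n * Real.log n)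

lemma mangoldtLogSum_sub {m n : ℕ} (hm : 2 ≤ m) (hmn : m ≤ n) :
    |mangoldtLogSum n - mangoldtLogSum m - (Real.log (Real.log n) - Real.log (Real.log m))| ≤
      8 / Real.log m := by
  have hpos : ∀ i : ℕ, 2 ≤ i → 0 < Real.log i := fun i hi =>
    Real.log_pos (by exact_mod_cast (by omega : 1 < i))
  rcases hmn.eq_or_lt with rfl | hlt
  · simp; exact div_nonneg (by norm_num) (hpos m hm).le
  set a : ℕ → ℝ := fun i => ArithmeticFunction.vonMangoldt i / i - (Real.log i - Real.log (i - 1 : ℕ)) with ha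
  have tel : ∀ (f : ℕ → ℝ) (j : ℕ), m ≤ j → ∑ i ∈ Finset.Ioc m j, (f i - f (i - 1)) = f j - f m := by
    intro f j hj
    induction j, hj using Nat.le_induction with
    | base => simp
    | succ j hj ih => rw [Finset.sum_Ioc_succ_top (by omega), ih]; simp
  have split : ∀ (f : ℕ → ℝ) (j : ℕ), m ≤ j → ∑ i ∈ Finset.Ioc m j, f i =
      ∑ i ∈ Finset.Ioc 0 j, f i - ∑ i ∈ Finset.Ioc 0 m, f i := by
    intro f j hj
    rw [← Finset.sum_Ioc_consecutive f (Nat.zero_le m) hj]; ring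
  have hD : ∀ j, m ≤ j → j ≤ n → |∑ i ∈ Finset.Ioc m j, a i| ≤ 7 := by
    intro j hj _
    simp only [ha]
    rw [Finset.sum_sub_distrib, tel (fun i => Real.log i) j hj, split _ j hj]
    have h1 := mertens_first (N := j) (by omega)
    have h2 := mertens_first (N := m) (by omega)
    rw [abs_le]; constructor <;> linarith [h1.1, h1.2, h2.1, h2.2]
  have h1 := abs_sum_mul_le_of_antitone (a := a) (g := fun i => (Real.log i)⁻¹) hlt hD
    (fun i hi _ => by
      apply inv_anti₀ (hpos i (by omega))
      apply Real.log_le_log (by exact_mod_cast (by omega : 0 < i)); push_cast; linarith)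
    (inv_nonneg.2 (hpos n (by omega)).le)
  have h1' : 7 * (Real.log ((m + 1 : ℕ) : ℝ))⁻¹ ≤ 7 / Real.log m := by
    rw [div_eq_mul_inv]
    gcongr
    · exact hpos m hm
    · omega
  have h2 : ∑ i ∈ Finset.Ioc m n, a i * (Real.log i)⁻¹ = mangoldtLogSum n - mangoldtLogSum m -
      ∑ i ∈ Finset.Ioc m n, (Real.log i - Real.log (i - 1 : ℕ)) / Real.log i := by
    rw [mangoldtLogSum, mangoldtLogSum, ← split _ n hmn, ← Finset.sum_sub_distrib]
    refine Finset.sum_congr rfl fun i hi => ?_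
    have hi2 := hpos i (by have := (Finset.mem_Ioc.1 hi).1; omega)
    simp only [ha]
    field_simp
  have h3 : |∑ i ∈ Finset.Ioc m n, (Real.log i - Real.log (i - 1 : ℕ)) / Real.log i -
      (Real.log (Real.log n) - Real.log (Real.log m))| ≤ 1 / Real.log m := by
    rw [← tel (fun i => Real.log (Real.log i)) n hmn, ← Finset.sum_sub_distrib]
    have hterm : ∀ i ∈ Finset.Ioc m n, |(Real.log i - Real.log (i - 1 : ℕ)) / Real.log i -
        (Real.log (Real.log i) - Real.log (Real.log (i - 1 : ℕ)))| ≤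
        -((Real.log i)⁻¹) - -((Real.log (i - 1 : ℕ))⁻¹) := by
      intro i hi
      have hi' := (Finset.mem_Ioc.1 hi).1
      have p1 := hpos i (by omega)
      have p2 := hpos (i - 1) (by omega)
      set A := Real.log (i - 1 : ℕ)
      set B := Real.log i
      have hAB : A ≤ B := Real.log_le_log (by exact_mod_cast (by omega : 0 < i - 1))
        (by exact_mod_cast (by omega : i - 1 ≤ i))
      have hB1 : B - A ≤ 1 := by
        have hc : (i:ℝ) = ((i - 1 : ℕ) : ℝ) + 1 := by
          rw [Nat.cast_sub (by omega)]; push_cast; ring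
        have h0 : (1:ℝ) ≤ ((i - 1 : ℕ) : ℝ) := by exact_mod_cast (by omega : 1 ≤ i - 1)
        simp only [A, B]
        rw [← Real.log_div (by linarith) (by linarith)]
        refine (Real.log_le_sub_one_of_pos (by rw [hc]; positivity)).trans ?_
        rw [sub_le_iff_le_add, div_le_iff₀ (by linarith)]
        linarith
      rw [← Real.log_div p1.ne' p2.ne']
      have l1 : Real.log (B / A) ≤ B / A - 1 := Real.log_le_sub_one_of_pos (by positivity)
      have l2 : 1 - (B / A)⁻¹ ≤ Real.log (B / A) := Real.one_sub_inv_le_log_of_pos (by positivity)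
      have l3 : (B - A) / B = 1 - (B / A)⁻¹ := by field_simp
      have l4 : B / A - 1 - (B - A) / B ≤ -(B⁻¹) - -(A⁻¹) := by
        have : B / A - 1 - (B - A) / B = (B - A) * (-(B⁻¹) - -(A⁻¹)) := by field_simp; ring
        rw [this]
        apply mul_le_of_le_one_left _ hB1
        have := inv_anti₀ p2 hAB
        linarith
      rw [abs_le]; constructor
      · linarith
      · have := inv_anti₀ p2 hAB
        linarith
    refine (Finset.abs_sum_le_sum_abs _ _).trans ((Finset.sum_le_sum hterm).trans ?_)
    rw [tel (fun i => -((Real.log i)⁻¹)) n hmn]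
    have := inv_nonneg.2 (hpos n (by omega)).le
    rw [one_div]; linarith
  have h4 : 8 / Real.log m = 7 / Real.log m + 1 / Real.log m := by ring
  rw [h2] at h1
  have h1'' := h1.trans h1'
  rw [h4]
  rw [abs_le] at *
  constructor <;> linarith [h1''.1, h1''.2, h3.1, h3.2]

lemma integral_log_mul_exp_neg :
    IntegrableOn (fun t : ℝ => Real.log t * Real.exp (-t)) (Set.Ioi 0) ∧
    ∫ t in Set.Ioi (0:ℝ), Real.log t * Real.exp (-t) = -Real.eulerMascheroniConstant := by
  have h1 := Complex.hasDerivAt_GammaIntegral (s := 1) (by simp)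
  have h2 : HasDerivAt GammaIntegral (-Real.eulerMascheroniConstant : ℂ) 1 := by
    refine Complex.hasDerivAt_Gamma_one.congr_of_eventuallyEq ?_
    have : {s : ℂ | 0 < s.re} ∈ nhds (1:ℂ) :=
      (isOpen_lt continuous_const Complex.continuous_re).mem_nhds (by simp)
    filter_upwards [this] with s hs
    exact (Complex.Gamma_eq_integral hs).symm
  have h3 := h1.unique h2
  have h4 : ∫ t in Set.Ioi (0:ℝ), Real.log t * Real.exp (-t) = -Real.eulerMascheroniConstant := by
    have : (∫ t : ℝ in Set.Ioi 0, (t:ℂ) ^ ((1:ℂ) - 1) * (Real.log t * Real.exp (-t))) =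
        ((∫ t in Set.Ioi (0:ℝ), Real.log t * Real.exp (-t) : ℝ) : ℂ) := by
      rw [← integral_complex_ofReal]
      refine integral_congr_ae (Filter.Eventually.of_forall fun t => ?_)
      simp
    rw [this] at h3
    exact_mod_cast h3
  refine ⟨?_, h4⟩
  by_contra hc
  rw [integral_undef hc] at h4
  linarith [Real.one_half_lt_eulerMascheroniConstant]

lemma exists_mangoldtLogSum_limit : ∃ b : ℝ, ∀ n : ℕ, 2 ≤ n →
    |mangoldtLogSum n - Real.log (Real.log n) - b| ≤ 8 / Real.log n := by
  set Q : ℕ → ℝ := fun n => mangoldtLogSum n - Real.log (Real.log n)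
  have hQ : ∀ m n : ℕ, 2 ≤ m → m ≤ n → |Q n - Q m| ≤ 8 / Real.log m := fun m n hm hmn => by
    have := mangoldtLogSum_sub hm hmn
    rwa [show Q n - Q m = mangoldtLogSum n - mangoldtLogSum m -
      (Real.log (Real.log n) - Real.log (Real.log m)) by simp only [Q]; ring]
  have ht : Filter.Tendsto (fun n : ℕ => 8 / Real.log n) Filter.atTop (nhds 0) :=
    (Real.tendsto_log_atTop.comp tendsto_natCast_atTop_atTop).const_div_atTop 8
  have hc : CauchySeq Q := by
    rw [Metric.cauchySeq_iff']
    intro e he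
    obtain ⟨N, hN⟩ := Filter.eventually_atTop.1 (ht.eventually (gt_mem_nhds he))
    refine ⟨max N 2, fun n hn => ?_⟩
    rw [Real.dist_eq]
    exact (hQ _ n (le_max_right _ _) hn).trans_lt (hN _ (le_max_left _ _))
  obtain ⟨b, hb⟩ := cauchySeq_tendsto_of_complete hc
  refine ⟨b, fun n hn => ?_⟩
  have h1 : Filter.Tendsto (fun m => |Q m - Q n|) Filter.atTop (nhds |b - Q n|) :=
    (hb.sub_const _).abs
  have h2 := le_of_tendsto h1 (Filter.eventually_atTop.2 ⟨n, fun m hm => hQ n m hn hm⟩)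
  rw [abs_sub_comm] at h2
  exact h2

lemma mangoldtLogSum_floor_bound {b : ℝ} (hb : ∀ n : ℕ, 2 ≤ n →
    |mangoldtLogSum n - Real.log (Real.log n) - b| ≤ 8 / Real.log n) {t : ℝ} (ht : 2 ≤ t) :
    |mangoldtLogSum ⌊t⌋₊ - Real.log (Real.log t) - b| ≤ 18 / Real.log t := by
  have hn2 : 2 ≤ ⌊t⌋₊ := Nat.le_floor (by exact_mod_cast ht)
  set n := ⌊t⌋₊ with hn
  have h1 : (n:ℝ) ≤ t := Nat.floor_le (by linarith)
  have h2 : t < n + 1 := Nat.lt_floor_add_one t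
  have hnR : (2:ℝ) ≤ n := by exact_mod_cast hn2
  have p1 : 0 < Real.log n := Real.log_pos (by linarith)
  have p2 : 0 < Real.log t := Real.log_pos (by linarith)
  have h3 : Real.log t ≤ 2 * Real.log n := by
    have : Real.log t ≤ Real.log ((n:ℝ) ^ 2) := Real.log_le_log (by linarith) (by nlinarith)
    rwa [Real.log_pow] at this
  have h4 : Real.log t - Real.log n ≤ 1 := by
    rw [← Real.log_div (by linarith) (by linarith)]
    refine (Real.log_le_sub_one_of_pos (by positivity)).trans ?_
    rw [sub_le_iff_le_add, div_le_iff₀ (by linarith)]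
    linarith
  have h5 : Real.log n ≤ Real.log t := Real.log_le_log (by linarith) h1
  have h6 : |Real.log (Real.log t) - Real.log (Real.log n)| ≤ 1 / Real.log n := by
    rw [abs_of_nonneg (by linarith [Real.log_le_log p1 h5]), ← Real.log_div p2.ne' p1.ne']
    refine (Real.log_le_sub_one_of_pos (by positivity)).trans ?_
    rw [div_sub_one p1.ne']
    gcongr
  have h7 := hb n hn2
  have h8 : 9 / Real.log n ≤ 18 / Real.log t := by
    rw [div_le_div_iff₀ p1 p2]; linarith
  have h9 : 9 / Real.log n = 8 / Real.log n + 1 / Real.log n := by ring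
  rw [abs_le] at *
  constructor <;> linarith [h6.1, h6.2, h7.1, h7.2]

lemma log_zeta_eq_integral {η : ℝ} (hη : 0 < η) :
    Real.log (riemannZeta ((1 + η : ℝ) : ℂ)).re =
      η * ∫ t in Set.Ioi (1:ℝ), mangoldtLogSum ⌊t⌋₊ * t ^ (-(η + 1)) := by
  obtain ⟨b, hb⟩ := exists_mangoldtLogSum_limit
  set f : ℕ → ℝ := fun n => ArithmeticFunction.vonMangoldt n / (n * Real.log n) with hf
  have hf0 : ∀ n, 0 ≤ f n := fun n => div_nonneg ArithmeticFunction.vonMangoldt_nonneg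
    (mul_nonneg (Nat.cast_nonneg _) (Real.log_natCast_nonneg n))
  have hsumeq : ∀ n : ℕ, ∑ k ∈ Finset.Icc 1 n, f k = mangoldtLogSum n := fun n => rfl
  have hO : (fun n : ℕ => ∑ k ∈ Finset.Icc 1 n, f k) =O[Filter.atTop] fun n => (n : ℝ) ^ (η / 2) := by
    have h1 : (fun n : ℕ => Real.log (n:ℝ)) =O[Filter.atTop] fun n => (n : ℝ) ^ (η / 2) :=
      ((isLittleO_log_rpow_atTop (by positivity)).isBigO).comp_tendsto tendsto_natCast_atTop_atTop
    refine Asymptotics.IsBigO.trans (Asymptotics.IsBigO.of_bound (|b| + 2 + 8 / Real.log 2 / Real.log 2 + |b| / Real.log 2) ?_) h1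
    filter_upwards [Filter.eventually_ge_atTop 2] with n hn
    rw [hsumeq]
    have h2 := hb n hn
    have p0 : 0 < Real.log 2 := Real.log_pos (by norm_num)
    have p1 : Real.log 2 ≤ Real.log n := Real.log_le_log (by norm_num) (by exact_mod_cast hn)
    have p2 : 0 < Real.log n := by linarith
    have h3 : Real.log (Real.log n) ≤ Real.log n := (Real.log_le_self p2.le)
    have h4 : 8 / Real.log n ≤ 8 / Real.log 2 := by gcongr
    have h5 : 0 ≤ mangoldtLogSum n := by
      rw [← hsumeq]; exact Finset.sum_nonneg fun i _ => hf0 i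
    rw [Real.norm_of_nonneg h5, Real.norm_of_nonneg p2.le]
    have h6 : 8 / Real.log 2 ≤ 8 / Real.log 2 / Real.log 2 * Real.log n := by
      rw [div_mul_eq_mul_div, le_div_iff₀ p0]; gcongr
    have h7 : |b| ≤ |b| / Real.log 2 * Real.log n := by
      rw [div_mul_eq_mul_div, le_div_iff₀ p0]; gcongr
    have h8 := le_abs_self b
    have h9 : 0 ≤ |b| * Real.log n := by positivity
    rw [abs_le] at h2
    nlinarith
  have key := LSeries_eq_mul_integral_of_nonneg f (r := η / 2) (s := (η : ℂ)) (by positivity)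
    (by simp; linarith) hO hf0
  rw [log_riemannZeta_eq (by linarith)]
  have e1 : LSeries (fun n => (f n : ℂ)) η = ((∑' n : ℕ, ArithmeticFunction.vonMangoldt n /
      ((n:ℝ) ^ (1 + η) * Real.log n) : ℝ) : ℂ) := by
    rw [LSeries, Complex.ofReal_tsum]
    refine tsum_congr fun n => ?_
    rcases eq_or_ne n 0 with rfl | hn
    · simp
    · have hn0 : (0:ℝ) < n := by exact_mod_cast Nat.pos_of_ne_zero hn
      rw [LSeries.term_of_ne_zero hn]
      have : (n:ℂ) ^ (η:ℂ) = (((n:ℝ) ^ η : ℝ) : ℂ) := by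
        rw [Complex.ofReal_cpow hn0.le]; simp
      rw [this, ← Complex.ofReal_div]
      congr 1
      simp only [hf]
      rw [Real.rpow_add hn0, Real.rpow_one, div_div]
      congr 1; ring
  have e2 : ∫ t in Set.Ioi (1 : ℝ), (∑ k ∈ Finset.Icc 1 ⌊t⌋₊, (f k : ℂ)) * (t:ℂ) ^ (-((η:ℂ) + 1)) =
      ((∫ t in Set.Ioi (1:ℝ), mangoldtLogSum ⌊t⌋₊ * t ^ (-(η + 1)) : ℝ) : ℂ) := by
    rw [← integral_complex_ofReal]
    refine setIntegral_congr_fun measurableSet_Ioi fun t ht => ?_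
    have ht0 : (0:ℝ) < t := lt_trans one_pos ht
    rw [← hsumeq]
    push_cast
    rw [Complex.ofReal_cpow ht0.le]
    push_cast; rfl
  rw [e1, e2] at key
  exact_mod_cast key

lemma integral_substitution {k : ℝ} (hk : 0 < k) :
    1 / k * ∫ t in Set.Ioi (1:ℝ), mangoldtLogSum ⌊t⌋₊ * t ^ (-(1 / k + 1)) =
      ∫ v in Set.Ioi (0:ℝ), mangoldtLogSum ⌊Real.exp (k * v)⌋₊ * Real.exp (-v) := by
  have himg : (fun v : ℝ => Real.exp (k * v)) '' Set.Ioi 0 = Set.Ioi 1 := by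
    ext t
    constructor
    · rintro ⟨v, hv, rfl⟩
      exact Real.one_lt_exp_iff.2 (mul_pos hk hv)
    · intro ht
      have ht1 : (1:ℝ) < t := ht
      refine ⟨Real.log t / k, div_pos (Real.log_pos ht1) hk, ?_⟩
      simp only
      rw [mul_div_cancel₀ _ hk.ne', Real.exp_log (by linarith)]
  rw [← himg, integral_image_eq_integral_abs_deriv_smul (f' := fun v => Real.exp (k * v) * k)
    measurableSet_Ioi, ← integral_const_mul]
  · refine integral_congr_ae (Filter.Eventually.of_forall fun v => ?_)
    simp only [smul_eq_mul]
    rw [abs_of_pos (by positivity), ← Real.exp_mul]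
    have : Real.exp (k * v) * Real.exp (k * v * -(1 / k + 1)) = Real.exp (-v) := by
      rw [← Real.exp_add]; congr 1; field_simp; ring
    rw [← this]; field_simp
  · intro v _
    apply HasDerivAt.hasDerivWithinAt
    have := ((hasDerivAt_id v).const_mul k).exp
    simpa using this
  · intro a _ b _ h
    have := Real.exp_injective h
    exact mul_left_cancel₀ hk.ne' this

lemma mangoldtLogSum_limit_eq {b : ℝ} (hb : ∀ n : ℕ, 2 ≤ n →
    |mangoldtLogSum n - Real.log (Real.log n) - b| ≤ 8 / Real.log n) :
    b = Real.eulerMascheroniConstant := by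
  obtain ⟨hI, hγ⟩ := integral_log_mul_exp_neg
  have hE : IntegrableOn (fun v : ℝ => Real.exp (-v)) (Set.Ioi 0) := integrableOn_exp_neg_Ioi 0
  set F : ℕ → ℝ → ℝ := fun k v => (mangoldtLogSum ⌊Real.exp (k * v)⌋₊ - Real.log k) * Real.exp (-v)
  have p0 : 0 < Real.log 2 := Real.log_pos (by norm_num)
  have hmeas : ∀ k, Measurable (F k) := by
    intro k
    have h1 : Measurable (mangoldtLogSum : ℕ → ℝ) := measurable_from_top
    have h2 : Measurable fun v : ℝ => ⌊Real.exp (k * v)⌋₊ :=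
      Nat.measurable_floor.comp (by fun_prop)
    exact ((h1.comp h2).sub_const _).mul (by fun_prop)
  have hbound : ∀ k : ℕ, 1 ≤ k → ∀ v ∈ Set.Ioi (0:ℝ), ‖F k v‖ ≤
      |Real.log v * Real.exp (-v)| + (|b| + 18 / Real.log 2) * Real.exp (-v) := by
    intro k hk v hv
    have hv0 : 0 < v := hv
    have hkR : (1:ℝ) ≤ k := by exact_mod_cast hk
    have hk0 : 0 ≤ Real.log k := Real.log_nonneg hkR
    simp only [F]
    rw [norm_mul, abs_mul, Real.norm_of_nonneg (Real.exp_pos _).le, abs_of_pos (Real.exp_pos (-v)),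
      ← add_mul]
    gcongr
    rw [Real.norm_eq_abs]
    have hc0 : 0 ≤ 18 / Real.log 2 := by positivity
    rcases le_or_gt 2 (Real.exp (k * v)) with h2 | h2
    · have h3 := mangoldtLogSum_floor_bound hb h2
      rw [Real.log_exp, Real.log_mul (by positivity) hv0.ne'] at h3
      have h4 : 18 / (k * v) ≤ 18 / Real.log 2 := by
        gcongr
        rw [Real.log_le_iff_le_exp (by norm_num)]; exact h2
      have h5 := h3.trans h4
      have h6 := neg_abs_le b
      have h7 := le_abs_self b
      have h8 := neg_abs_le (Real.log v)
      have h9 := le_abs_self (Real.log v)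
      rw [abs_le] at h5 ⊢
      constructor <;> linarith [h5.1, h5.2]
    · have hfl : ⌊Real.exp (k * v)⌋₊ < 2 := (Nat.floor_lt (by positivity)).2 (by exact_mod_cast h2)
      have hz : mangoldtLogSum ⌊Real.exp (k * v)⌋₊ = 0 := by
        unfold mangoldtLogSum
        refine Finset.sum_eq_zero fun i hi => ?_
        have := Finset.mem_Ioc.1 hi
        have : i = 1 := by omega
        simp [this]
      rw [hz, zero_sub, abs_neg, abs_of_nonneg hk0]
      have hkv : k * v ≤ 1 := by
        have : k * v < Real.log 2 := by rw [Real.lt_log_iff_exp_lt (by norm_num)]; exact h2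
        linarith [Real.log_two_lt_d9]
      have h3 : Real.log k ≤ -Real.log v := by
        have : Real.log (k * v) ≤ 0 := Real.log_nonpos (by positivity) hkv
        rw [Real.log_mul (by positivity) hv0.ne'] at this
        linarith
      have := neg_abs_le (Real.log v)
      have := abs_nonneg b
      linarith
  have hlim : ∀ v ∈ Set.Ioi (0:ℝ), Filter.Tendsto (fun k => F k v) Filter.atTop
      (nhds ((Real.log v + b) * Real.exp (-v))) := by
    intro v hv
    have hv0 : 0 < v := hv
    apply Filter.Tendsto.mul_const
    rw [tendsto_iff_norm_sub_tendsto_zero]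
    have hkv : Filter.Tendsto (fun k : ℕ => (k:ℝ) * v) Filter.atTop Filter.atTop :=
      tendsto_natCast_atTop_atTop.atTop_mul_const hv0
    refine squeeze_zero' (Filter.Eventually.of_forall fun k => norm_nonneg _) ?_
      (hkv.const_div_atTop 18)
    filter_upwards [hkv.eventually_ge_atTop 1, Filter.eventually_ge_atTop 1] with k hk1 hk
    have h2 : 2 ≤ Real.exp (k * v) := by
      have := Real.add_one_le_exp (k * v : ℝ); linarith
    have h3 := mangoldtLogSum_floor_bound hb h2
    have hkR : (1:ℝ) ≤ k := by exact_mod_cast hk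
    rw [Real.log_exp, Real.log_mul (by positivity) hv0.ne'] at h3
    rw [Real.norm_eq_abs]
    convert h3 using 2; ring
  have hdct := tendsto_integral_filter_of_dominated_convergence (μ := volume.restrict (Set.Ioi (0:ℝ)))
    (F := F) (l := Filter.atTop)
    (fun v => |Real.log v * Real.exp (-v)| + (|b| + 18 / Real.log 2) * Real.exp (-v))
    (Filter.Eventually.of_forall fun k => (hmeas k).aestronglyMeasurable)
    (Filter.eventually_atTop.2 ⟨1, fun k hk =>
      (ae_restrict_iff' measurableSet_Ioi).2 (Filter.Eventually.of_forall (hbound k hk))⟩)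
    (hI.abs.add (hE.const_mul _))
    ((ae_restrict_iff' measurableSet_Ioi).2 (Filter.Eventually.of_forall hlim))
  have hInt : ∫ v in Set.Ioi (0:ℝ), (Real.log v + b) * Real.exp (-v) =
      -Real.eulerMascheroniConstant + b := by
    simp_rw [add_mul]
    rw [integral_add hI (hE.const_mul b), hγ, integral_const_mul, integral_exp_neg_Ioi_zero, mul_one]
  rw [hInt] at hdct
  have hval : ∀ k : ℕ, 1 ≤ k → ∫ v in Set.Ioi (0:ℝ), F k v =
      Real.log (riemannZeta ((1 + 1 / (k:ℝ) : ℝ) : ℂ)).re + Real.log (1 + 1 / (k:ℝ) - 1) := by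
    intro k hk
    have hkR : (0:ℝ) < k := by exact_mod_cast hk
    rw [log_zeta_eq_integral (by positivity), integral_substitution hkR]
    have hFi : IntegrableOn (F k) (Set.Ioi 0) := by
      refine Integrable.mono' (hI.abs.add (hE.const_mul (|b| + 18 / Real.log 2)))
        (hmeas k).aestronglyMeasurable
        ((ae_restrict_iff' measurableSet_Ioi).2 (Filter.Eventually.of_forall (hbound k hk)))
    have e : (fun v : ℝ => mangoldtLogSum ⌊Real.exp (k * v)⌋₊ * Real.exp (-v)) =
        fun v => F k v + Real.log k * Real.exp (-v) := by
      funext v; simp only [F]; ring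
    rw [e, integral_add hFi (hE.const_mul _), integral_const_mul, integral_exp_neg_Ioi_zero]
    rw [show (1 + 1 / (k:ℝ) - 1) = (k:ℝ)⁻¹ by ring, Real.log_inv]; ring
  have hz := log_riemannZeta_add_log_sub_isLittleO_ofReal
  rw [Asymptotics.isLittleO_one_iff] at hz
  have hseq : Filter.Tendsto (fun k : ℕ => (1 + 1 / (k:ℝ))) Filter.atTop (nhdsWithin 1 (Set.Ioi 1)) := by
    rw [tendsto_nhdsWithin_iff]
    constructor
    · have := (tendsto_one_div_atTop_nhds_zero_nat (𝕜 := ℝ)).const_add 1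
      simpa using this
    · filter_upwards [Filter.eventually_ge_atTop 1] with k hk
      have hkR : (0:ℝ) < k := by exact_mod_cast hk
      have : 0 < 1 / (k:ℝ) := by positivity
      simp only [Set.mem_Ioi]; linarith
  have h0 := hz.comp hseq
  have h1 : Filter.Tendsto (fun k => ∫ v in Set.Ioi (0:ℝ), F k v) Filter.atTop (nhds 0) := by
    refine h0.congr' ?_
    filter_upwards [Filter.eventually_ge_atTop 1] with k hk
    rw [hval k hk]; rfl
  have := tendsto_nhds_unique h1 hdct
  linarith

lemma sum_prime_powers_le (z : ℕ) :
    ∑ p ∈ (z + 1).primesBelow, ∑ i ∈ Finset.range (Nat.log p z),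
      (1 / (p:ℝ)) ^ (i + 1) / ((i:ℝ) + 1) ≤ mangoldtLogSum z := by
  rw [Finset.sum_sigma']
  set S := (z + 1).primesBelow.sigma fun p => Finset.range (Nat.log p z) with hS
  have hmem : ∀ q ∈ S, q.1 ≤ z ∧ q.1.Prime ∧ q.2 < Nat.log q.1 z := by
    intro q hq
    rw [hS, Finset.mem_sigma, Nat.mem_primesBelow, Finset.mem_range] at hq
    exact ⟨by omega, hq.1.2, hq.2⟩
  have hinj : Set.InjOn (fun q : (_ : ℕ) × ℕ => q.1 ^ (q.2 + 1)) S := by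
    intro q hq r hr h
    obtain ⟨h1, h2⟩ := (hmem q hq).2.1.pow_inj (hmem r hr).2.1 h
    cases q; cases r
    simp only at h1 h2
    subst h1; subst h2; rfl
  have hterm : ∀ q ∈ S, (1 / (q.1:ℝ)) ^ (q.2 + 1) / ((q.2:ℝ) + 1) =
      ArithmeticFunction.vonMangoldt (q.1 ^ (q.2 + 1)) /
        (((q.1 ^ (q.2 + 1) : ℕ) : ℝ) * Real.log ((q.1 ^ (q.2 + 1) : ℕ) : ℝ)) := by
    intro q hq
    have hp := (hmem q hq).2.1
    have hp1 : (1:ℝ) < q.1 := by exact_mod_cast hp.one_lt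
    have hl := Real.log_pos hp1
    rw [ArithmeticFunction.vonMangoldt_apply_pow (Nat.succ_ne_zero _),
      ArithmeticFunction.vonMangoldt_apply_prime hp]
    push_cast
    rw [Real.log_pow]
    push_cast
    have : (q.1:ℝ) ≠ 0 := by positivity
    field_simp
    rw [← mul_pow, one_div_mul_cancel this, one_pow]
  rw [Finset.sum_congr rfl hterm]
  rw [← Finset.sum_image (s := S) (g := fun q : (_ : ℕ) × ℕ => q.1 ^ (q.2 + 1))
    (f := fun n : ℕ => ArithmeticFunction.vonMangoldt n / ((n:ℝ) * Real.log n)) hinj]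
  refine Finset.sum_le_sum_of_subset_of_nonneg ?_ fun n _ _ =>
    div_nonneg ArithmeticFunction.vonMangoldt_nonneg
      (mul_nonneg (Nat.cast_nonneg _) (Real.log_natCast_nonneg _))
  intro n hn
  obtain ⟨q, hq, rfl⟩ := Finset.mem_image.1 hn
  obtain ⟨h1, h2, h3⟩ := hmem q hq
  have h4 : q.1 ^ (q.2 + 1) ≤ q.1 ^ Nat.log q.1 z := Nat.pow_le_pow_right h2.pos h3
  have h5 := Nat.pow_log_le_self q.1 (x := z) (by have := h2.pos; omega)
  exact Finset.mem_Ioc.2 ⟨pow_pos h2.pos _, h4.trans h5⟩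

lemma neg_log_one_sub_prime_le {p z : ℕ} (hp : p.Prime) (hpz : p ≤ z) :
    -Real.log (1 - 1 / (p:ℝ)) ≤ (∑ i ∈ Finset.range (Nat.log p z),
      (1 / (p:ℝ)) ^ (i + 1) / ((i:ℝ) + 1)) + 2 * (z:ℝ) ^ (-(1/4:ℝ)) * (p:ℝ) ^ (-(3/2:ℝ)) := by
  have hp2 : (2:ℝ) ≤ p := by exact_mod_cast hp.two_le
  have hp0 : (0:ℝ) < p := by linarith
  have hz0 : (0:ℝ) < z := by exact_mod_cast hp.pos.trans_le hpz
  have hx0 : 0 < 1 / (p:ℝ) := by positivity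
  have hx : 1 / (p:ℝ) ≤ 1 / 2 := one_div_le_one_div_of_le (by norm_num) hp2
  have h := Real.abs_log_sub_add_sum_range_le (x := 1 / (p:ℝ))
    (by rw [abs_of_pos hx0]; linarith) (Nat.log p z)
  rw [abs_of_pos hx0] at h
  have h1 := neg_abs_le (∑ i ∈ Finset.range (Nat.log p z), (1 / (p:ℝ)) ^ (i + 1) / ((i:ℝ) + 1) +
    Real.log (1 - 1 / (p:ℝ)))
  set P : ℝ := (p:ℝ) ^ (Nat.log p z + 1) with hP
  have hPz : (z:ℝ) ≤ P := by
    rw [hP]; exact_mod_cast (Nat.lt_pow_succ_log_self hp.one_lt z).le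
  have hPp : (p:ℝ) ^ 2 ≤ P := by
    refine pow_le_pow_right₀ (by linarith) ?_
    have : 1 ≤ Nat.log p z := Nat.log_pos hp.one_lt hpz
    omega
  have hP0 : 0 < P := by positivity
  have h2 : (1 / (p:ℝ)) ^ (Nat.log p z + 1) = P⁻¹ := by rw [one_div, inv_pow]
  have h3 : P⁻¹ ≤ (z:ℝ) ^ (-(1/4:ℝ)) * (p:ℝ) ^ (-(3/2:ℝ)) := by
    have : P⁻¹ = P ^ (-(1/4:ℝ)) * P ^ (-(3/4:ℝ)) := by
      rw [← Real.rpow_add hP0, ← Real.rpow_neg_one]; norm_num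
    rw [this]
    have e : (p:ℝ) ^ (-(3/2:ℝ)) = ((p:ℝ)^2) ^ (-(3/4:ℝ)) := by
      rw [← Real.rpow_natCast, ← Real.rpow_mul hp0.le]; norm_num
    rw [e]
    exact mul_le_mul (Real.rpow_le_rpow_of_nonpos hz0 hPz (by norm_num))
      (Real.rpow_le_rpow_of_nonpos (by positivity) hPp (by norm_num)) (by positivity) (by positivity)
  have h4 : (1 / (p:ℝ)) ^ (Nat.log p z + 1) / (1 - 1 / (p:ℝ)) ≤ 2 * P⁻¹ := by
    rw [h2, div_le_iff₀ (by linarith)]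
    nlinarith [inv_pos.2 hP0]
  linarith

lemma exists_prod_inv_one_sub_le : ∃ C : ℝ, 0 < C ∧ ∀ z : ℕ, 2 ≤ z →
    ∏ p ∈ (z + 1).primesBelow, (1 - 1 / (p:ℝ))⁻¹ ≤
      Real.exp Real.eulerMascheroniConstant * (Real.log z + C) := by
  obtain ⟨b, hb⟩ := exists_mangoldtLogSum_limit
  have hbγ := mangoldtLogSum_limit_eq hb
  rw [hbγ] at hb
  have hsum : Summable fun n : ℕ => (n:ℝ) ^ (-(3/2:ℝ)) := Real.summable_nat_rpow.2 (by norm_num)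
  set B : ℝ := ∑' n : ℕ, (n:ℝ) ^ (-(3/2:ℝ)) with hB
  have hB0 : 0 ≤ B := tsum_nonneg fun n => by positivity
  set C : ℝ := 8 + 8 * B with hC
  have hC0 : 0 < C := by positivity
  refine ⟨C * Real.exp (C / Real.log 2), by positivity, fun z hz => ?_⟩
  have hz2 : (2:ℝ) ≤ z := by exact_mod_cast hz
  have hlog2 : 0 < Real.log 2 := Real.log_pos (by norm_num)
  have hl2 : Real.log 2 ≤ Real.log z := Real.log_le_log (by norm_num) hz2
  have hl : 0 < Real.log z := by linarith
  have hpr : ∀ p ∈ (z + 1).primesBelow, p.Prime ∧ p ≤ z := fun p hp => by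
    rw [Nat.mem_primesBelow] at hp; exact ⟨hp.2, by omega⟩
  have hpos : ∀ p ∈ (z + 1).primesBelow, 0 < 1 - 1 / (p:ℝ) := fun p hp => by
    have : (1:ℝ) < p := by exact_mod_cast (hpr p hp).1.one_lt
    rw [sub_pos, div_lt_one (by linarith)]; exact this
  have hprod : ∏ p ∈ (z + 1).primesBelow, (1 - 1 / (p:ℝ))⁻¹ =
      Real.exp (∑ p ∈ (z + 1).primesBelow, -Real.log (1 - 1 / (p:ℝ))) := by
    rw [Real.exp_sum]
    refine Finset.prod_congr rfl fun p hp => ?_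
    rw [Real.exp_neg, Real.exp_log (hpos p hp)]
  have h1 : ∑ p ∈ (z + 1).primesBelow, -Real.log (1 - 1 / (p:ℝ)) ≤
      mangoldtLogSum z + 2 * (z:ℝ) ^ (-(1/4:ℝ)) * B := by
    calc _ ≤ ∑ p ∈ (z + 1).primesBelow, ((∑ i ∈ Finset.range (Nat.log p z),
          (1 / (p:ℝ)) ^ (i + 1) / ((i:ℝ) + 1)) + 2 * (z:ℝ) ^ (-(1/4:ℝ)) * (p:ℝ) ^ (-(3/2:ℝ))) :=
          Finset.sum_le_sum fun p hp => neg_log_one_sub_prime_le (hpr p hp).1 (hpr p hp).2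
      _ ≤ _ := by
          rw [Finset.sum_add_distrib, ← Finset.mul_sum]
          gcongr
          · exact sum_prime_powers_le z
          · exact hsum.sum_le_tsum _ fun n _ => by positivity
  have h2 := (abs_le.1 (hb z hz)).2
  have h3 : (z:ℝ) ^ (-(1/4:ℝ)) ≤ 4 / Real.log z := by
    have := Real.log_le_rpow_div (x := z) (ε := 1/4) (by linarith) (by norm_num)
    rw [Real.rpow_neg (by linarith), le_div_iff₀ hl]
    have hq : 0 < (z:ℝ) ^ (1/4:ℝ) := by positivity
    rw [inv_mul_le_iff₀ hq]; linarith
  have h4 : ∑ p ∈ (z + 1).primesBelow, -Real.log (1 - 1 / (p:ℝ)) ≤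
      Real.log (Real.log z) + Real.eulerMascheroniConstant + C / Real.log z := by
    have : 2 * (z:ℝ) ^ (-(1/4:ℝ)) * B ≤ 2 * (4 / Real.log z) * B := by gcongr
    have e : C / Real.log z = 8 / Real.log z + 2 * (4 / Real.log z) * B := by
      rw [hC]; field_simp; ring
    rw [e]; linarith
  rw [hprod]
  refine (Real.exp_le_exp.2 h4).trans ?_
  rw [Real.exp_add, Real.exp_add, Real.exp_log hl]
  have h5 : Real.exp (C / Real.log z) ≤ 1 + C / Real.log z * Real.exp (C / Real.log 2) := by
    have ht0 : 0 < C / Real.log z := by positivity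
    have ht : C / Real.log z ≤ C / Real.log 2 := by gcongr
    have h6 : Real.exp (C / Real.log z) - 1 ≤ C / Real.log z * Real.exp (C / Real.log z) := by
      have := Real.add_one_le_exp (-(C / Real.log z))
      have h7 := mul_le_mul_of_nonneg_left this (Real.exp_pos (C / Real.log z)).le
      rw [← Real.exp_add, add_neg_cancel, Real.exp_zero] at h7
      linarith
    have := mul_le_mul_of_nonneg_left (Real.exp_le_exp.2 ht) ht0.le
    linarith
  calc _ ≤ Real.log z * Real.exp Real.eulerMascheroniConstant *
      (1 + C / Real.log z * Real.exp (C / Real.log 2)) := by gcongr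
    _ = _ := by field_simp

lemma prod_one_sub_inv_sq_le {z : ℕ} (hz : 2 ≤ z) :
    ∏ p ∈ (z + 1).primesBelow, (1 - 1 / (p:ℝ) ^ 2) ≤ 6 / π ^ 2 * (1 + 2 / z) := by
  have hz2 : (2:ℝ) ≤ z := by exact_mod_cast hz
  let f : ℕ →* ℝ :=
    { toFun := fun n => 1 / (n:ℝ) ^ 2
      map_one' := by simp
      map_mul' := fun m n => by push_cast; rw [mul_pow, one_div_mul_one_div] }
  have hf : ∀ {p : ℕ}, p.Prime → ‖f p‖ < 1 := fun {p} hp => by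
    have : (2:ℝ) ≤ p := by exact_mod_cast hp.two_le
    change ‖1 / (p:ℝ) ^ 2‖ < 1
    rw [Real.norm_of_nonneg (by positivity), div_lt_one (by positivity)]
    nlinarith
  have h1 := (EulerProduct.summable_and_hasSum_smoothNumbers_prod_primesBelow_geometric hf (z + 1)).2
  have h2 : ∑ n ∈ Finset.Ioc 0 z, 1 / (n:ℝ) ^ 2 ≤
      ∏ p ∈ (z + 1).primesBelow, (1 - 1 / (p:ℝ) ^ 2)⁻¹ := by
    have h3 : HasSum (Set.indicator (Nat.smoothNumbers (z + 1)) fun n => f n)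
        (∏ p ∈ (z + 1).primesBelow, (1 - f p)⁻¹) := by
      rw [← hasSum_subtype_iff_indicator]; exact h1
    have h4 := sum_le_hasSum (Finset.Ioc 0 z) (fun n _ => Set.indicator_nonneg (fun n _ => by
      change (0:ℝ) ≤ 1 / (n:ℝ) ^ 2; positivity) n) h3
    refine le_trans (le_of_eq (Finset.sum_congr rfl fun n hn => ?_)) h4
    rw [Set.indicator_of_mem]
    · rfl
    · rw [Finset.mem_Ioc] at hn
      rw [Nat.mem_smoothNumbers]
      refine ⟨by omega, fun p hp => ?_⟩
      have := Nat.le_of_dvd hn.1 (Nat.dvd_of_mem_primeFactorsList hp)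
      omega
  have h5 : π ^ 2 / 6 - 1 / z ≤ ∑ n ∈ Finset.Ioc 0 z, 1 / (n:ℝ) ^ 2 := by
    have h6 := hasSum_zeta_two
    refine le_of_tendsto (h6.tendsto_sum_nat.sub_const (1 / (z:ℝ))) ?_
    filter_upwards [Filter.eventually_gt_atTop z] with N hN
    have : ∀ m : ℕ, ∑ n ∈ Finset.range (z + 1 + m), 1 / (n:ℝ) ^ 2 ≤
        ∑ n ∈ Finset.Ioc 0 z, 1 / (n:ℝ) ^ 2 + 1 / (z:ℝ) - 1 / ((z:ℝ) + (m:ℝ)) := by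
      intro m
      induction m with
      | zero =>
        have : Finset.range (z + 1 + 0) = insert 0 (Finset.Ioc 0 z) := by
          ext a; simp
        rw [this, Finset.sum_insert (by simp)]; simp
      | succ m ih =>
        rw [← add_assoc, Finset.sum_range_succ]
        have e : 1 / (((z + 1 + m : ℕ) : ℝ)) ^ 2 ≤ 1 / ((z:ℝ) + m) - 1 / ((z:ℝ) + (m + 1 : ℕ)) := by
          push_cast
          have ha : (0:ℝ) < (z:ℝ) + m := by positivity
          rw [div_sub_div _ _ (by positivity) (by positivity), div_le_div_iff₀ (by positivity) (by positivity)]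
          nlinarith
        linarith
    have h7 := this (N - (z + 1))
    rw [show z + 1 + (N - (z + 1)) = N by omega] at h7
    have : (0:ℝ) ≤ 1 / ((z:ℝ) + (N - (z + 1) : ℕ)) := by positivity
    linarith
  have hpos : 0 < ∏ p ∈ (z + 1).primesBelow, (1 - 1 / (p:ℝ) ^ 2) := by
    refine Finset.prod_pos fun p hp => ?_
    have : (2:ℝ) ≤ p := by exact_mod_cast (Nat.mem_primesBelow.1 hp).2.two_le
    rw [sub_pos, div_lt_one (by positivity)]; nlinarith
  rw [Finset.prod_inv_distrib] at h2
  have h8 := h5.trans h2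
  set P := ∏ p ∈ (z + 1).primesBelow, (1 - 1 / (p:ℝ) ^ 2)
  have hpi : 9 < π ^ 2 := by nlinarith [Real.pi_gt_three]
  have h9 : P * (π ^ 2 / 6 - 1 / z) ≤ 1 := by
    have := mul_le_mul_of_nonneg_left h8 hpos.le
    rwa [mul_inv_cancel₀ hpos.ne'] at this
  have hzi : 1 / (z:ℝ) ≤ 1 / 2 := one_div_le_one_div_of_le (by norm_num) hz2
  have hzi0 : 0 < 1 / (z:ℝ) := by positivity
  have h10 : 1 ≤ (π ^ 2 / 6 - 1 / z) * (6 / π ^ 2 * (1 + 2 / z)) := by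
    rw [show (π ^ 2 / 6 - 1 / (z:ℝ)) * (6 / π ^ 2 * (1 + 2 / z)) =
      (1 - 6 / π ^ 2 * (1 / z)) * (1 + 2 * (1 / (z:ℝ))) by field_simp]
    have : 6 / π ^ 2 ≤ 2 / 3 := by rw [div_le_div_iff₀ (by positivity) (by norm_num)]; linarith
    have h0 : 0 < 6 / π ^ 2 := by positivity
    set t := 1 / (z:ℝ)
    nlinarith [mul_le_mul_of_nonneg_right this hzi0.le, mul_pos hzi0 hzi0]
  have hA : 0 < π ^ 2 / 6 - 1 / (z:ℝ) := by nlinarith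
  nlinarith [mul_le_mul_of_nonneg_left h9 hA.le]

/-- The weight of a prime `q` in the `j`-th conditional average. -/
noncomputable def primeWeight (j q : ℕ) : ℝ := if q ≤ j then 1 / (q:ℝ) else 1 / (q:ℝ) ^ 2

lemma primeWeight_nonneg (j q : ℕ) : 0 ≤ primeWeight j q := by
  unfold primeWeight; split_ifs <;> positivity

lemma prod_Ioc_one_add_inv_sq_le {z M : ℕ} (hz : 1 ≤ z) (hM : z ≤ M) :
    ∏ n ∈ Finset.Ioc z M, (1 + 1 / (n:ℝ) ^ 2) ≤ 1 + 1 / (z:ℝ) := by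
  have hz1 : (1:ℝ) ≤ z := by exact_mod_cast hz
  have key : ∏ n ∈ Finset.Ioc z M, (1 + 1 / (n:ℝ) ^ 2) ≤ (1 + 1 / (z:ℝ)) * ((M:ℝ) / (M + 1)) := by
    induction M, hM using Nat.le_induction with
    | base => simp only [Finset.Ioc_self, Finset.prod_empty]; field_simp; rfl
    | succ M hM ih =>
      have hM1 : (1:ℝ) ≤ M := hz1.trans (by exact_mod_cast hM)
      rw [Finset.prod_Ioc_succ_top (by omega)]
      push_cast
      calc _ ≤ (1 + 1 / (z:ℝ)) * ((M:ℝ) / (M + 1)) * (1 + 1 / ((M:ℝ) + 1) ^ 2) := by gcongr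
        _ ≤ _ := by
          rw [mul_assoc]
          gcongr
          rw [show (1 + 1 / ((M:ℝ) + 1) ^ 2) = (((M:ℝ) + 1) ^ 2 + 1) / ((M:ℝ) + 1) ^ 2 by field_simp,
            div_mul_div_comm, div_le_div_iff₀ (by positivity) (by positivity)]
          nlinarith [sq_nonneg ((M:ℝ) + 1)]
  refine key.trans ?_
  have : (M:ℝ) / (M + 1) ≤ 1 := by rw [div_le_one (by positivity)]; linarith
  have h0 : 0 ≤ 1 + 1 / (z:ℝ) := by positivity
  nlinarith

lemma exists_prod_primeWeight_le : ∃ C : ℝ, 0 < C ∧ ∀ z D : ℕ, 2 ≤ z →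
    ∏ q ∈ (D + 1).primesBelow, (1 + primeWeight z q) ≤
      6 / π ^ 2 * Real.exp Real.eulerMascheroniConstant * (Real.log z + C) := by
  obtain ⟨C, hC0, hC⟩ := exists_prod_inv_one_sub_le
  refine ⟨4 * C + 4, by positivity, fun z D hz => ?_⟩
  have hz2 : (2:ℝ) ≤ z := by exact_mod_cast hz
  have h1 : ∏ q ∈ (D + 1).primesBelow, (1 + primeWeight z q) ≤
      ∏ q ∈ (max z D + 1).primesBelow, (1 + primeWeight z q) := by
    refine Finset.prod_le_prod_of_subset_of_one_le (fun q hq => ?_) (fun q _ => ?_) (fun q _ _ => ?_)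
    · rw [Nat.mem_primesBelow] at hq ⊢; exact ⟨by omega, hq.2⟩
    · linarith [primeWeight_nonneg z q]
    · linarith [primeWeight_nonneg z q]
  have h2 : ∏ q ∈ (max z D + 1).primesBelow, (1 + primeWeight z q) ≤
      (∏ q ∈ (z + 1).primesBelow, (1 + 1 / (q:ℝ))) *
        ∏ n ∈ Finset.Ioc z (max z D), (1 + 1 / (n:ℝ) ^ 2) := by
    rw [← Finset.prod_filter_mul_prod_filter_not _ (fun q => q ≤ z)]
    have e1 : ((max z D + 1).primesBelow.filter fun q => q ≤ z) = (z + 1).primesBelow := by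
      ext q; simp only [Finset.mem_filter, Nat.mem_primesBelow]
      constructor
      · rintro ⟨⟨_, h⟩, h'⟩; exact ⟨by omega, h⟩
      · rintro ⟨h, h'⟩; exact ⟨⟨by omega, h'⟩, by omega⟩
    rw [e1]
    have e2 : ∏ q ∈ (z + 1).primesBelow, (1 + primeWeight z q) =
        ∏ q ∈ (z + 1).primesBelow, (1 + 1 / (q:ℝ)) := by
      refine Finset.prod_congr rfl fun q hq => ?_
      rw [Nat.mem_primesBelow] at hq
      rw [primeWeight, if_pos (by omega)]
    rw [e2]
    refine mul_le_mul_of_nonneg_left ?_ (Finset.prod_nonneg fun q _ => by positivity)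
    have e3 : ∏ q ∈ (max z D + 1).primesBelow with ¬ q ≤ z, (1 + primeWeight z q) =
        ∏ q ∈ (max z D + 1).primesBelow with ¬ q ≤ z, (1 + 1 / (q:ℝ) ^ 2) := by
      refine Finset.prod_congr rfl fun q hq => ?_
      rw [primeWeight, if_neg (Finset.mem_filter.1 hq).2]
    rw [e3]
    refine Finset.prod_le_prod_of_subset_of_one_le (fun q hq => ?_) (fun q _ => by positivity)
      (fun q _ _ => ?_)
    · rw [Finset.mem_filter, Nat.mem_primesBelow] at hq
      exact Finset.mem_Ioc.2 ⟨by omega, by omega⟩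
    · have : (0:ℝ) ≤ 1 / (q:ℝ) ^ 2 := by positivity
      linarith
  have h3 : ∏ q ∈ (z + 1).primesBelow, (1 + 1 / (q:ℝ)) =
      (∏ q ∈ (z + 1).primesBelow, (1 - 1 / (q:ℝ) ^ 2)) * ∏ q ∈ (z + 1).primesBelow, (1 - 1 / (q:ℝ))⁻¹ := by
    rw [← Finset.prod_mul_distrib]
    refine Finset.prod_congr rfl fun q hq => ?_
    have : (2:ℝ) ≤ q := by exact_mod_cast (Nat.mem_primesBelow.1 hq).2.two_le
    have h0 : 1 - 1 / (q:ℝ) ≠ 0 := by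
      rw [sub_ne_zero, ne_eq, eq_comm, div_eq_one_iff_eq (by linarith)]; linarith
    rw [eq_mul_inv_iff_mul_eq₀ h0]; field_simp; ring
  have h4 := prod_Ioc_one_add_inv_sq_le (z := z) (M := max z D) (by omega) (le_max_left _ _)
  have h5 := hC z hz
  have h6 := prod_one_sub_inv_sq_le hz
  have hp5 : 0 ≤ ∏ q ∈ (z + 1).primesBelow, (1 - 1 / (q:ℝ))⁻¹ := by
    refine Finset.prod_nonneg fun q hq => ?_
    have : (2:ℝ) ≤ q := by exact_mod_cast (Nat.mem_primesBelow.1 hq).2.two_le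
    refine inv_nonneg.2 ?_
    rw [sub_nonneg, div_le_one (by linarith)]; linarith
  have hlz : 0 ≤ Real.log z := Real.log_natCast_nonneg _
  rw [h3] at h2
  refine h1.trans (h2.trans ?_)
  have hE := Real.exp_pos Real.eulerMascheroniConstant
  set E := Real.exp Real.eulerMascheroniConstant
  calc _ ≤ (6 / π ^ 2 * (1 + 2 / z)) * (E * (Real.log z + C)) * (1 + 1 / z) := by gcongr
    _ = 6 / π ^ 2 * E * ((1 + 2 / z) * (1 + 1 / z) * (Real.log z + C)) := by ring
    _ ≤ 6 / π ^ 2 * E * (Real.log z + (4 * C + 4)) := by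
      gcongr
      have hle : Real.log z ≤ z - 1 := Real.log_le_sub_one_of_pos (by linarith)
      have hu : (1:ℝ) / z ≤ 1 / 2 := one_div_le_one_div_of_le (by norm_num) hz2
      have hu0 : (0:ℝ) < 1 / z := by positivity
      have hul : 1 / (z:ℝ) * Real.log z ≤ 1 := by
        rw [div_mul_eq_mul_div, one_mul, div_le_one (by linarith)]; linarith
      rw [show (2:ℝ) / z = 2 * (1 / z) by ring]
      set t := (1:ℝ) / z
      have hq : (1 + 2 * t) * (1 + t) ≤ 1 + 4 * t := by nlinarith
      calc _ ≤ (1 + 4 * t) * (Real.log z + C) := by gcongr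
        _ ≤ _ := by nlinarith

lemma sum_mangoldt_log_div_sq_le (n : ℕ) : ∀ z M : ℕ, 4 ≤ z → M - z ≤ n →
    ∑ i ∈ Finset.Ioc z M, ArithmeticFunction.vonMangoldt i * Real.log i / (i:ℝ) ^ 2 ≤
      32 * Real.log z / z := by
  induction n using Nat.strong_induction_on with
  | _ n ih =>
  intro z M hz hn
  have hz4 : (4:ℝ) ≤ z := by exact_mod_cast hz
  have hterm : ∀ i : ℕ, 0 ≤ ArithmeticFunction.vonMangoldt i * Real.log i / (i:ℝ) ^ 2 := fun i =>
    div_nonneg (mul_nonneg ArithmeticFunction.vonMangoldt_nonneg (Real.log_natCast_nonneg _))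
      (by positivity)
  have hlz : 0 < Real.log z := Real.log_pos (by linarith)
  rcases le_or_gt M z with h | h
  · rw [Finset.Ioc_eq_empty (by omega)]; simp; positivity
  have hblock : ∑ i ∈ Finset.Ioc z (2 * z),
      ArithmeticFunction.vonMangoldt i * Real.log i / (i:ℝ) ^ 2 ≤ 8 * (Real.log z / z) := by
    have h1 : ∑ i ∈ Finset.Ioc z (2 * z), ArithmeticFunction.vonMangoldt i / (i:ℝ) ≤ 8 := by
      have ha := (mertens_first (N := z) (by omega)).1
      have hb := (mertens_first (N := 2 * z) (by omega)).2
      have hs := Finset.sum_Ioc_consecutive (fun i : ℕ => ArithmeticFunction.vonMangoldt i / (i:ℝ))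
        (Nat.zero_le z) (by omega : z ≤ 2 * z)
      push_cast at hb
      rw [Real.log_mul (by norm_num) (by linarith)] at hb
      have := Real.log_two_lt_d9
      linarith
    calc _ ≤ ∑ i ∈ Finset.Ioc z (2 * z), ArithmeticFunction.vonMangoldt i / (i:ℝ) * (Real.log z / z) := by
          refine Finset.sum_le_sum fun i hi => ?_
          have hi' := Finset.mem_Ioc.1 hi
          have hzi : (z:ℝ) ≤ i := by exact_mod_cast hi'.1.le
          have he : Real.exp 1 ≤ 4 := by linarith [Real.exp_one_lt_d9]
          have := Real.log_div_self_antitoneOn (a := (z:ℝ)) (b := (i:ℝ)) (by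
            simp only [Set.mem_Ici]; linarith) (by simp only [Set.mem_Ici]; linarith) hzi
          simp only at this
          rw [show ArithmeticFunction.vonMangoldt i * Real.log i / (i:ℝ) ^ 2 =
            ArithmeticFunction.vonMangoldt i / (i:ℝ) * (Real.log i / i) by
              have : (i:ℝ) ≠ 0 := by linarith
              field_simp]
          exact mul_le_mul_of_nonneg_left this
            (div_nonneg ArithmeticFunction.vonMangoldt_nonneg (by positivity))
      _ ≤ _ := by
        rw [← Finset.sum_mul]; gcongr
  rcases le_or_gt M (2 * z) with h' | h'
  · have := Finset.sum_le_sum_of_subset_of_nonneg (Finset.Ioc_subset_Ioc_right h' : Finset.Ioc z M ⊆ _)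
      (fun i _ _ => hterm i)
    refine this.trans (hblock.trans ?_)
    rw [mul_div_assoc]; gcongr; norm_num
  · rw [← Finset.sum_Ioc_consecutive _ (by omega : z ≤ 2 * z) h'.le]
    have h2 := ih (M - 2 * z) (by omega) (2 * z) M (by omega) le_rfl
    push_cast at h2
    rw [Real.log_mul (by norm_num) (by linarith)] at h2
    have h3 : Real.log 2 ≤ Real.log z / 2 := by
      have : Real.log (2 ^ 2 : ℝ) ≤ Real.log z := Real.log_le_log (by norm_num) (by linarith)
      rw [Real.log_pow] at this; push_cast at this; linarith
    have h4 : 32 * (Real.log 2 + Real.log z) / (2 * z) ≤ 24 * (Real.log z / z) := by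
      rw [div_le_iff₀ (by linarith)]
      have : 24 * (Real.log z / z) * (2 * z) = 48 * Real.log z := by field_simp; norm_num
      rw [this]; linarith
    have : 32 * Real.log z / z = 8 * (Real.log z / z) + 24 * (Real.log z / z) := by ring
    rw [this]; linarith

lemma sum_primes_log_sq_le {z M : ℕ} (hz : 4 ≤ z) :
    ∑ p ∈ (Finset.Ioc z M).filter Nat.Prime, (Real.log p / p) ^ 2 ≤ 32 * Real.log z / z := by
  refine le_trans ?_ (sum_mangoldt_log_div_sq_le _ z M hz le_rfl)
  rw [Finset.sum_filter]
  refine Finset.sum_le_sum fun i _ => ?_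
  split_ifs with h
  · rw [ArithmeticFunction.vonMangoldt_apply_prime h, div_pow, sq (Real.log i)]
  · exact div_nonneg (mul_nonneg ArithmeticFunction.vonMangoldt_nonneg (Real.log_natCast_nonneg _))
      (by positivity)

lemma sum_moebius_primeFactors_le {g : ℕ → ℝ} (hg : ∀ q, 0 ≤ g q) (D : ℕ) :
    ∑ d ∈ Finset.Ioc 0 D, |(ArithmeticFunction.moebius d : ℝ)| * ∏ q ∈ d.primeFactors, g q ≤
      ∏ q ∈ (D + 1).primesBelow, (1 + g q) := by
  rw [Finset.prod_one_add]
  have h1 : ∑ d ∈ Finset.Ioc 0 D, |(ArithmeticFunction.moebius d : ℝ)| * ∏ q ∈ d.primeFactors, g q =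
      ∑ d ∈ (Finset.Ioc 0 D).filter Squarefree, ∏ q ∈ d.primeFactors, g q := by
    rw [Finset.sum_filter]
    refine Finset.sum_congr rfl fun d _ => ?_
    split_ifs with h
    · rw [← Int.cast_abs, ArithmeticFunction.abs_moebius_eq_one_of_squarefree h]; simp
    · rw [ArithmeticFunction.moebius_eq_zero_of_not_squarefree h]; simp
  rw [h1]
  have hinj : Set.InjOn (fun d : ℕ => d.primeFactors) ((Finset.Ioc 0 D).filter Squarefree : Finset ℕ) := by
    intro a ha b hb h
    simp only [Finset.coe_filter, Set.mem_ofPred_eq] at ha hb h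
    rw [← Nat.prod_primeFactors_of_squarefree ha.2, ← Nat.prod_primeFactors_of_squarefree hb.2, h]
  rw [← Finset.sum_image (g := fun d : ℕ => d.primeFactors) (f := fun t => ∏ q ∈ t, g q) hinj]
  refine Finset.sum_le_sum_of_subset_of_nonneg ?_ fun t _ _ => Finset.prod_nonneg fun q _ => hg q
  intro t ht
  obtain ⟨d, hd, rfl⟩ := Finset.mem_image.1 ht
  rw [Finset.mem_powerset]
  intro q hq
  have hd' := Finset.mem_Ioc.1 (Finset.mem_filter.1 hd).1
  have := Nat.le_of_dvd hd'.1 (Nat.dvd_of_mem_primeFactors hq)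
  exact Nat.mem_primesBelow.2 ⟨by omega, Nat.prime_of_mem_primeFactors hq⟩

lemma sum_moebius_primeFactors_dvd_le {g : ℕ → ℝ} (hg : ∀ q, 0 ≤ g q) (D : ℕ) {p : ℕ} :
    ∑ d ∈ (Finset.Ioc 0 D).filter (fun d => p ∈ d.primeFactors),
      |(ArithmeticFunction.moebius d : ℝ)| * ∏ q ∈ d.primeFactors, g q ≤
      2 * g p * ∏ q ∈ (D + 1).primesBelow, (1 + g q) := by
  have hterm : ∀ (g : ℕ → ℝ), (∀ q, 0 ≤ g q) → ∀ d : ℕ,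
      0 ≤ |(ArithmeticFunction.moebius d : ℝ)| * ∏ q ∈ d.primeFactors, g q :=
    fun g hg d => mul_nonneg (abs_nonneg _) (Finset.prod_nonneg fun q _ => hg q)
  set g' := Function.update g p 1 with hg'
  have hg'0 : ∀ q, 0 ≤ g' q := fun q => by
    rw [hg', Function.update_apply]; split_ifs
    · exact zero_le_one
    · exact hg q
  have h1 : ∀ d ∈ (Finset.Ioc 0 D).filter (fun d => p ∈ d.primeFactors),
      |(ArithmeticFunction.moebius d : ℝ)| * ∏ q ∈ d.primeFactors, g q =
      g p * (|(ArithmeticFunction.moebius d : ℝ)| * ∏ q ∈ d.primeFactors, g' q) := by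
    intro d hd
    have hp := (Finset.mem_filter.1 hd).2
    rw [← Finset.mul_prod_erase _ g hp, ← Finset.mul_prod_erase _ g' hp]
    have : ∏ q ∈ d.primeFactors.erase p, g' q = ∏ q ∈ d.primeFactors.erase p, g q :=
      Finset.prod_congr rfl fun q hq => by
        rw [hg', Function.update_of_ne (Finset.ne_of_mem_erase hq)]
    rw [this, hg', Function.update_self]; ring
  rw [Finset.sum_congr rfl h1, ← Finset.mul_sum, mul_comm 2 (g p), mul_assoc]
  refine mul_le_mul_of_nonneg_left ?_ (hg p)
  calc _ ≤ ∑ d ∈ Finset.Ioc 0 D, |(ArithmeticFunction.moebius d : ℝ)| * ∏ q ∈ d.primeFactors, g' q :=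
        Finset.sum_le_sum_of_subset_of_nonneg (Finset.filter_subset _ _)
          fun d _ _ => hterm g' hg'0 d
    _ ≤ ∏ q ∈ (D + 1).primesBelow, (1 + g' q) := sum_moebius_primeFactors_le hg'0 D
    _ ≤ ∏ q ∈ (D + 1).primesBelow, ((if q = p then 2 else 1) * (1 + g q)) := by
        refine Finset.prod_le_prod (fun q _ => by linarith [hg'0 q]) fun q _ => ?_
        rw [hg', Function.update_apply]
        split_ifs
        · linarith [hg q]
        · linarith
    _ ≤ _ := by
        rw [Finset.prod_mul_distrib]
        refine mul_le_mul_of_nonneg_right ?_ (Finset.prod_nonneg fun q _ => by linarith [hg q])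
        rw [Finset.prod_ite_eq']
        split_ifs <;> norm_num

/-- The centred fractional part. -/
noncomputable def psi (v : ℝ) : ℝ := Int.fract v - 1 / 2

lemma abs_psi_le (v : ℝ) : |psi v| ≤ 1 / 2 := by
  unfold psi
  rw [abs_le]; constructor <;> linarith [Int.fract_nonneg v, Int.fract_lt_one v]

lemma psi_add_int (v : ℝ) (n : ℤ) : psi (v + n) = psi v := by
  unfold psi; rw [Int.fract_add_intCast]

lemma psi_add_nat (v : ℝ) (n : ℕ) : psi (v + n) = psi v := by
  unfold psi; rw [Int.fract_add_natCast]

lemma psi_div_add_of_dvd {s N : ℕ} (hs : s ∣ N) (hs0 : s ≠ 0) (u : ℝ) (l : ℕ) :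
    psi ((u + l * N) / s) = psi (u / s) := by
  obtain ⟨m, rfl⟩ := hs
  have : (s:ℝ) ≠ 0 := by exact_mod_cast hs0
  rw [show (u + l * ((s * m : ℕ):ℝ)) / s = u / s + ((l * m : ℕ) : ℝ) by push_cast; field_simp,
    psi_add_nat]

lemma sum_emod_range {p : ℕ} (hp : 0 < p) {m : ℕ} (hm : Nat.Coprime m p) (a : ℤ) (h : ℤ → ℝ) :
    ∑ l ∈ Finset.range p, h ((a + l * m) % p) = ∑ l ∈ Finset.range p, h l := by
  have hp' : (p:ℤ) ≠ 0 := by exact_mod_cast hp.ne'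
  have hpos : (0:ℤ) < p := by exact_mod_cast hp
  have hinj : Set.InjOn (fun l : ℕ => ((a + l * m) % p).toNat) (Finset.range p : Finset ℕ) := by
    intro l hl l' hl' he
    simp only [Finset.coe_range, Set.mem_Iio] at hl hl' he
    have h1 : (a + l * m) % p = (a + l' * m) % p := by
      have h2 := Int.emod_nonneg (a + l * m) hp'
      have h3 := Int.emod_nonneg (a + l' * m) hp'
      omega
    have h4 : (p:ℤ) ∣ ((l':ℤ) - l) * m := by
      have := Int.ModEq.dvd (show a + l * m ≡ a + l' * m [ZMOD p] from h1)
      rwa [show a + (l':ℤ) * m - (a + l * m) = ((l':ℤ) - l) * m by ring] at this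
    have h5 : (p:ℤ) ∣ (l':ℤ) - l :=
      (Nat.isCoprime_iff_coprime.2 hm.symm).dvd_of_dvd_mul_right h4
    have h6 := Int.eq_zero_of_abs_lt_dvd h5 (by rw [abs_lt]; constructor <;> omega)
    omega
  have hmaps : Set.MapsTo (fun l : ℕ => ((a + l * m) % p).toNat) (Finset.range p : Finset ℕ)
      (Finset.range p : Finset ℕ) := by
    intro l _
    simp only [Finset.coe_range, Set.mem_Iio]
    have h2 := Int.emod_nonneg (a + l * m) hp'
    have h3 := Int.emod_lt_of_pos (a + l * m) hpos
    omega
  refine Finset.sum_nbij (fun l : ℕ => ((a + l * m) % p).toNat) (fun l hl => hmaps hl) hinj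
    (Finset.surjOn_of_injOn_of_card_le _ hmaps hinj le_rfl) fun l _ => ?_
  rw [Int.toNat_of_nonneg (Int.emod_nonneg _ hp')]

lemma sum_psi_shift {p : ℕ} (hp : 0 < p) {m : ℕ} (hm : Nat.Coprime m p) (v : ℝ) :
    ∑ l ∈ Finset.range p, psi ((v + l * m) / p) = psi v := by
  have hp0 : (0:ℝ) < p := by exact_mod_cast hp
  have hpos : (0:ℤ) < p := by exact_mod_cast hp
  set t := Int.fract v with ht
  have h1 : ∀ k : ℤ, psi ((t + k) / p) = (t + ((k % p : ℤ) : ℝ)) / p - 1 / 2 := by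
    intro k
    have hk : (k:ℝ) = ((k % p : ℤ) : ℝ) + p * ((k / p : ℤ) : ℝ) := by
      exact_mod_cast (Int.emod_add_mul_ediv k p).symm
    rw [hk, show (t + (((k % p : ℤ) : ℝ) + p * ((k / p : ℤ) : ℝ))) / p =
      (t + ((k % p : ℤ) : ℝ)) / p + ((k / p : ℤ) : ℝ) by field_simp; ring, psi_add_int]
    rw [psi, Int.fract_eq_self.2]
    · have h2 : (0:ℝ) ≤ ((k % p : ℤ) : ℝ) := by exact_mod_cast Int.emod_nonneg k hpos.ne'
      have h3 : ((k % p : ℤ) : ℝ) ≤ p - 1 := by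
        have := Int.emod_lt_of_pos k hpos
        exact_mod_cast (by omega : k % p ≤ p - 1)
      constructor
      · have := Int.fract_nonneg v; positivity
      · rw [div_lt_one hp0]; linarith [Int.fract_lt_one v]
  have h2 : ∀ l ∈ Finset.range p, psi ((v + l * m) / p) =
      (t + (((⌊v⌋ + l * m) % p : ℤ) : ℝ)) / p - 1 / 2 := by
    intro l _
    rw [← h1]; congr 2; push_cast; linarith [Int.floor_add_fract v]
  rw [Finset.sum_congr rfl h2, sum_emod_range hp hm ⌊v⌋ (fun k => (t + (k:ℝ)) / p - 1 / 2)]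
  rw [Finset.sum_sub_distrib, ← Finset.sum_div, Finset.sum_add_distrib]
  simp only [Finset.sum_const, Finset.card_range, nsmul_eq_mul, Int.cast_natCast]
  have := Finset.sum_range_id_mul_two p
  have h3 : (∑ l ∈ Finset.range p, (l:ℝ)) = p * (p - 1) / 2 := by
    have h4 : ((∑ l ∈ Finset.range p, l : ℕ) : ℝ) * 2 = p * (p - 1) := by
      rw [← Nat.cast_pred hp]; exact_mod_cast this
    push_cast at h4; linarith
  rw [h3, psi]; field_simp; ring

lemma sum_exp_le_of_sum_eq_zero {ι : Type*} {s : Finset ι} {x : ι → ℝ} {b : ℝ}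
    (h0 : ∑ i ∈ s, x i = 0) (hb : ∀ i ∈ s, |x i| ≤ b) :
    ∑ i ∈ s, Real.exp (x i) ≤ s.card * Real.exp (b ^ 2 / 2) := by
  rcases le_or_gt b 0 with h | h
  · calc _ = ∑ i ∈ s, (1:ℝ) := Finset.sum_congr rfl fun i hi => by
          have : x i = 0 := abs_nonpos_iff.1 ((hb i hi).trans h)
          rw [this, Real.exp_zero]
      _ = (s.card : ℝ) * 1 := by simp
      _ ≤ _ := by gcongr; exact Real.one_le_exp (by positivity)
  · have h1 : ∀ i ∈ s, Real.exp (x i) ≤ Real.cosh b + x i * (Real.sinh b / b) := by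
      intro i hi
      have hx := abs_le.1 (hb i hi)
      have := convexOn_exp.2 (Set.mem_univ b) (Set.mem_univ (-b))
        (div_nonneg (by linarith) (by linarith) : 0 ≤ (b + x i) / (2 * b))
        (div_nonneg (by linarith) (by linarith) : 0 ≤ (b - x i) / (2 * b))
        (by field_simp; ring)
      simp only [smul_eq_mul] at this
      rw [show (b + x i) / (2 * b) * b + (b - x i) / (2 * b) * -b = x i by field_simp; ring] at this
      refine this.trans (le_of_eq ?_)
      rw [Real.cosh_eq, Real.sinh_eq]; field_simp; ring
    calc _ ≤ ∑ i ∈ s, (Real.cosh b + x i * (Real.sinh b / b)) := Finset.sum_le_sum h1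
      _ = s.card * Real.cosh b := by
        rw [Finset.sum_add_distrib, ← Finset.sum_mul, h0]; simp
      _ ≤ _ := by gcongr; exact Real.cosh_le_exp_half_sq b

/-- The `j`-smooth part of a squarefree number. -/
def smoothPart (j d : ℕ) : ℕ := ∏ p ∈ d.primeFactors with p ≤ j, p

/-- The signed weight of `d` in the `j`-th conditional average. -/
noncomputable def avgCoeff (j d : ℕ) : ℝ :=
  (ArithmeticFunction.moebius d : ℝ) * ∏ q ∈ d.primeFactors, primeWeight j q

/-- The `j`-th conditional average of `∑_{d ≤ D} μ(d) / d ψ(u / d)`. -/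
noncomputable def condAvg (D j : ℕ) (u : ℝ) : ℝ :=
  ∑ d ∈ Finset.Ioc 0 D, avgCoeff j d * psi (u / smoothPart j d)

lemma abs_avgCoeff (j d : ℕ) : |avgCoeff j d| =
    |(ArithmeticFunction.moebius d : ℝ)| * ∏ q ∈ d.primeFactors, primeWeight j q := by
  rw [avgCoeff, abs_mul, abs_of_nonneg (Finset.prod_nonneg fun q _ => primeWeight_nonneg j q)]

lemma smoothPart_dvd_primorial (j d : ℕ) : smoothPart j d ∣ primorial j := by
  refine Finset.prod_dvd_prod_of_subset _ _ _ fun q hq => ?_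
  rw [Finset.mem_filter] at hq ⊢
  exact ⟨Finset.mem_range.2 (by omega), Nat.prime_of_mem_primeFactors hq.1⟩

lemma smoothPart_ne_zero (j d : ℕ) : smoothPart j d ≠ 0 :=
  Finset.prod_ne_zero_iff.2 fun _ hq =>
    (Nat.prime_of_mem_primeFactors (Finset.mem_filter.1 hq).1).ne_zero

lemma condAvg_add {D j N : ℕ} (hN : primorial j ∣ N) (u : ℝ) (l : ℕ) :
    condAvg D j (u + l * N) = condAvg D j u := by
  refine Finset.sum_congr rfl fun d _ => ?_
  rw [psi_div_add_of_dvd ((smoothPart_dvd_primorial j d).trans hN) (smoothPart_ne_zero j d)]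

lemma primeWeight_succ_of_ne {j q : ℕ} (h : q ≠ j + 1) : primeWeight (j + 1) q = primeWeight j q := by
  unfold primeWeight
  simp only [show (q ≤ j + 1 ↔ q ≤ j) by omega]

lemma avgCoeff_succ_of_notMem {j d : ℕ} (h : j + 1 ∉ d.primeFactors) :
    avgCoeff (j + 1) d = avgCoeff j d := by
  unfold avgCoeff
  congr 1
  refine Finset.prod_congr rfl fun q hq => primeWeight_succ_of_ne ?_
  rintro rfl; exact h hq

lemma smoothPart_succ_of_notMem {j d : ℕ} (h : j + 1 ∉ d.primeFactors) :
    smoothPart (j + 1) d = smoothPart j d := by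
  unfold smoothPart
  congr 1
  ext q
  simp only [Finset.mem_filter, and_congr_right_iff]
  intro hq
  have : q ≠ j + 1 := by rintro rfl; exact h hq
  omega

lemma avgCoeff_succ_of_mem {j d : ℕ} (h : j + 1 ∈ d.primeFactors) :
    avgCoeff (j + 1) d = ((j + 1 : ℕ) : ℝ) * avgCoeff j d := by
  unfold avgCoeff
  rw [← Finset.mul_prod_erase _ _ h, ← Finset.mul_prod_erase _ (primeWeight j) h]
  have : ∏ q ∈ d.primeFactors.erase (j + 1), primeWeight (j + 1) q =
      ∏ q ∈ d.primeFactors.erase (j + 1), primeWeight j q :=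
    Finset.prod_congr rfl fun q hq => primeWeight_succ_of_ne (Finset.ne_of_mem_erase hq)
  rw [this]
  have h0 : ((j + 1 : ℕ) : ℝ) ≠ 0 := by positivity
  have e1 : primeWeight (j + 1) (j + 1) = 1 / ((j + 1 : ℕ) : ℝ) := if_pos le_rfl
  have e2 : primeWeight j (j + 1) = 1 / ((j + 1 : ℕ) : ℝ) ^ 2 := if_neg (by omega)
  rw [e1, e2]; field_simp

lemma smoothPart_succ_of_mem {j d : ℕ} (h : j + 1 ∈ d.primeFactors) :
    smoothPart (j + 1) d = smoothPart j d * (j + 1) := by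
  unfold smoothPart
  have : (d.primeFactors.filter fun p => p ≤ j + 1) =
      insert (j + 1) (d.primeFactors.filter fun p => p ≤ j) := by
    ext q; simp only [Finset.mem_filter, Finset.mem_insert]
    constructor
    · rintro ⟨h1, h2⟩
      rcases Nat.lt_or_ge j q with h3 | h3
      · left; omega
      · right; exact ⟨h1, h3⟩
    · rintro (rfl | ⟨h1, h2⟩)
      · exact ⟨h, le_rfl⟩
      · exact ⟨h1, by omega⟩
  rw [this, Finset.prod_insert (by simp), mul_comm]

lemma condAvg_succ_of_not_prime {D j : ℕ} (h : ¬ (j + 1).Prime) (u : ℝ) :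
    condAvg D (j + 1) u = condAvg D j u := by
  refine Finset.sum_congr rfl fun d _ => ?_
  have : j + 1 ∉ d.primeFactors := fun h' => h (Nat.prime_of_mem_primeFactors h')
  rw [avgCoeff_succ_of_notMem this, smoothPart_succ_of_notMem this]

lemma primorial_succ_prime {j : ℕ} (h : (j + 1).Prime) :
    primorial (j + 1) = (j + 1) * primorial j := by
  unfold primorial
  rw [Finset.range_add_one (n := j + 1), Finset.filter_insert, if_pos h, Finset.prod_insert (by simp)]

lemma primorial_succ_not_prime {j : ℕ} (h : ¬ (j + 1).Prime) :
    primorial (j + 1) = primorial j := by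
  unfold primorial
  rw [Finset.range_add_one (n := j + 1), Finset.filter_insert, if_neg h]

lemma primorial_div_coprime {j s : ℕ} (h : (j + 1).Prime) {m : ℕ} (hm : primorial j = s * m) :
    Nat.Coprime m (j + 1) := by
  rw [Nat.coprime_comm, Nat.Prime.coprime_iff_not_dvd h]
  intro hd
  have h1 : j + 1 ∣ primorial j := hm ▸ hd.mul_left s
  unfold primorial at h1
  rw [Prime.dvd_finsetProd_iff h.prime] at h1
  obtain ⟨q, hq, h2⟩ := h1
  rw [Finset.mem_filter, Finset.mem_range] at hq
  have := Nat.le_of_dvd hq.2.pos h2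
  omega

lemma sum_condAvg_succ {D j : ℕ} (h : (j + 1).Prime) (u : ℝ) :
    ∑ l ∈ Finset.range (j + 1), condAvg D (j + 1) (u + l * primorial j) =
      ((j + 1 : ℕ) : ℝ) * condAvg D j u := by
  unfold condAvg
  rw [Finset.sum_comm, Finset.mul_sum]
  refine Finset.sum_congr rfl fun d _ => ?_
  by_cases hd : j + 1 ∈ d.primeFactors
  · rw [smoothPart_succ_of_mem hd, avgCoeff_succ_of_mem hd, ← Finset.mul_sum]
    obtain ⟨m, hm⟩ := smoothPart_dvd_primorial j d
    have hs : (smoothPart j d : ℝ) ≠ 0 := by exact_mod_cast smoothPart_ne_zero j d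
    rw [← sum_psi_shift h.pos (primorial_div_coprime h hm) (u / smoothPart j d), mul_assoc]
    congr 2
    refine Finset.sum_congr rfl fun l _ => ?_
    rw [hm]; congr 1; push_cast; field_simp
  · rw [smoothPart_succ_of_notMem hd, avgCoeff_succ_of_notMem hd]
    rw [Finset.sum_congr rfl fun l _ => by
      rw [psi_div_add_of_dvd (smoothPart_dvd_primorial j d) (smoothPart_ne_zero j d)]]
    simp

/-- A bound for the increments of the conditional averages. -/
noncomputable def incBound (D p : ℕ) : ℝ :=
  2 * (1 / (p:ℝ)) * ∏ q ∈ (D + 1).primesBelow, (1 + primeWeight p q)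

lemma abs_condAvg_sub_le {D j : ℕ} (u : ℝ) (l : ℕ) :
    |condAvg D (j + 1) (u + l * primorial j) - condAvg D j u| ≤ incBound D (j + 1) := by
  unfold condAvg
  rw [← Finset.sum_sub_distrib]
  have h1 := sum_moebius_primeFactors_dvd_le (primeWeight_nonneg (j + 1)) D (p := j + 1)
  rw [show primeWeight (j + 1) (j + 1) = 1 / ((j + 1 : ℕ) : ℝ) from if_pos le_rfl] at h1
  refine le_trans ?_ h1
  rw [Finset.sum_filter]
  refine (Finset.abs_sum_le_sum_abs _ _).trans (Finset.sum_le_sum fun d _ => ?_)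
  split_ifs with hd
  · rw [← abs_avgCoeff, avgCoeff_succ_of_mem hd]
    refine (abs_sub _ _).trans ?_
    rw [abs_mul, abs_mul, abs_mul]
    have h2 := abs_psi_le ((u + l * primorial j) / smoothPart (j + 1) d)
    have h3 := abs_psi_le (u / smoothPart j d)
    have h4 : (1:ℝ) ≤ |((j + 1 : ℕ) : ℝ)| := by
      rw [abs_of_nonneg (by positivity)]; push_cast; linarith [(Nat.cast_nonneg j : (0:ℝ) ≤ j)]
    have h5 := abs_nonneg (avgCoeff j d)
    have h6 : |avgCoeff j d| ≤ |((j + 1 : ℕ) : ℝ)| * |avgCoeff j d| := by nlinarith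
    have h7 := mul_le_mul_of_nonneg_left h2 (h5.trans h6)
    have h8 := mul_le_mul_of_nonneg_left h3 h5
    linarith
  · rw [smoothPart_succ_of_notMem hd, avgCoeff_succ_of_notMem hd,
      psi_div_add_of_dvd (smoothPart_dvd_primorial j d) (smoothPart_ne_zero j d), sub_self, abs_zero]

lemma sum_range_mul_eq (a b : ℕ) (F : ℕ → ℝ) :
    ∑ i ∈ Finset.range (a * b), F i =
      ∑ i ∈ Finset.range b, ∑ l ∈ Finset.range a, F (i + l * b) := by
  rw [Finset.sum_comm]
  induction a with
  | zero => simp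
  | succ a ih =>
    rw [Nat.succ_mul, Finset.sum_range_add, ih, Finset.sum_range_succ]
    congr 1
    exact Finset.sum_congr rfl fun i _ => by rw [add_comm]

lemma sum_exp_condAvg_le {D z : ℕ} (lam u : ℝ) {j : ℕ} (hj : z ≤ j) :
    ∑ i ∈ Finset.range (primorial j), Real.exp (lam * (condAvg D j (u + i) - condAvg D z (u + i))) ≤
      primorial j * Real.exp (lam ^ 2 / 2 *
        ∑ p ∈ (Finset.Ioc z j).filter Nat.Prime, incBound D p ^ 2) := by
  induction j, hj using Nat.le_induction with
  | base => simp
  | succ j hj ih =>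
    rw [← Finset.insert_Ioc_right_eq_Ioc_add_one (by omega), Finset.filter_insert]
    by_cases h : (j + 1).Prime
    · rw [if_pos h, Finset.sum_insert (by simp), primorial_succ_prime h, sum_range_mul_eq]
      have key : ∀ i ∈ Finset.range (primorial j), ∑ l ∈ Finset.range (j + 1),
          Real.exp (lam * (condAvg D (j + 1) (u + ((i + l * primorial j : ℕ) : ℝ)) -
            condAvg D z (u + ((i + l * primorial j : ℕ) : ℝ)))) ≤
          ((j + 1 : ℕ) : ℝ) * Real.exp ((lam * incBound D (j + 1)) ^ 2 / 2) *
            Real.exp (lam * (condAvg D j (u + i) - condAvg D z (u + i))) := by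
        intro i _
        have e : ∀ l ∈ Finset.range (j + 1),
            Real.exp (lam * (condAvg D (j + 1) (u + ((i + l * primorial j : ℕ) : ℝ)) -
              condAvg D z (u + ((i + l * primorial j : ℕ) : ℝ)))) =
            Real.exp (lam * (condAvg D (j + 1) (u + i + l * primorial j) - condAvg D j (u + i))) *
            Real.exp (lam * (condAvg D j (u + i) - condAvg D z (u + i))) := by
          intro l _
          rw [← Real.exp_add]
          push_cast
          rw [← add_assoc, condAvg_add (primorial_dvd_primorial hj)]
          congr 1; ring
        rw [Finset.sum_congr rfl e, ← Finset.sum_mul]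
        refine mul_le_mul_of_nonneg_right ?_ (Real.exp_pos _).le
        have hb := sum_exp_le_of_sum_eq_zero (s := Finset.range (j + 1))
          (x := fun l : ℕ => lam * (condAvg D (j + 1) (u + i + l * primorial j) - condAvg D j (u + i)))
          (b := |lam| * incBound D (j + 1)) (by
            rw [← Finset.mul_sum, Finset.sum_sub_distrib, sum_condAvg_succ h]; simp)
          (fun l _ => by
            rw [abs_mul]
            exact mul_le_mul_of_nonneg_left (abs_condAvg_sub_le (u + i) l) (abs_nonneg _))
        rw [Finset.card_range, mul_pow, sq_abs, ← mul_pow] at hb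
        exact hb
      refine (Finset.sum_le_sum key).trans ?_
      rw [← Finset.mul_sum]
      refine (mul_le_mul_of_nonneg_left ih (by positivity)).trans (le_of_eq ?_)
      rw [mul_add (lam ^ 2 / 2), Real.exp_add]
      push_cast
      rw [show (lam * incBound D (j + 1)) ^ 2 / 2 = lam ^ 2 / 2 * incBound D (j + 1) ^ 2 by ring]
      ring
    · rw [if_neg h, primorial_succ_not_prime h]
      simp only [condAvg_succ_of_not_prime h]
      exact ih

lemma sum_range_mul_of_periodic {h : ℕ → ℝ} {L : ℕ} (hper : ∀ i l, h (i + l * L) = h i) (q : ℕ) :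
    ∑ i ∈ Finset.range (q * L), h i = q * ∑ i ∈ Finset.range L, h i := by
  rw [sum_range_mul_eq, Finset.mul_sum]
  refine Finset.sum_congr rfl fun i _ => ?_
  simp [hper]

lemma mean_eq_of_periodic {h : ℕ → ℝ} {L Q : ℕ} (hper : ∀ i l, h (i + l * L) = h i) (hLQ : L ∣ Q)
    (hQ : 0 < Q) :
    (∑ i ∈ Finset.range Q, h i) / Q = (∑ i ∈ Finset.range L, h i) / L := by
  obtain ⟨q, rfl⟩ := hLQ
  have hL : (L:ℝ) ≠ 0 := by have := Nat.pos_of_mul_pos_right hQ; positivity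
  have hq : (q:ℝ) ≠ 0 := by have := Nat.pos_of_mul_pos_left hQ; positivity
  rw [mul_comm L q, sum_range_mul_of_periodic hper]
  push_cast; field_simp

lemma abs_sum_sub_mean_le {h : ℕ → ℝ} {L Q : ℕ} {A : ℝ} (hper : ∀ i l, h (i + l * L) = h i)
    (hLQ : L ∣ Q) (hQ : 0 < Q) (hA : ∀ i, |h i| ≤ A) (Y : ℕ) :
    |∑ i ∈ Finset.range Y, h i - Y * ((∑ i ∈ Finset.range Q, h i) / Q)| ≤ 2 * L * A := by
  have hL0 : 0 < L := Nat.pos_of_dvd_of_pos hLQ hQ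
  have hL : (0:ℝ) < L := by exact_mod_cast hL0
  rw [mean_eq_of_periodic hper hLQ hQ]
  have hA0 : 0 ≤ A := (abs_nonneg _).trans (hA 0)
  have hsum : ∀ n : ℕ, |∑ i ∈ Finset.range n, h i| ≤ n * A := fun n => by
    refine (Finset.abs_sum_le_sum_abs _ _).trans ?_
    refine (Finset.sum_le_sum fun i _ => hA i).trans ?_
    simp
  set q := Y / L
  set r := Y % L
  have hY : Y = q * L + r := by rw [mul_comm]; exact (Nat.div_add_mod Y L).symm
  have hr : (r:ℝ) ≤ L := by exact_mod_cast (Nat.mod_lt Y hL0).le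
  have h1 : ∑ i ∈ Finset.range Y, h i =
      q * ∑ i ∈ Finset.range L, h i + ∑ i ∈ Finset.range r, h i := by
    conv_lhs => rw [hY, Finset.sum_range_add, sum_range_mul_of_periodic hper]
    congr 1
    exact Finset.sum_congr rfl fun i _ => by rw [add_comm, hper]
  have hYr : (Y:ℝ) = q * L + r := by exact_mod_cast hY
  rw [h1, hYr, show (q:ℝ) * ∑ i ∈ Finset.range L, h i + ∑ i ∈ Finset.range r, h i -
    (q * L + r) * ((∑ i ∈ Finset.range L, h i) / L) =
    ∑ i ∈ Finset.range r, h i - r * ((∑ i ∈ Finset.range L, h i) / L) by field_simp; ring]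
  refine (abs_sub _ _).trans ?_
  have h2 : |(r:ℝ) * ((∑ i ∈ Finset.range L, h i) / L)| ≤ r * A := by
    rw [abs_mul, abs_of_nonneg (Nat.cast_nonneg r), abs_div, abs_of_pos hL]
    refine mul_le_mul_of_nonneg_left ?_ (Nat.cast_nonneg r)
    rw [div_le_iff₀ hL, mul_comm A]; exact hsum L
  have h3 := hsum r
  nlinarith

lemma sum_pow_transfer {I : Finset ℕ} {D N n : ℕ} {F : ℕ → ℕ → ℝ} {a : ℕ → ℝ} (hn : n ≠ 0)
    (hN : 0 < N) (hI : ∀ d ∈ I, d ∣ N ∧ d ≤ D)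
    (hper : ∀ d ∈ I, ∀ i l, F d (i + l * d) = F d i)
    (ha : ∀ d ∈ I, ∀ i, |F d i| ≤ a d) (Y : ℕ) :
    ∑ i ∈ Finset.range Y, (∑ d ∈ I, F d i) ^ n ≤
      Y * ((∑ i ∈ Finset.range N, (∑ d ∈ I, F d i) ^ n) / N) +
        2 * (D:ℝ) ^ n * (∑ d ∈ I, a d) ^ n := by
  have hperN : ∀ i l, (∑ d ∈ I, F d (i + l * N)) ^ n = (∑ d ∈ I, F d i) ^ n := by
    intro i l
    congr 1
    refine Finset.sum_congr rfl fun d hd => ?_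
    obtain ⟨m, hm⟩ := (hI d hd).1
    rw [hm, show i + l * (d * m) = i + (l * m) * d by ring, hper d hd]
  rw [← mean_eq_of_periodic hperN (dvd_pow_self N hn) (pow_pos hN n)]
  simp_rw [Finset.sum_pow']
  rw [Finset.sum_comm, Finset.sum_comm (s := Finset.range (N ^ n)), Finset.sum_div, Finset.mul_sum,
    Finset.mul_sum, ← sub_le_iff_le_add', ← Finset.sum_sub_distrib]
  refine Finset.sum_le_sum fun t ht => ?_
  rw [Fintype.mem_piFinset] at ht
  have hle : ((∏ r, t r : ℕ) : ℝ) ≤ (D:ℝ) ^ n := by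
    have : ∏ r, t r ≤ ∏ _r : Fin n, D := Finset.prod_le_prod' fun r _ => (hI _ (ht r)).2
    rw [Finset.prod_const, Finset.card_univ, Fintype.card_fin] at this
    exact_mod_cast this
  have hdvd : ∏ r, t r ∣ N ^ n := by
    have : ∏ r, t r ∣ ∏ _r : Fin n, N := Finset.prod_dvd_prod_of_dvd _ _ fun r _ => (hI _ (ht r)).1
    rwa [Finset.prod_const, Finset.card_univ, Fintype.card_fin] at this
  have ha0 : ∀ r, 0 ≤ a (t r) := fun r => (abs_nonneg _).trans (ha _ (ht r) 0)
  have key := abs_sum_sub_mean_le (h := fun i => ∏ r, F (t r) i) (L := ∏ r, t r) (Q := N ^ n)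
    (A := ∏ r, a (t r)) (fun i l => by
      refine Finset.prod_congr rfl fun r _ => ?_
      obtain ⟨m, hm⟩ := Finset.dvd_prod_of_mem t (Finset.mem_univ r)
      rw [hm, show i + l * (t r * m) = i + (l * m) * t r by ring, hper _ (ht r)])
    hdvd (pow_pos hN n) (fun i => by
      rw [Finset.abs_prod]
      exact Finset.prod_le_prod (fun r _ => abs_nonneg _) fun r _ => ha _ (ht r) i) Y
  refine (le_abs_self _).trans (key.trans ?_)
  exact mul_le_mul_of_nonneg_right (by linarith) (Finset.prod_nonneg fun r _ => ha0 r)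

lemma pow_two_mul_le_exp (x : ℝ) (k : ℕ) :
    x ^ (2 * k) ≤ ((2 * k).factorial : ℝ) * (Real.exp x + Real.exp (-x)) := by
  have h1 := Real.pow_div_factorial_le_exp |x| (abs_nonneg x) (2 * k)
  rw [div_le_iff₀ (by positivity), Even.pow_abs (even_two_mul k)] at h1
  have h2 : Real.exp |x| ≤ Real.exp x + Real.exp (-x) := by
    rcases abs_cases x with h | h <;> rw [h.1] <;> linarith [Real.exp_pos x, Real.exp_pos (-x)]
  exact h1.trans ((mul_le_mul_of_nonneg_right h2 (by positivity)).trans (le_of_eq (mul_comm _ _)))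

lemma sum_condAvg_pow_le {D z k : ℕ} (hz : z ≤ D) (hk : 1 ≤ k) {V : ℝ} (hV : 0 < V)
    (hVb : ∑ p ∈ (Finset.Ioc z D).filter Nat.Prime, incBound D p ^ 2 ≤ V) (u : ℝ) :
    ∑ i ∈ Finset.range (primorial D), (condAvg D D (u + i) - condAvg D z (u + i)) ^ (2 * k) ≤
      primorial D * (2 * (2 * Real.exp 1 * k * V) ^ k) := by
  have hk0 : (0:ℝ) < k := by exact_mod_cast hk
  set lam := Real.sqrt (2 * k / V) with hlam
  have hl0 : 0 < lam := Real.sqrt_pos.2 (by positivity)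
  have hl2 : lam ^ 2 = 2 * k / V := Real.sq_sqrt (by positivity)
  have h1 : ∀ s : ℝ, s ^ 2 = lam ^ 2 → ∑ i ∈ Finset.range (primorial D),
      Real.exp (s * (condAvg D D (u + i) - condAvg D z (u + i))) ≤ primorial D * Real.exp k := by
    intro s hs
    refine (sum_exp_condAvg_le s u hz).trans ?_
    gcongr
    calc _ ≤ s ^ 2 / 2 * V := by gcongr
      _ = k := by rw [hs, hl2]; field_simp
  have h2 : ∀ i ∈ Finset.range (primorial D),
      (condAvg D D (u + i) - condAvg D z (u + i)) ^ (2 * k) ≤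
      ((2 * k).factorial : ℝ) / lam ^ (2 * k) *
        (Real.exp (lam * (condAvg D D (u + i) - condAvg D z (u + i))) +
        Real.exp (-lam * (condAvg D D (u + i) - condAvg D z (u + i)))) := by
    intro i _
    have := pow_two_mul_le_exp (lam * (condAvg D D (u + i) - condAvg D z (u + i))) k
    rw [mul_pow] at this
    rw [div_mul_eq_mul_div, le_div_iff₀ (by positivity), mul_comm, neg_mul]
    exact this
  refine (Finset.sum_le_sum h2).trans ?_
  rw [← Finset.mul_sum, Finset.sum_add_distrib]
  have h3 := h1 lam rfl
  have h4 := h1 (-lam) (by ring)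
  have hf : ((2 * k).factorial : ℝ) ≤ ((2 * k : ℕ):ℝ) ^ (2 * k) := by
    exact_mod_cast Nat.factorial_le_pow (2 * k)
  calc _ ≤ ((2 * k : ℕ):ℝ) ^ (2 * k) / lam ^ (2 * k) *
        (primorial D * Real.exp k + primorial D * Real.exp k) := by gcongr
    _ = _ := by
      rw [pow_mul lam, hl2, pow_mul, ← div_pow]
      rw [show Real.exp (k:ℝ) = Real.exp 1 ^ k by rw [← Real.exp_nat_mul, mul_one]]
      push_cast
      rw [show ((2 * (k:ℝ)) ^ 2 / (2 * k / V)) = 2 * k * V by field_simp]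
      rw [show 2 * Real.exp 1 * k * V = 2 * k * V * Real.exp 1 by ring, mul_pow _ (Real.exp 1)]
      ring

lemma avgCoeff_top {D d : ℕ} (hd : d ∈ Finset.Ioc 0 D) :
    avgCoeff D d = (ArithmeticFunction.moebius d : ℝ) / d := by
  have hd' := Finset.mem_Ioc.1 hd
  unfold avgCoeff
  by_cases h : Squarefree d
  · have : ∏ q ∈ d.primeFactors, primeWeight D q = ∏ q ∈ d.primeFactors, (1 / (q:ℝ)) := by
      refine Finset.prod_congr rfl fun q hq => if_pos ?_
      exact (Nat.le_of_dvd hd'.1 (Nat.dvd_of_mem_primeFactors hq)).trans hd'.2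
    rw [this, Finset.prod_div_distrib, Finset.prod_const_one]
    have e : (∏ q ∈ d.primeFactors, (q:ℝ)) = d := by
      rw [← Nat.cast_prod, Nat.prod_primeFactors_of_squarefree h]
    rw [e]; ring
  · rw [ArithmeticFunction.moebius_eq_zero_of_not_squarefree h]; simp

lemma smoothPart_dvd {j d : ℕ} : smoothPart j d ∣ d :=
  (Finset.prod_dvd_prod_of_subset _ _ _ (Finset.filter_subset _ _)).trans (Nat.prod_primeFactors_dvd d)

lemma condAvg_top (D : ℕ) (u : ℝ) : condAvg D D u =
    ∑ d ∈ Finset.Ioc 0 D, (ArithmeticFunction.moebius d : ℝ) / d * psi (u / d) := by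
  refine Finset.sum_congr rfl fun d hd => ?_
  rw [avgCoeff_top hd]
  have hd' := Finset.mem_Ioc.1 hd
  by_cases h : Squarefree d
  · have : smoothPart D d = d := by
      unfold smoothPart
      rw [Finset.filter_true_of_mem, Nat.prod_primeFactors_of_squarefree h]
      exact fun q hq => (Nat.le_of_dvd hd'.1 (Nat.dvd_of_mem_primeFactors hq)).trans hd'.2
    rw [this]
  · rw [ArithmeticFunction.moebius_eq_zero_of_not_squarefree h]; simp

lemma primeWeight_anti {j J q : ℕ} (h : j ≤ J) : primeWeight j q ≤ primeWeight J q := by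
  unfold primeWeight
  split_ifs with h1 h2 h2
  · exact le_rfl
  · omega
  · rcases Nat.eq_zero_or_pos q with rfl | hq
    · simp
    · have : (1:ℝ) ≤ q := by exact_mod_cast hq
      exact one_div_le_one_div_of_le (by positivity) (by nlinarith)
  · exact le_rfl

lemma abs_avgCoeff_le {z D d : ℕ} (hz : z ≤ D) : |avgCoeff z d| ≤ |avgCoeff D d| := by
  rw [abs_avgCoeff, abs_avgCoeff]
  exact mul_le_mul_of_nonneg_left (Finset.prod_le_prod (fun q _ => primeWeight_nonneg _ _)
    fun q _ => primeWeight_anti hz) (abs_nonneg _)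

lemma card_condAvg_sub_ge_le {D z k : ℕ} (hz : z ≤ D) (hk : 1 ≤ k) {V : ℝ} (hV : 0 < V)
    (hVb : ∑ p ∈ (Finset.Ioc z D).filter Nat.Prime, incBound D p ^ 2 ≤ V) (u : ℝ) (Y : ℕ) :
    (((Finset.range Y).filter fun i : ℕ =>
        1 / 4 ≤ |condAvg D D (u + i) - condAvg D z (u + i)|).card : ℝ) ≤
      Y * (2 * (32 * Real.exp 1 * k * V) ^ k) + 2 * (4 * (D * (1 + Real.log D))) ^ (2 * k) := by
  set T : ℕ → ℝ := fun i => condAvg D D (u + i) - condAvg D z (u + i) with hT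
  have h1 : (((Finset.range Y).filter fun i : ℕ => 1 / 4 ≤ |T i|).card : ℝ) ≤
      16 ^ k * ∑ i ∈ Finset.range Y, T i ^ (2 * k) := by
    rw [Finset.card_filter, Finset.mul_sum]
    push_cast
    refine Finset.sum_le_sum fun i _ => ?_
    rw [show (16:ℝ) ^ k = 4 ^ (2 * k) by rw [pow_mul]; norm_num, ← mul_pow,
      ← Even.pow_abs (even_two_mul k), abs_mul, abs_of_pos (show (0:ℝ) < 4 by norm_num)]
    split_ifs with h
    · exact one_le_pow₀ (by linarith)
    · positivity
  refine h1.trans ?_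
  rw [show Y * (2 * (32 * Real.exp 1 * k * V) ^ k) + 2 * (4 * (D * (1 + Real.log D))) ^ (2 * k) =
    16 ^ k * (Y * (2 * (2 * Real.exp 1 * k * V) ^ k) +
      2 * (D:ℝ) ^ (2 * k) * (1 + Real.log D) ^ (2 * k)) by
    rw [show 32 * Real.exp 1 * k * V = 16 * (2 * Real.exp 1 * k * V) by ring, mul_pow (16:ℝ),
      mul_pow (4:ℝ), mul_pow (D:ℝ), show (4:ℝ) ^ (2 * k) = 16 ^ k by rw [pow_mul]; norm_num]
    ring]
  refine mul_le_mul_of_nonneg_left ?_ (by positivity)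
  set F : ℕ → ℕ → ℝ := fun d i => avgCoeff D d * psi ((u + i) / smoothPart D d) -
    avgCoeff z d * psi ((u + i) / smoothPart z d) with hF
  set I := (Finset.Ioc 0 D).filter Squarefree with hI
  have hTF : ∀ i, T i = ∑ d ∈ I, F d i := by
    intro i
    rw [hT, hI, Finset.sum_filter]
    simp only [condAvg]
    rw [← Finset.sum_sub_distrib]
    refine Finset.sum_congr rfl fun d _ => ?_
    split_ifs with h
    · rfl
    · simp only [avgCoeff]
      rw [ArithmeticFunction.moebius_eq_zero_of_not_squarefree h]; simp
  have hmem : ∀ d ∈ I, 0 < d ∧ d ≤ D ∧ Squarefree d := fun d hd => by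
    rw [hI, Finset.mem_filter, Finset.mem_Ioc] at hd; exact ⟨hd.1.1, hd.1.2, hd.2⟩
  have key := sum_pow_transfer (I := I) (D := D) (N := primorial D) (n := 2 * k) (F := F)
    (a := fun d => 1 / (d:ℝ)) (by omega) (primorial_pos D) (fun d hd => by
      obtain ⟨h0, hD, hs⟩ := hmem d hd
      refine ⟨?_, hD⟩
      rw [← Nat.prod_primeFactors_of_squarefree hs]
      refine Finset.prod_dvd_prod_of_subset _ _ _ fun q hq => ?_
      have := Nat.le_of_dvd h0 (Nat.dvd_of_mem_primeFactors hq)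
      exact Finset.mem_filter.2 ⟨Finset.mem_range.2 (by omega), Nat.prime_of_mem_primeFactors hq⟩)
    (fun d hd i l => by
      simp only [hF]
      push_cast
      rw [← add_assoc, psi_div_add_of_dvd smoothPart_dvd (smoothPart_ne_zero _ _),
        psi_div_add_of_dvd smoothPart_dvd (smoothPart_ne_zero _ _)])
    (fun d hd i => by
      obtain ⟨h0, hD, hs⟩ := hmem d hd
      have hc : |avgCoeff D d| ≤ 1 / (d:ℝ) := by
        rw [avgCoeff_top (Finset.mem_Ioc.2 ⟨h0, hD⟩)]; exact abs_moebius_div_le d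
      have hc' := (abs_avgCoeff_le (d := d) hz).trans hc
      simp only [hF]
      refine (abs_sub _ _).trans ?_
      rw [abs_mul, abs_mul]
      have h3 := abs_psi_le ((u + i) / smoothPart D d)
      have h4 := abs_psi_le ((u + i) / smoothPart z d)
      have h5 := mul_le_mul hc h3 (abs_nonneg _) (by positivity)
      have h6 := mul_le_mul hc' h4 (abs_nonneg _) (by positivity)
      linarith) Y
  simp only [← hTF] at key
  refine key.trans ?_
  have hp : (0:ℝ) < primorial D := by exact_mod_cast primorial_pos D
  have h7 := sum_condAvg_pow_le hz hk hV hVb u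
  have h8 : ∑ d ∈ I, 1 / (d:ℝ) ≤ 1 + Real.log D := by
    have := harmonic_le_one_add_log D
    rw [harmonic_eq_sum_Icc] at this
    push_cast at this
    refine le_trans ?_ this
    simp only [one_div]
    refine Finset.sum_le_sum_of_subset_of_nonneg (fun d hd => ?_) fun d _ _ => by positivity
    obtain ⟨h0, hD, _⟩ := hmem d hd
    exact Finset.mem_Icc.2 ⟨h0, hD⟩
  have h9 : 0 ≤ ∑ d ∈ I, 1 / (d:ℝ) := Finset.sum_nonneg fun d _ => by positivity
  gcongr
  rw [div_le_iff₀ hp]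
  exact h7.trans (le_of_eq (mul_comm _ _))

lemma volume_inter_Ico_le {S : Set ℝ} (hS : MeasurableSet S) {Y : ℕ} {B : ℝ}
    (h : ∀ u : ℝ, (((Finset.range Y).filter fun i : ℕ => u + i ∈ S).card : ℝ) ≤ B) :
    volume (S ∩ Set.Ico 0 (Y:ℝ)) ≤ ENNReal.ofReal B := by
  have hsub : S ∩ Set.Ico 0 (Y:ℝ) ⊆ ⋃ i ∈ Finset.range Y, (S ∩ Set.Ico (i:ℝ) (i + 1)) := by
    rintro u ⟨hu, hu0, huY⟩
    simp only [Set.mem_iUnion]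
    refine ⟨⌊u⌋₊, Finset.mem_range.2 ((Nat.floor_lt hu0).2 huY), hu, Nat.floor_le hu0,
      Nat.lt_floor_add_one u⟩
  refine (measure_mono hsub).trans ((measure_biUnion_finset_le _ _).trans ?_)
  have h1 : ∀ i ∈ Finset.range Y, volume (S ∩ Set.Ico (i:ℝ) (i + 1)) =
      ∫⁻ u in Set.Ico (0:ℝ) 1, Set.indicator ((fun u : ℝ => u + i) ⁻¹' S) 1 u := by
    intro i _
    rw [lintegral_indicator_one (hS.preimage (by fun_prop)),
      Measure.restrict_apply (hS.preimage (by fun_prop)),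
      ← measure_preimage_add_right volume (i:ℝ) (S ∩ Set.Ico (i:ℝ) (i + 1))]
    congr 1
    ext u
    simp only [Set.mem_preimage, Set.mem_inter_iff, Set.mem_Ico]
    constructor
    · rintro ⟨a, b, c⟩; exact ⟨a, by linarith, by linarith⟩
    · rintro ⟨a, b, c⟩; exact ⟨a, by linarith, by linarith⟩
  rw [Finset.sum_congr rfl h1, ← lintegral_finsetSum _ fun i _ =>
    measurable_one.indicator (hS.preimage (by fun_prop))]
  calc _ ≤ ∫⁻ _u in Set.Ico (0:ℝ) 1, ENNReal.ofReal B := by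
        refine lintegral_mono fun u => ?_
        have e : ∑ i ∈ Finset.range Y, Set.indicator ((fun u : ℝ => u + i) ⁻¹' S) (1 : ℝ → ENNReal) u =
            (((Finset.range Y).filter fun i : ℕ => u + i ∈ S).card : ENNReal) := by
          rw [Finset.card_filter]
          push_cast
          refine Finset.sum_congr rfl fun i _ => ?_
          simp [Set.indicator_apply]
        rw [e, ← ENNReal.ofReal_natCast]
        exact ENNReal.ofReal_le_ofReal (h u)
    _ = ENNReal.ofReal B := by simp

lemma measurable_psi : Measurable psi := by
  unfold psi
  exact measurable_fract.sub_const _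

lemma measurable_condAvg (D j : ℕ) : Measurable (condAvg D j) := by
  unfold condAvg
  refine Finset.measurable_fun_sum _ fun d _ => ?_
  exact (measurable_psi.comp (measurable_id.div_const _)).const_mul _

lemma exists_condAvg_bounds : ∃ C : ℝ, 0 < C ∧ ∀ z D : ℕ, 4 ≤ z → z ≤ D →
    (∀ u, |condAvg D z u| ≤
      3 * Real.exp Real.eulerMascheroniConstant / π ^ 2 * (Real.log z + C)) ∧
    ∀ k Y : ℕ, 1 ≤ k → volume ({u : ℝ | 1 / 4 ≤ |condAvg D D u - condAvg D z u|} ∩ Set.Ico 0 (Y:ℝ)) ≤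
      ENNReal.ofReal (Y * (2 * (C * k * (Real.log z / z)) ^ k) +
        2 * (4 * (D * (1 + Real.log D))) ^ (2 * k)) := by
  obtain ⟨C, hC0, hC⟩ := exists_prod_primeWeight_le
  set A : ℝ := 6 / π ^ 2 * Real.exp Real.eulerMascheroniConstant with hA
  have hA0 : 0 < A := by positivity
  set B : ℝ := 2 * A * (1 + 2 * C) with hB
  have hB0 : 0 < B := by positivity
  refine ⟨C + 32 * Real.exp 1 * (B ^ 2 * 32), by positivity, fun z D hz hzD => ⟨fun u => ?_, ?_⟩⟩
  · have h1 := sum_moebius_primeFactors_le (primeWeight_nonneg z) D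
    have h2 := hC z D (by omega)
    have h3 : |condAvg D z u| ≤ (∑ d ∈ Finset.Ioc 0 D, |(ArithmeticFunction.moebius d : ℝ)| *
        ∏ q ∈ d.primeFactors, primeWeight z q) * (1 / 2) := by
      unfold condAvg
      rw [Finset.sum_mul]
      refine (Finset.abs_sum_le_sum_abs _ _).trans (Finset.sum_le_sum fun d _ => ?_)
      rw [abs_mul, ← abs_avgCoeff]
      exact mul_le_mul_of_nonneg_left (abs_psi_le _) (abs_nonneg _)
    have h4 : 3 * Real.exp Real.eulerMascheroniConstant / π ^ 2 = A / 2 := by rw [hA]; ring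
    rw [h4]
    have h5 : |condAvg D z u| ≤ A / 2 * (Real.log z + C) := by linarith
    refine h5.trans ?_
    gcongr
    have : 0 < 32 * Real.exp 1 * (B ^ 2 * 32) := by positivity
    linarith
  · intro k Y hk
    have hz4 : (4:ℝ) ≤ z := by exact_mod_cast hz
    have hlz : 0 < Real.log z := Real.log_pos (by linarith)
    have hinc : ∀ p ∈ (Finset.Ioc z D).filter Nat.Prime, incBound D p ^ 2 ≤
        B ^ 2 * (Real.log p / p) ^ 2 := by
      intro p hp
      rw [Finset.mem_filter, Finset.mem_Ioc] at hp
      have h1 := hC p D hp.2.two_le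
      have hp2 : (4:ℝ) ≤ p := hz4.trans (by exact_mod_cast hp.1.1.le)
      have hl : 1 / 2 ≤ Real.log p := by
        have : Real.log 4 ≤ Real.log p := Real.log_le_log (by norm_num) hp2
        have h4 : Real.log 4 = 2 * Real.log 2 := by
          rw [show (4:ℝ) = 2 ^ 2 by norm_num, Real.log_pow]; norm_num
        linarith [Real.log_two_gt_d9]
      have h2 : incBound D p ≤ B * (Real.log p / p) := by
        unfold incBound
        calc _ ≤ 2 * (1 / (p:ℝ)) * (A * (Real.log p + C)) := by gcongr
          _ ≤ 2 * (1 / (p:ℝ)) * (A * ((1 + 2 * C) * Real.log p)) := by gcongr; nlinarith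
          _ = _ := by rw [hB]; ring
      rw [← mul_pow]
      refine pow_le_pow_left₀ ?_ h2 2
      unfold incBound
      exact mul_nonneg (by positivity) (Finset.prod_nonneg fun q _ => by
        linarith [primeWeight_nonneg p q])
    have hV : ∑ p ∈ (Finset.Ioc z D).filter Nat.Prime, incBound D p ^ 2 ≤
        B ^ 2 * 32 * (Real.log z / z) := by
      refine (Finset.sum_le_sum hinc).trans ?_
      rw [← Finset.mul_sum, mul_assoc]
      gcongr
      rw [← mul_div_assoc]
      exact sum_primes_log_sq_le hz
    have hmeas : MeasurableSet {u : ℝ | 1 / 4 ≤ |condAvg D D u - condAvg D z u|} :=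
      measurableSet_le measurable_const
        (((measurable_condAvg D D).sub (measurable_condAvg D z)).abs)
    refine (volume_inter_Ico_le hmeas (B := Y * (2 * (32 * Real.exp 1 * k *
      (B ^ 2 * 32 * (Real.log z / z))) ^ k) + 2 * (4 * (D * (1 + Real.log D))) ^ (2 * k))
      fun u => ?_).trans (ENNReal.ofReal_le_ofReal ?_)
    · exact card_condAvg_sub_ge_le hzD hk (by positivity) hV u Y
    · have h2 : 32 * Real.exp 1 * k * (B ^ 2 * 32 * (Real.log z / z)) ≤
          (C + 32 * Real.exp 1 * (B ^ 2 * 32)) * k * (Real.log z / z) := by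
        rw [show 32 * Real.exp 1 * k * (B ^ 2 * 32 * (Real.log z / z)) =
          (32 * Real.exp 1 * (B ^ 2 * 32)) * k * (Real.log z / z) by ring]
        gcongr
        linarith
      have h3 := pow_le_pow_left₀ (by positivity) h2 k
      have h4 := mul_le_mul_of_nonneg_left h3 (Nat.cast_nonneg (α := ℝ) Y)
      linarith

lemma sum_range_succ_eq_sum_Ioc {f : ℕ → ℝ} (h : f 0 = 0) (n : ℕ) :
    ∑ i ∈ Finset.range (n + 1), f i = ∑ i ∈ Finset.Ioc 0 n, f i := by
  rw [Finset.sum_range_succ', h, add_zero, Finset.range_eq_Ico, Finset.sum_Ico_add' f 0 n 1]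
  refine Finset.sum_congr ?_ fun _ _ => rfl
  ext i
  simp only [Finset.mem_Ico, Finset.mem_Ioc]
  omega

lemma sum_moebius_psi_tail_le : ∃ C : ℝ, 0 < C ∧ ∀ W : ℕ, 1 ≤ W → ∀ u : ℝ, (W:ℝ) ≤ u →
    |∑ d ∈ Finset.Ioc W ⌊u⌋₊, (ArithmeticFunction.moebius d : ℝ) / d * psi (u / d)| ≤
      C * (u / W) * Real.exp (-(√(Real.log W) / 10000)) := by
  obtain ⟨C, hC0, hC⟩ := moebiusSum_bound
  refine ⟨8 * C, by positivity, fun W hW u hu => ?_⟩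
  set e := Real.exp (-(√(Real.log W) / 10000)) with he
  have hW1 : (1:ℝ) ≤ W := by exact_mod_cast hW
  have hu0 : 0 ≤ u := by linarith
  have hWn : W ≤ ⌊u⌋₊ := Nat.le_floor hu
  have hA : ∀ j : ℕ, W ≤ j → |moebiusSum j| ≤ C * e := by
    intro j hj
    have hj1 : (W:ℝ) ≤ j := by exact_mod_cast hj
    refine (hC j (by linarith)).trans ?_
    rw [he]
    gcongr
  have hD : ∀ j, W ≤ j → j ≤ ⌊u⌋₊ →
      |∑ d ∈ Finset.Ioc W j, (ArithmeticFunction.moebius d : ℝ) / d| ≤ 2 * (C * e) := by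
    intro j hj _
    have h1 : ∑ d ∈ Finset.Ioc W j, (ArithmeticFunction.moebius d : ℝ) / d =
        moebiusSum j - moebiusSum W := by
      unfold moebiusSum
      rw [Nat.floor_natCast, Nat.floor_natCast, eq_sub_iff_add_eq, add_comm,
        ← Finset.sum_range_add_sum_Ico _ (show W + 1 ≤ j + 1 by omega)]
      congr 1
      refine Finset.sum_congr ?_ fun _ _ => rfl
      ext i
      simp only [Finset.mem_Ico, Finset.mem_Ioc]
      omega
    rw [h1]
    have := abs_sub (moebiusSum j) (moebiusSum W)
    linarith [hA j hj, hA W le_rfl]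
  rcases hWn.eq_or_lt with h | hlt
  · rw [← h]
    simp only [Finset.Ioc_self, Finset.sum_empty, abs_zero]
    positivity
  have hn0 : 0 ≤ 2 * (C * e) := by positivity
  have hsplit : ∑ d ∈ Finset.Ioc W ⌊u⌋₊, (ArithmeticFunction.moebius d : ℝ) / d * psi (u / d) =
      u * ∑ d ∈ Finset.Ioc W ⌊u⌋₊, (ArithmeticFunction.moebius d : ℝ) / d * (1 / (d:ℝ)) -
      ∑ d ∈ Finset.Ioc W ⌊u⌋₊, (ArithmeticFunction.moebius d : ℝ) / d * (⌊u / d⌋₊ : ℝ) -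
      1 / 2 * ∑ d ∈ Finset.Ioc W ⌊u⌋₊, (ArithmeticFunction.moebius d : ℝ) / d := by
    rw [Finset.mul_sum, Finset.mul_sum, ← Finset.sum_sub_distrib, ← Finset.sum_sub_distrib]
    refine Finset.sum_congr rfl fun d _ => ?_
    have h0 : 0 ≤ u / (d:ℝ) := by positivity
    have : (⌊u / (d:ℝ)⌋₊ : ℝ) = u / d - Int.fract (u / d) := by
      rw [natCast_floor_eq_intCast_floor h0, Int.fract]; ring
    rw [this]
    unfold psi
    ring
  have b1 := abs_sum_mul_le_of_antitone (g := fun d : ℕ => 1 / (d:ℝ)) hlt hD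
    (fun i hi _ => one_div_le_one_div_of_le (by exact_mod_cast (show 0 < i by omega))
      (by push_cast; linarith)) (by positivity)
  have b2 := abs_sum_mul_le_of_antitone (g := fun d : ℕ => (⌊u / (d:ℝ)⌋₊ : ℝ)) hlt hD
    (fun i hi _ => by
      have : (0:ℝ) < i := by exact_mod_cast (show 0 < i by omega)
      have : u / ((i + 1 : ℕ) : ℝ) ≤ u / i := by
        apply div_le_div_of_nonneg_left hu0 this; push_cast; linarith
      exact_mod_cast Nat.floor_le_floor this) (by positivity)
  have b3 := hD ⌊u⌋₊ hlt.le le_rfl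
  have hW2 : (1:ℝ) / ((W + 1 : ℕ) : ℝ) ≤ 1 / W :=
    one_div_le_one_div_of_le (by linarith) (by push_cast; linarith)
  have hfl : (⌊u / ((W + 1 : ℕ) : ℝ)⌋₊ : ℝ) ≤ u / W := by
    refine (Nat.floor_le (by positivity)).trans ?_
    have := mul_le_mul_of_nonneg_left hW2 hu0
    simpa [div_eq_mul_inv] using this
  have huW : 1 ≤ u / W := by rw [le_div_iff₀ (by linarith)]; linarith
  rw [hsplit]
  have c1 := mul_le_mul_of_nonneg_left b1 hu0
  have c2 : u * (2 * (C * e) * (1 / ((W + 1 : ℕ) : ℝ))) ≤ 2 * (C * e) * (u / W) := by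
    calc _ = 2 * (C * e) * (u * (1 / ((W + 1 : ℕ) : ℝ))) := by ring
      _ ≤ 2 * (C * e) * (u * (1 / W)) := by gcongr
      _ = _ := by ring
  have c3 := mul_le_mul_of_nonneg_left hfl hn0
  have c4 := mul_le_mul_of_nonneg_left huW hn0
  rw [show 8 * C * (u / W) * e = 4 * (2 * (C * e) * (u / W)) by ring]
  rw [← abs_of_nonneg hu0, ← abs_mul, abs_of_nonneg hu0] at c1
  rw [abs_le] at *
  constructor <;> linarith [c1.1, c1.2, b2.1, b2.2, b3.1, b3.2]

lemma sum_totient_eq (n : ℕ) : ∑ m ∈ Finset.Ioc 0 n, (Nat.totient m : ℝ) =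
    ∑ d ∈ Finset.Ioc 0 n, (ArithmeticFunction.moebius d : ℝ) *
      (((n / d : ℕ) : ℝ) * (((n / d : ℕ) : ℝ) + 1) / 2) := by
  have h1 := (ArithmeticFunction.sum_eq_iff_sum_mul_moebius_eq (R := ℝ)
    (f := fun n => (Nat.totient n : ℝ)) (g := fun n => (n:ℝ))).1
    (fun n _ => by exact_mod_cast Nat.sum_totient n)
  have h2 := ArithmeticFunction.sum_Ioc_mul_eq_sum_sum
    (ArithmeticFunction.moebius : ArithmeticFunction ℝ)
    ((ArithmeticFunction.id : ArithmeticFunction ℕ) : ArithmeticFunction ℝ) n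
  have hT : ∀ k : ℕ, ∑ m ∈ Finset.Ioc 0 k, (m:ℝ) = (k:ℝ) * ((k:ℝ) + 1) / 2 := by
    intro k
    induction k with
    | zero => simp
    | succ k ih => rw [Finset.sum_Ioc_succ_top (Nat.zero_le k), ih]; push_cast; ring
  simp only [ArithmeticFunction.mul_apply, ArithmeticFunction.natCoe_apply,
    ArithmeticFunction.intCoe_apply, ArithmeticFunction.id_apply, hT] at h2
  rw [← h2]
  exact Finset.sum_congr rfl fun m hm => (h1 m (Finset.mem_Ioc.1 hm).1).symm

lemma abs_sum_moebius_div_sq_sub_le {n : ℕ} (hn : 1 ≤ n) :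
    |∑ d ∈ Finset.Ioc 0 n, (ArithmeticFunction.moebius d : ℝ) / (d:ℝ) ^ 2 - (6 / π ^ 2 : ℝ)| ≤ (1 / n : ℝ) := by
  have hs := (ArithmeticFunction.LSeriesSummable_moebius_iff (s := 2)).2 (by norm_num)
  have hz := ArithmeticFunction.LSeries_zeta_mul_Lseries_moebius (s := 2) (by norm_num)
  rw [ArithmeticFunction.LSeries_zeta_eq_riemannZeta (by norm_num), riemannZeta_two] at hz
  have hv : LSeries (fun n => ((ArithmeticFunction.moebius n : ℤ) : ℂ)) 2 =
      ((6 / π ^ 2 : ℝ) : ℂ) := by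
    have hpi : (π : ℂ) ≠ 0 := by exact_mod_cast Real.pi_ne_zero
    push_cast
    field_simp at hz ⊢
    linear_combination hz
  have hsum := hs.LSeriesHasSum
  rw [hv] at hsum
  unfold LSeriesHasSum at hsum
  have hterm : LSeries.term (fun n => ((ArithmeticFunction.moebius n : ℤ) : ℂ)) 2 =
      fun n : ℕ => (((ArithmeticFunction.moebius n : ℝ) / (n:ℝ) ^ 2 : ℝ) : ℂ) := by
    ext d
    rcases eq_or_ne d 0 with rfl | hd
    · simp
    · rw [LSeries.term_of_ne_zero hd]
      push_cast
      norm_cast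
  rw [hterm] at hsum
  have hreal := (Complex.hasSum_ofReal).1 hsum
  have hlim := hreal.tendsto_sum_nat
  have hlim2 := (hlim.comp (Filter.tendsto_add_atTop_nat 1)).const_sub
    (∑ d ∈ Finset.Ioc 0 n, (ArithmeticFunction.moebius d : ℝ) / (d:ℝ) ^ 2)
  refine le_of_tendsto hlim2.abs ?_
  filter_upwards [Filter.eventually_ge_atTop n] with M hM
  have h1 : ∑ i ∈ Finset.range (M + 1), (ArithmeticFunction.moebius i : ℝ) / (i:ℝ) ^ 2 =
      ∑ d ∈ Finset.Ioc 0 n, (ArithmeticFunction.moebius d : ℝ) / (d:ℝ) ^ 2 +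
      ∑ d ∈ Finset.Ioc n M, (ArithmeticFunction.moebius d : ℝ) / (d:ℝ) ^ 2 := by
    rw [Finset.sum_Ioc_consecutive
      (fun d : ℕ => (ArithmeticFunction.moebius d : ℝ) / (d:ℝ) ^ 2) (Nat.zero_le n) hM, sum_range_succ_eq_sum_Ioc (by simp)]
  simp only [Function.comp]
  rw [h1, sub_add_cancel_left, abs_neg]
  refine (Finset.abs_sum_le_sum_abs _ _).trans ?_
  have h2 := sum_Ioc_inv_sq_le_sub (α := ℝ) (show n ≠ 0 by omega) hM
  have h3 : ∑ d ∈ Finset.Ioc n M, |(ArithmeticFunction.moebius d : ℝ) / (d:ℝ) ^ 2| ≤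
      ∑ d ∈ Finset.Ioc n M, ((d:ℝ) ^ 2)⁻¹ := by
    refine Finset.sum_le_sum fun d _ => ?_
    rw [abs_div, abs_of_nonneg (sq_nonneg (d:ℝ)), div_eq_mul_inv]
    have : |(ArithmeticFunction.moebius d : ℝ)| ≤ 1 := by
      exact_mod_cast ArithmeticFunction.abs_moebius_le_one
    exact mul_le_of_le_one_left (by positivity) this
  have : (0:ℝ) ≤ (M:ℝ)⁻¹ := by positivity
  rw [one_div]
  linarith

lemma abs_Rtilde_add_sum_le {u : ℝ} (hu : 10 ≤ u) (hf : Int.fract u ≠ 0) :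
    |Rtilde u + ∑ d ∈ Finset.Ioc 0 ⌊u⌋₊, (ArithmeticFunction.moebius d : ℝ) / d * psi (u / d)| ≤
      7 / 10 := by
  set n := ⌊u⌋₊ with hn
  have hu0 : 0 < u := by linarith
  have hn10 : 10 ≤ n := Nat.le_floor (by exact_mod_cast hu)
  have hn10' : (10:ℝ) ≤ n := by exact_mod_cast hn10
  have hnu : u < n + 1 := Nat.lt_floor_add_one u
  have hnu' : (n:ℝ) ≤ u := Nat.floor_le hu0.le
  have hsum : ∑ m ∈ Finset.range (n + 1), (Nat.totient m : ℝ) =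
      u ^ 2 / 2 * ∑ d ∈ Finset.Ioc 0 n, (ArithmeticFunction.moebius d : ℝ) / (d:ℝ) ^ 2 -
      u * ∑ d ∈ Finset.Ioc 0 n, (ArithmeticFunction.moebius d : ℝ) / d * psi (u / d) +
      ∑ d ∈ Finset.Ioc 0 n, (ArithmeticFunction.moebius d : ℝ) * ((psi (u / d) ^ 2 - 1 / 4) / 2) := by
    rw [sum_range_succ_eq_sum_Ioc (by simp), sum_totient_eq, Finset.mul_sum, Finset.mul_sum,
      ← Finset.sum_sub_distrib, ← Finset.sum_add_distrib]
    refine Finset.sum_congr rfl fun d hd => ?_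
    have hd0 : (d:ℝ) ≠ 0 := by
      have := (Finset.mem_Ioc.1 hd).1
      positivity
    have h0 : 0 ≤ u / (d:ℝ) := by positivity
    have : ((n / d : ℕ) : ℝ) = u / d - psi (u / d) - 1 / 2 := by
      rw [hn, ← Nat.floor_div_natCast, natCast_floor_eq_intCast_floor h0, psi, Int.fract]; ring
    rw [this]
    field_simp
    ring
  have hS := abs_sum_moebius_div_sq_sub_le (show 1 ≤ n by omega)
  have hT : |∑ d ∈ Finset.Ioc 0 n, (ArithmeticFunction.moebius d : ℝ) *
      ((psi (u / d) ^ 2 - 1 / 4) / 2)| ≤ (n / 8 : ℝ) := by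
    refine (Finset.abs_sum_le_sum_abs _ _).trans ?_
    have : ∀ d ∈ Finset.Ioc 0 n, |(ArithmeticFunction.moebius d : ℝ) *
        ((psi (u / d) ^ 2 - 1 / 4) / 2)| ≤ (1 / 8 : ℝ) := by
      intro d _
      rw [abs_mul]
      have h1 : |(ArithmeticFunction.moebius d : ℝ)| ≤ 1 := by
        exact_mod_cast ArithmeticFunction.abs_moebius_le_one
      have h2 : |(psi (u / d) ^ 2 - 1 / 4) / 2| ≤ (1 / 8 : ℝ) := by
        have := abs_le.1 (abs_psi_le (u / d))
        rw [abs_le]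
        constructor <;> nlinarith [sq_nonneg (psi (u / d))]
      calc _ ≤ 1 * (1 / 8 : ℝ) := by gcongr
        _ = _ := one_mul _
    refine (Finset.sum_le_sum this).trans ?_
    rw [Finset.sum_const, Nat.card_Ioc, nsmul_eq_mul]
    simp only [Nat.sub_zero]
    linarith
  unfold Rtilde Rerr
  rw [if_neg hf, zero_div, sub_zero, ← hn, hsum]
  set S := ∑ d ∈ Finset.Ioc 0 n, (ArithmeticFunction.moebius d : ℝ) / (d:ℝ) ^ 2
  set T := ∑ d ∈ Finset.Ioc 0 n, (ArithmeticFunction.moebius d : ℝ) *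
      ((psi (u / d) ^ 2 - 1 / 4) / 2)
  set G := ∑ d ∈ Finset.Ioc 0 n, (ArithmeticFunction.moebius d : ℝ) / d * psi (u / d)
  have e : (u ^ 2 / 2 * S - u * G + T - 3 / π ^ 2 * u ^ 2) / u + G =
      u / 2 * (S - 6 / π ^ 2) + T / u := by field_simp; ring
  rw [e]
  have b1 : |u / 2 * (S - 6 / π ^ 2)| ≤ 11 / 20 := by
    rw [abs_mul, abs_of_pos (by positivity)]
    calc _ ≤ u / 2 * (1 / n : ℝ) := by gcongr
      _ ≤ _ := by
        rw [mul_one_div, div_le_iff₀ (by linarith)]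
        linarith
  have b2 : |T / u| ≤ 1 / 8 := by
    rw [abs_div, abs_of_pos hu0, div_le_iff₀ hu0]
    linarith
  have := abs_add_le (u / 2 * (S - 6 / π ^ 2)) (T / u)
  linarith

lemma integral_sin_mul_sin {α β : ℝ} (h : α - β ≠ 0) (h' : α + β ≠ 0) (Y : ℝ) :
    ∫ u in (0:ℝ)..Y, Real.sin (α * u) * Real.sin (β * u) =
      Real.sin ((α - β) * Y) / (2 * (α - β)) - Real.sin ((α + β) * Y) / (2 * (α + β)) := by
  have hd : ∀ u ∈ Set.uIcc 0 Y, HasDerivAt (fun u => Real.sin ((α - β) * u) / (2 * (α - β)) -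
      Real.sin ((α + β) * u) / (2 * (α + β))) (Real.sin (α * u) * Real.sin (β * u)) u := by
    intro u _
    have h1 := (((hasDerivAt_id u).const_mul (α - β)).sin.div_const (2 * (α - β))).sub
      (((hasDerivAt_id u).const_mul (α + β)).sin.div_const (2 * (α + β)))
    refine h1.congr_deriv ?_
    simp only [id, mul_one]
    rw [sub_mul, add_mul, Real.cos_sub, Real.cos_add]
    field_simp
    ring
  rw [intervalIntegral.integral_eq_sub_of_hasDerivAt hd
    (Continuous.intervalIntegrable (by fun_prop) _ _)]
  simp

lemma abs_integral_sin_mul_sin_le {α β : ℝ} (hα : 0 < α) (hβ : 0 < β) (h : α ≠ β) (Y : ℝ) :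
    |∫ u in (0:ℝ)..Y, Real.sin (α * u) * Real.sin (β * u)| ≤ 1 / |α - β| := by
  have h0 : α - β ≠ 0 := sub_ne_zero.2 h
  rw [integral_sin_mul_sin h0 (by positivity)]
  refine (abs_sub _ _).trans ?_
  rw [abs_div, abs_div, abs_mul, abs_mul, abs_two]
  have hp : 0 < |α - β| := abs_pos.2 h0
  have h1 : |α - β| ≤ |α + β| := by
    rw [abs_of_pos (show 0 < α + β by positivity), abs_le]; constructor <;> linarith
  have h2 : |Real.sin ((α - β) * Y)| / (2 * |α - β|) ≤ 1 / (2 * |α - β|) := by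
    gcongr; exact Real.abs_sin_le_one _
  have h3 : |Real.sin ((α + β) * Y)| / (2 * |α + β|) ≤ 1 / (2 * |α - β|) := by
    gcongr; exact Real.abs_sin_le_one _
  have : 1 / |α - β| = 1 / (2 * |α - β|) + 1 / (2 * |α - β|) := by field_simp; norm_num
  linarith

lemma integral_sin_two_pi_mul_sin {h k : ℕ} (hh : h ≠ 0) (hk : k ≠ 0) :
    ∫ u in (0:ℝ)..1, Real.sin (2 * π * h * u) * Real.sin (2 * π * k * u) =
      if h = k then 1 / 2 else 0 := by
  have hh0 : (0:ℝ) < h := by positivity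
  have hk0 : (0:ℝ) < k := by positivity
  have hpi := Real.pi_pos
  split_ifs with e
  · subst e
    have hd : ∀ u ∈ Set.uIcc (0:ℝ) 1, HasDerivAt (fun u => u / 2 -
        Real.sin (2 * π * h * u) * Real.cos (2 * π * h * u) / (2 * (2 * π * h)))
        (Real.sin (2 * π * h * u) * Real.sin (2 * π * h * u)) u := by
      intro u _
      have h1 := ((hasDerivAt_id u).div_const 2).sub
        (((((hasDerivAt_id u).const_mul (2 * π * h)).sin.mul
          ((hasDerivAt_id u).const_mul (2 * π * h)).cos)).div_const (2 * (2 * π * h)))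
      refine h1.congr_deriv ?_
      simp only [id, mul_one]
      have := Real.sin_sq_add_cos_sq (2 * π * h * u)
      field_simp
      linear_combination -this
    rw [intervalIntegral.integral_eq_sub_of_hasDerivAt hd
      (Continuous.intervalIntegrable (by fun_prop) _ _)]
    have : Real.sin (2 * π * h * 1) = 0 := by
      rw [show 2 * π * h * 1 = ((2 * h : ℕ) : ℝ) * π by push_cast; ring]
      exact Real.sin_nat_mul_pi _
    rw [this]
    simp
  · have hne : (h:ℝ) - k ≠ 0 := sub_ne_zero.2 (by exact_mod_cast e)
    rw [integral_sin_mul_sin (by rw [← mul_sub]; positivity) (by positivity)]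
    have h1 : Real.sin ((2 * π * h - 2 * π * k) * 1) = 0 := by
      rw [show (2 * π * h - 2 * π * k) * 1 = ((2 * (h - k) : ℤ) : ℝ) * π by push_cast; ring]
      exact Real.sin_int_mul_pi _
    have h2 : Real.sin ((2 * π * h + 2 * π * k) * 1) = 0 := by
      rw [show (2 * π * h + 2 * π * k) * 1 = ((2 * (h + k) : ℤ) : ℝ) * π by push_cast; ring]
      exact Real.sin_int_mul_pi _
    rw [h1, h2]
    simp

lemma integral_sub_half_mul_sin {h : ℕ} (hh : h ≠ 0) :
    ∫ u in (0:ℝ)..1, (u - 1 / 2) * Real.sin (2 * π * h * u) = -(1 / (2 * π * h)) := by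
  have hh0 : (0:ℝ) < h := by positivity
  have hpi := Real.pi_pos
  have hd : ∀ u ∈ Set.uIcc (0:ℝ) 1, HasDerivAt (fun u => -((u - 1 / 2) *
      Real.cos (2 * π * h * u) / (2 * π * h)) + Real.sin (2 * π * h * u) / (2 * π * h) ^ 2)
      ((u - 1 / 2) * Real.sin (2 * π * h * u)) u := by
    intro u _
    have h1 := ((((hasDerivAt_id u).sub_const (1 / 2)).mul
      ((hasDerivAt_id u).const_mul (2 * π * h)).cos).div_const (2 * π * h)).neg.add
      (((hasDerivAt_id u).const_mul (2 * π * h)).sin.div_const ((2 * π * h) ^ 2))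
    refine h1.congr_deriv ?_
    simp only [id, mul_one]
    field_simp
    ring
  rw [intervalIntegral.integral_eq_sub_of_hasDerivAt hd
    (Continuous.intervalIntegrable (by fun_prop) _ _)]
  have h1 : Real.sin (2 * π * h * 1) = 0 := by
    rw [show 2 * π * h * 1 = ((2 * h : ℕ) : ℝ) * π by push_cast; ring]
    exact Real.sin_nat_mul_pi _
  have h2 : Real.cos (2 * π * h * 1) = 1 := by
    rw [show 2 * π * h * 1 = (h : ℝ) * (2 * π) by ring]
    exact Real.cos_nat_mul_two_pi _
  rw [h1, h2]
  simp
  ring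

noncomputable def psiRem (H : ℕ) (v : ℝ) : ℝ :=
  psi v + ∑ h ∈ Finset.Ioc 0 H, Real.sin (2 * π * h * v) / (π * h)

lemma integral_psiRem_sq_le {H : ℕ} (hH : 1 ≤ H) :
    ∫ v in (0:ℝ)..1, psiRem H v ^ 2 ≤ 1 / H := by
  have hpi := Real.pi_pos
  have e1 : ∫ v in (0:ℝ)..1, psiRem H v ^ 2 = ∫ v in (0:ℝ)..1, ((v - 1 / 2) ^ 2 +
      ∑ h ∈ Finset.Ioc 0 H, 2 / (π * h) * ((v - 1 / 2) * Real.sin (2 * π * h * v)) +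
      ∑ h ∈ Finset.Ioc 0 H, ∑ k ∈ Finset.Ioc 0 H, 1 / (π * h) * (1 / (π * k)) *
        (Real.sin (2 * π * h * v) * Real.sin (2 * π * k * v))) := by
    refine intervalIntegral.integral_congr_Ioo_of_le zero_le_one fun v hv => ?_
    have hf : psi v = v - 1 / 2 := by
      unfold psi; rw [Int.fract_eq_self.2 ⟨hv.1.le, hv.2⟩]
    have hs : ∀ f : ℕ → ℝ, (∑ h ∈ Finset.Ioc 0 H, f h) ^ 2 =
        ∑ h ∈ Finset.Ioc 0 H, ∑ k ∈ Finset.Ioc 0 H, f h * f k := fun f => by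
      rw [sq, Finset.sum_mul_sum]
    simp only [psiRem, hf]
    rw [add_sq, hs, Finset.mul_sum]
    congr 1
    · congr 1
      exact Finset.sum_congr rfl fun h _ => by ring
    · exact Finset.sum_congr rfl fun h _ => Finset.sum_congr rfl fun k _ => by ring
  have c1 : IntervalIntegrable (fun v : ℝ => (v - 1 / 2) ^ 2) volume 0 1 :=
    Continuous.intervalIntegrable (by fun_prop) _ _
  have c2 : ∀ h : ℕ, IntervalIntegrable (fun v : ℝ =>
      2 / (π * h) * ((v - 1 / 2) * Real.sin (2 * π * h * v))) volume 0 1 := fun h =>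
    Continuous.intervalIntegrable (by fun_prop) _ _
  have c3 : ∀ h k : ℕ, IntervalIntegrable (fun v : ℝ => 1 / (π * h) * (1 / (π * k)) *
        (Real.sin (2 * π * h * v) * Real.sin (2 * π * k * v))) volume 0 1 := fun h k =>
    Continuous.intervalIntegrable (by fun_prop) _ _
  have c4 : ∀ h : ℕ, IntervalIntegrable (fun v : ℝ => ∑ k ∈ Finset.Ioc 0 H,
      1 / (π * h) * (1 / (π * k)) *
        (Real.sin (2 * π * h * v) * Real.sin (2 * π * k * v))) volume 0 1 := fun h =>
    Continuous.intervalIntegrable (by fun_prop) _ _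
  rw [e1, intervalIntegral.integral_add (Continuous.intervalIntegrable (by fun_prop) _ _)
    (Continuous.intervalIntegrable (by fun_prop) _ _), intervalIntegral.integral_add c1
    (Continuous.intervalIntegrable (by fun_prop) _ _),
    intervalIntegral.integral_finsetSum fun h _ => c2 h,
    intervalIntegral.integral_finsetSum fun h _ => c4 h]
  have d2 : ∑ h ∈ Finset.Ioc 0 H, ∫ v in (0:ℝ)..1,
      2 / (π * h) * ((v - 1 / 2) * Real.sin (2 * π * h * v)) =
      -(∑ h ∈ Finset.Ioc 0 H, 1 / (h:ℝ) ^ 2) / π ^ 2 := by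
    rw [neg_div, Finset.sum_div, ← Finset.sum_neg_distrib]
    refine Finset.sum_congr rfl fun h hh => ?_
    have h0 : h ≠ 0 := by have := (Finset.mem_Ioc.1 hh).1; omega
    rw [intervalIntegral.integral_const_mul, integral_sub_half_mul_sin h0]
    have : (h:ℝ) ≠ 0 := by exact_mod_cast h0
    field_simp
  have d3 : ∑ h ∈ Finset.Ioc 0 H, ∫ v in (0:ℝ)..1, ∑ k ∈ Finset.Ioc 0 H,
      1 / (π * h) * (1 / (π * k)) * (Real.sin (2 * π * h * v) * Real.sin (2 * π * k * v)) =
      (∑ h ∈ Finset.Ioc 0 H, 1 / (h:ℝ) ^ 2) / (2 * π ^ 2) := by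
    rw [Finset.sum_div]
    refine Finset.sum_congr rfl fun h hh => ?_
    have h0 : h ≠ 0 := by have := (Finset.mem_Ioc.1 hh).1; omega
    have h1 : (h:ℝ) ≠ 0 := by exact_mod_cast h0
    rw [intervalIntegral.integral_finsetSum fun k _ => c3 h k, Finset.sum_eq_single h]
    · rw [intervalIntegral.integral_const_mul, integral_sin_two_pi_mul_sin h0 h0, if_pos rfl]
      field_simp
    · intro k hk hkh
      rw [intervalIntegral.integral_const_mul, integral_sin_two_pi_mul_sin h0
        (by have := (Finset.mem_Ioc.1 hk).1; omega), if_neg (Ne.symm hkh), mul_zero]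
    · exact fun h => absurd hh h
  have d1 : ∫ v in (0:ℝ)..1, (v - 1 / 2) ^ 2 = 1 / 12 := by
    rw [intervalIntegral.integral_comp_sub_right (fun v => v ^ 2) (1 / 2 : ℝ), integral_pow]
    norm_num
  rw [d1, d2, d3]
  have hz : π ^ 2 / 6 ≤ ∑ h ∈ Finset.Ioc 0 H, 1 / (h:ℝ) ^ 2 + 1 / H := by
    have hlim := hasSum_zeta_two.tendsto_sum_nat.comp (Filter.tendsto_add_atTop_nat 1)
    refine le_of_tendsto hlim ?_
    filter_upwards [Filter.eventually_ge_atTop H] with M hM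
    simp only [Function.comp]
    rw [sum_range_succ_eq_sum_Ioc (by simp), ← Finset.sum_Ioc_consecutive
      (fun h : ℕ => 1 / (h:ℝ) ^ 2) (Nat.zero_le H) hM]
    have h2 := sum_Ioc_inv_sq_le_sub (α := ℝ) (show H ≠ 0 by omega) hM
    have : (0:ℝ) ≤ (M:ℝ)⁻¹ := by positivity
    simp only [one_div]
    linarith
  set S := ∑ h ∈ Finset.Ioc 0 H, 1 / (h:ℝ) ^ 2
  have hp9 : 1 ≤ π ^ 2 := by nlinarith [Real.pi_gt_three]
  have e2 : 1 / 12 + -S / π ^ 2 + S / (2 * π ^ 2) = (π ^ 2 / 6 - S) / (2 * π ^ 2) := by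
    field_simp; ring
  rw [e2, div_le_iff₀ (by positivity)]
  have : 0 ≤ (1:ℝ) / H := by positivity
  nlinarith

lemma sum_Ioc_one_div_le {n : ℕ} : ∑ i ∈ Finset.Ioc 0 n, 1 / (i:ℝ) ≤ 1 + Real.log n := by
  have h := harmonic_le_one_add_log n
  rw [harmonic_eq_sum_Icc] at h
  push_cast at h
  rw [← Finset.Icc_add_one_left_eq_Ioc]
  simpa [one_div] using h

lemma sum_range_one_div_abs_sub_le {a W : ℕ} (h : a ≤ W) :
    ∑ b ∈ Finset.range (W + 1), 1 / |(a:ℝ) - b| ≤ 2 * (1 + Real.log W) := by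
  have hle : ∀ n ≤ W, ∑ i ∈ Finset.range (n + 1), 1 / (i:ℝ) ≤ 1 + Real.log W := by
    intro n hn
    rw [sum_range_succ_eq_sum_Ioc (by simp)]
    refine (Finset.sum_le_sum_of_subset_of_nonneg (Finset.Ioc_subset_Ioc_right hn)
      fun i _ _ => by positivity).trans sum_Ioc_one_div_le
  have h1 : ∑ b ∈ Finset.range (a + 1), 1 / |(a:ℝ) - b| ≤ 1 + Real.log W := by
    refine le_trans (le_of_eq ?_) (hle a h)
    rw [← Finset.sum_range_reflect (fun i : ℕ => 1 / (i:ℝ))]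
    refine Finset.sum_congr rfl fun b hb => ?_
    have hb : b ≤ a := by have := Finset.mem_range.1 hb; omega
    have hb' : (b:ℝ) ≤ a := by exact_mod_cast hb
    rw [show a + 1 - 1 - b = a - b by omega, Nat.cast_sub hb, abs_of_nonneg (by linarith)]
  have h2 : ∑ b ∈ Finset.Ico (a + 1) (W + 1), 1 / |(a:ℝ) - b| ≤ 1 + Real.log W := by
    rw [Finset.sum_Ico_eq_sum_range]
    have e : ∀ i : ℕ, 1 / |(a:ℝ) - ((a + 1 + i : ℕ) : ℝ)| = 1 / ((i + 1 : ℕ) : ℝ) := by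
      intro i
      rw [show (a:ℝ) - ((a + 1 + i : ℕ) : ℝ) = -((i + 1 : ℕ) : ℝ) by push_cast; ring, abs_neg,
        Nat.abs_cast]
    rw [Finset.sum_congr rfl fun i _ => e i]
    refine le_trans ?_ (hle (W - a) (by omega))
    rw [Finset.sum_range_succ' _ (W - a)]
    simp only [show W + 1 - (a + 1) = W - a by omega]
    simp
  rw [← Finset.sum_range_add_sum_Ico _ (show a + 1 ≤ W + 1 by omega)]
  linarith

lemma integral_sq_sum_sin_le {D W h : ℕ} (hD : 1 ≤ D) (hW : 1 ≤ W) (hh : 1 ≤ h) {c : ℕ → ℝ}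
    (hc : ∀ d, |c d| ≤ 1 / (d:ℝ)) {Y : ℝ} (hY : 0 ≤ Y) :
    ∫ u in (0:ℝ)..Y, (∑ d ∈ Finset.Ioc D W, c d * Real.sin (2 * π * h * (u / d))) ^ 2 ≤
      Y / D + 2 * W * (1 + Real.log W) := by
  have hpi := Real.pi_gt_three
  have hh1 : (1:ℝ) ≤ h := by exact_mod_cast hh
  have hW1 : (1:ℝ) ≤ W := by exact_mod_cast hW
  have hlW : 0 ≤ Real.log W := Real.log_nonneg hW1
  have e1 : ∀ u : ℝ, (∑ d ∈ Finset.Ioc D W, c d * Real.sin (2 * π * h * (u / d))) ^ 2 =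
      ∑ a ∈ Finset.Ioc D W, ∑ b ∈ Finset.Ioc D W, c a * c b *
        (Real.sin (2 * π * h / a * u) * Real.sin (2 * π * h / b * u)) := by
    intro u
    rw [sq, Finset.sum_mul_sum]
    refine Finset.sum_congr rfl fun a _ => Finset.sum_congr rfl fun b _ => ?_
    rw [show 2 * π * h / (a:ℝ) * u = 2 * π * h * (u / a) by ring,
      show 2 * π * h / (b:ℝ) * u = 2 * π * h * (u / b) by ring]
    ring
  simp only [e1]
  rw [intervalIntegral.integral_finsetSum fun a _ =>
    Continuous.intervalIntegrable (by fun_prop) _ _]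
  have key : ∀ a ∈ Finset.Ioc D W, ∫ u in (0:ℝ)..Y, ∑ b ∈ Finset.Ioc D W, c a * c b *
        (Real.sin (2 * π * h / a * u) * Real.sin (2 * π * h / b * u)) ≤
      Y * ((a:ℝ) ^ 2)⁻¹ + 2 * (1 + Real.log W) := by
    intro a ha
    have ha2 := Finset.mem_Ioc.1 ha
    have ha0 : (0:ℝ) < a := by exact_mod_cast (show 0 < a by omega)
    rw [intervalIntegral.integral_finsetSum fun b _ =>
      Continuous.intervalIntegrable (by fun_prop) _ _]
    have hb : ∀ b ∈ Finset.Ioc D W, ∫ u in (0:ℝ)..Y, c a * c b *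
        (Real.sin (2 * π * h / a * u) * Real.sin (2 * π * h / b * u)) ≤
        (if a = b then Y * ((a:ℝ) ^ 2)⁻¹ else 0) + 1 / |(a:ℝ) - b| := by
      intro b hb
      have hb2 := Finset.mem_Ioc.1 hb
      have hb0 : (0:ℝ) < b := by exact_mod_cast (show 0 < b by omega)
      have hcc : |c a * c b| ≤ 1 / (a:ℝ) * (1 / b) := by
        rw [abs_mul]
        exact mul_le_mul (hc a) (hc b) (abs_nonneg _) (by positivity)
      rw [intervalIntegral.integral_const_mul]
      refine (le_abs_self _).trans ?_
      rw [abs_mul]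
      split_ifs with e
      · subst e
        have h1 : |∫ u in (0:ℝ)..Y, Real.sin (2 * π * h / a * u) * Real.sin (2 * π * h / a * u)| ≤
            1 * |Y - 0| := by
          rw [← Real.norm_eq_abs]
          refine intervalIntegral.norm_integral_le_of_norm_le_const fun u _ => ?_
          rw [norm_mul, Real.norm_eq_abs]
          exact mul_le_one₀ (Real.abs_sin_le_one _) (abs_nonneg _) (Real.abs_sin_le_one _)
        rw [sub_zero, one_mul, abs_of_nonneg hY] at h1
        calc _ ≤ 1 / (a:ℝ) * (1 / a) * Y := by gcongr
          _ = Y * ((a:ℝ) ^ 2)⁻¹ := by field_simp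
          _ ≤ _ := by simp
      · have hab : (a:ℝ) - b ≠ 0 := sub_ne_zero.2 (by exact_mod_cast e)
        have hab0 : 0 < |(a:ℝ) - b| := abs_pos.2 hab
        have hd : |2 * π * h / (a:ℝ) - 2 * π * h / b| = 2 * π * h * |(a:ℝ) - b| / (a * b) := by
          rw [show 2 * π * h / (a:ℝ) - 2 * π * h / b = -(2 * π * h * ((a:ℝ) - b) / (a * b)) by
            field_simp; ring, abs_neg, abs_div, abs_mul,
            abs_of_pos (show 0 < 2 * π * h by positivity), abs_of_pos (show 0 < (a:ℝ) * b by positivity)]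
        have h1 := abs_integral_sin_mul_sin_le (α := 2 * π * h / a) (β := 2 * π * h / b)
          (by positivity) (by positivity) (by
            rw [← sub_ne_zero, ← abs_pos, hd]; positivity) Y
        rw [hd] at h1
        calc _ ≤ 1 / (a:ℝ) * (1 / b) * (1 / (2 * π * h * |(a:ℝ) - b| / (a * b))) := by gcongr
          _ = 1 / (2 * π * h * |(a:ℝ) - b|) := by field_simp
          _ ≤ 1 / |(a:ℝ) - b| := by
            apply one_div_le_one_div_of_le hab0
            apply le_mul_of_one_le_left hab0.le
            nlinarith
          _ = _ := (zero_add _).symm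
    refine (Finset.sum_le_sum hb).trans ?_
    rw [Finset.sum_add_distrib, Finset.sum_ite_eq, if_pos ha]
    gcongr
    refine le_trans (Finset.sum_le_sum_of_subset_of_nonneg ?_ fun i _ _ => by positivity)
      (sum_range_one_div_abs_sub_le ha2.2)
    intro i hi
    have := Finset.mem_Ioc.1 hi
    exact Finset.mem_range.2 (by omega)
  refine (Finset.sum_le_sum key).trans ?_
  rw [Finset.sum_add_distrib, ← Finset.mul_sum, Finset.sum_const, Nat.card_Ioc, nsmul_eq_mul]
  rcases le_or_gt D W with hDW | hDW
  · have h2 := sum_Ioc_inv_sq_le_sub (α := ℝ) (show D ≠ 0 by omega) hDW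
    have h3 : (0:ℝ) ≤ (W:ℝ)⁻¹ := by positivity
    have h4 : ∑ i ∈ Finset.Ioc D W, ((i:ℝ) ^ 2)⁻¹ ≤ (D:ℝ)⁻¹ := by linarith
    have h5 : ((W - D : ℕ) : ℝ) ≤ W := by exact_mod_cast Nat.sub_le W D
    have h6 := mul_le_mul_of_nonneg_left h4 hY
    have h7 := mul_le_mul_of_nonneg_right h5 (show 0 ≤ 2 * (1 + Real.log W) by positivity)
    rw [div_eq_mul_inv]
    linarith
  · rw [Finset.Ioc_eq_empty_of_le hDW.le, show W - D = 0 by omega]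
    simp only [Finset.sum_empty, Nat.cast_zero, mul_zero, zero_mul, add_zero]
    positivity

lemma measurable_psiRem (H : ℕ) : Measurable (psiRem H) := by
  unfold psiRem
  exact measurable_psi.add (by fun_prop)

lemma abs_psiRem_le (H : ℕ) (v : ℝ) : |psiRem H v| ≤ 1 / 2 + H := by
  unfold psiRem
  refine (abs_add_le _ _).trans (add_le_add (abs_psi_le v) ?_)
  refine (Finset.abs_sum_le_sum_abs _ _).trans ?_
  have : ∀ h ∈ Finset.Ioc 0 H, |Real.sin (2 * π * h * v) / (π * h)| ≤ 1 := by
    intro h hh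
    have h1 : (1:ℝ) ≤ h := by exact_mod_cast (Finset.mem_Ioc.1 hh).1
    have hpi := Real.pi_gt_three
    rw [abs_div, abs_of_pos (show 0 < π * h by positivity)]
    exact div_le_one_of_le₀ ((Real.abs_sin_le_one _).trans (by nlinarith)) (by positivity)
  refine (Finset.sum_le_sum this).trans ?_
  simp

lemma intervalIntegrable_of_abs_le {f : ℝ → ℝ} (hf : Measurable f) {C : ℝ} (h : ∀ u, |f u| ≤ C)
    (a b : ℝ) : IntervalIntegrable f volume a b := by
  rw [intervalIntegrable_iff]
  exact Measure.integrableOn_of_bounded (by simp) hf.aestronglyMeasurable (M := C)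
    (Filter.Eventually.of_forall h)

lemma intervalIntegrable_psiRem_sq (H : ℕ) (c a b : ℝ) :
    IntervalIntegrable (fun u => psiRem H (u / c) ^ 2) volume a b := by
  refine intervalIntegrable_of_abs_le
    (((measurable_psiRem H).comp (measurable_id.div_const c)).pow_const 2)
    (C := (1 / 2 + H) ^ 2) (fun u => ?_) a b
  rw [abs_pow]
  exact pow_le_pow_left₀ (abs_nonneg _) (abs_psiRem_le H _) 2

lemma psiRem_periodic (H : ℕ) : Function.Periodic (psiRem H) 1 := by
  intro v
  unfold psiRem
  congr 1
  · simpa using psi_add_int v 1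
  · refine Finset.sum_congr rfl fun h _ => ?_
    rw [mul_add, mul_one, show 2 * π * (h:ℝ) = h * (2 * π) by ring, Real.sin_add_nat_mul_two_pi]

lemma integral_psiRem_div_sq_le {H d : ℕ} (hH : 1 ≤ H) (hd : 1 ≤ d) {Y : ℝ} (hY : (d:ℝ) ≤ Y) :
    ∫ u in (0:ℝ)..Y, psiRem H (u / d) ^ 2 ≤ 2 * Y / H := by
  have hd0 : (0:ℝ) < d := by exact_mod_cast hd
  have hi : ∀ a b : ℝ, IntervalIntegrable (fun u => psiRem H u ^ 2) volume a b := by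
    intro a b
    simpa using intervalIntegrable_psiRem_sq H 1 a b
  rw [intervalIntegral.integral_comp_div (fun v => psiRem H v ^ 2) hd0.ne', zero_div, smul_eq_mul]
  have hn : Y / d ≤ (⌈Y / d⌉₊ : ℝ) := Nat.le_ceil _
  have hY0 : 0 ≤ Y / d := div_nonneg (hd0.le.trans hY) hd0.le
  have h1 : ∫ u in (0:ℝ)..Y / d, psiRem H u ^ 2 ≤ ∫ u in (0:ℝ)..(⌈Y / d⌉₊ : ℝ), psiRem H u ^ 2 :=
    intervalIntegral.integral_mono_interval le_rfl hY0 hn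
      (Filter.Eventually.of_forall fun u => sq_nonneg _) (hi _ _)
  have hper : Function.Periodic (fun u => psiRem H u ^ 2) 1 := fun v => by
    simp only [psiRem_periodic H v]
  have h2 := hper.intervalIntegral_add_zsmul_eq (⌈Y / d⌉₊ : ℤ) 0 hi
  simp only [zero_add, zsmul_eq_mul, mul_one, Int.cast_natCast] at h2
  have h3 := integral_psiRem_sq_le hH
  have h4 : (⌈Y / d⌉₊ : ℝ) ≤ 2 * (Y / d) := by
    have := Nat.ceil_lt_add_one hY0
    have : 1 ≤ Y / d := by rw [le_div_iff₀ hd0]; linarith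
    linarith
  calc (d:ℝ) * ∫ u in (0:ℝ)..Y / d, psiRem H u ^ 2
      ≤ d * ((2 * (Y / d)) * (1 / H)) := by
        gcongr
        rw [h2] at h1
        exact h1.trans (mul_le_mul h4 h3
          (intervalIntegral.integral_nonneg zero_le_one fun u _ => sq_nonneg _) (by positivity))
    _ = _ := by field_simp

lemma volume_quarter_le_abs_sum_psi_le {D W H : ℕ} (hD : 1 ≤ D) (hW : 1 ≤ W) (hH : 1 ≤ H) {Y : ℝ}
    (hY : (W:ℝ) ≤ Y) :
    volume ({u : ℝ | 1 / 4 ≤ |∑ d ∈ Finset.Ioc D W,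
      (ArithmeticFunction.moebius d : ℝ) / d * psi (u / d)|} ∩ Set.Ioc 0 Y) ≤
      ENNReal.ofReal (16 * (2 * (1 + Real.log W) ^ 2 * (2 * Y / H) +
        2 * (1 + Real.log H) ^ 2 * (Y / D + 2 * W * (1 + Real.log W)))) := by
  have hpi := Real.pi_gt_three
  have hW1 : (1:ℝ) ≤ W := by exact_mod_cast hW
  have hH1 : (1:ℝ) ≤ H := by exact_mod_cast hH
  have hlW : 0 ≤ Real.log W := Real.log_nonneg hW1
  have hlH : 0 ≤ Real.log H := Real.log_nonneg hH1
  have hY0 : 0 ≤ Y := by linarith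
  set c : ℕ → ℝ := fun d => (ArithmeticFunction.moebius d : ℝ) / d with hc
  have hcb : ∀ d, |c d| ≤ 1 / (d:ℝ) := fun d => abs_moebius_div_le d
  set P : ℝ → ℝ := fun u => ∑ d ∈ Finset.Ioc D W, c d * psi (u / d) with hP
  set S : ℕ → ℝ → ℝ := fun h u => ∑ d ∈ Finset.Ioc D W, c d * Real.sin (2 * π * h * (u / d)) with hS
  set R : ℝ → ℝ := fun u => ∑ d ∈ Finset.Ioc D W, 1 / (d:ℝ) * psiRem H (u / d) ^ 2 with hR
  set T : ℝ → ℝ := fun u => ∑ h ∈ Finset.Ioc 0 H, 1 / (h:ℝ) * S h u ^ 2 with hT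
  have hsub : ∑ d ∈ Finset.Ioc D W, 1 / (d:ℝ) ≤ 1 + Real.log W :=
    (Finset.sum_le_sum_of_subset_of_nonneg (Finset.Ioc_subset_Ioc_left (Nat.zero_le D))
      fun i _ _ => by positivity).trans sum_Ioc_one_div_le
  have hpt : ∀ u, P u ^ 2 ≤ 2 * (1 + Real.log W) * R u + 2 * (1 + Real.log H) * T u := by
    intro u
    have hdec : P u = ∑ d ∈ Finset.Ioc D W, c d * psiRem H (u / d) -
        ∑ h ∈ Finset.Ioc 0 H, 1 / (π * h) * S h u := by
      have e : ∑ h ∈ Finset.Ioc 0 H, 1 / (π * h) * S h u = ∑ d ∈ Finset.Ioc D W, c d *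
          ∑ h ∈ Finset.Ioc 0 H, Real.sin (2 * π * h * (u / d)) / (π * h) := by
        simp only [hS, Finset.mul_sum]
        rw [Finset.sum_comm]
        exact Finset.sum_congr rfl fun d _ => Finset.sum_congr rfl fun h _ => by ring
      rw [e, ← Finset.sum_sub_distrib]
      refine Finset.sum_congr rfl fun d _ => ?_
      unfold psiRem
      ring
    have b1 : (∑ d ∈ Finset.Ioc D W, c d * psiRem H (u / d)) ^ 2 ≤ (1 + Real.log W) * R u := by
      refine (Finset.sum_sq_le_sum_mul_sum_of_sq_le_mul _ (f := fun d : ℕ => 1 / (d:ℝ))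
        (g := fun d : ℕ => 1 / (d:ℝ) * psiRem H (u / d) ^ 2) (fun d _ => by positivity)
        (fun d _ => by positivity) fun d _ => ?_).trans ?_
      · rw [mul_pow, ← mul_assoc, ← sq, ← sq_abs (c d)]
        gcongr
        exact hcb d
      · exact mul_le_mul_of_nonneg_right hsub (Finset.sum_nonneg fun d _ => by positivity)
    have b2 : (∑ h ∈ Finset.Ioc 0 H, 1 / (π * h) * S h u) ^ 2 ≤ (1 + Real.log H) * T u := by
      refine (Finset.sum_sq_le_sum_mul_sum_of_sq_le_mul _ (f := fun d : ℕ => 1 / (d:ℝ))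
        (g := fun d : ℕ => 1 / (d:ℝ) * S d u ^ 2) (fun d _ => by positivity)
        (fun d _ => by positivity) fun d hd => ?_).trans ?_
      · have hd0 : (0:ℝ) < d := by exact_mod_cast (Finset.mem_Ioc.1 hd).1
        rw [mul_pow, ← mul_assoc, ← sq]
        gcongr
        nlinarith
      · exact mul_le_mul_of_nonneg_right sum_Ioc_one_div_le
          (Finset.sum_nonneg fun d _ => by positivity)
    rw [hdec]
    nlinarith [sq_nonneg (∑ d ∈ Finset.Ioc D W, c d * psiRem H (u / d) +
      ∑ h ∈ Finset.Ioc 0 H, 1 / (π * h) * S h u)]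
  have hPm : Measurable P := Finset.measurable_sum _ fun d _ =>
    (measurable_psi.comp (measurable_id.div_const _)).const_mul _
  have hPb : ∀ u, |P u ^ 2| ≤ (∑ d ∈ Finset.Ioc D W, |c d| * (1 / 2)) ^ 2 := by
    intro u
    rw [abs_pow]
    refine pow_le_pow_left₀ (abs_nonneg _) ((Finset.abs_sum_le_sum_abs _ _).trans
      (Finset.sum_le_sum fun d _ => ?_)) 2
    rw [abs_mul]
    exact mul_le_mul_of_nonneg_left (abs_psi_le _) (abs_nonneg _)
  have hPi := intervalIntegrable_of_abs_le (hPm.pow_const 2) hPb 0 Y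
  have hRi : IntervalIntegrable R volume 0 Y := by
    have := IntervalIntegrable.sum (Finset.Ioc D W) (f := fun d : ℕ => fun u : ℝ =>
      1 / (d:ℝ) * psiRem H (u / d) ^ 2) (μ := volume) (a := 0) (b := Y)
      fun d _ => (intervalIntegrable_psiRem_sq H d 0 Y).const_mul _
    have e : R = ∑ d ∈ Finset.Ioc D W, fun u : ℝ => 1 / (d:ℝ) * psiRem H (u / d) ^ 2 := by
      ext u
      simp only [hR, Finset.sum_apply]
    rwa [e]
  have hTi : IntervalIntegrable T volume 0 Y := Continuous.intervalIntegrable (by fun_prop) _ _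
  have hInt : ∫ u in (0:ℝ)..Y, P u ^ 2 ≤ 2 * (1 + Real.log W) ^ 2 * (2 * Y / H) +
        2 * (1 + Real.log H) ^ 2 * (Y / D + 2 * W * (1 + Real.log W)) := by
    have i1 : ∫ u in (0:ℝ)..Y, R u ≤ (1 + Real.log W) * (2 * Y / H) := by
      simp only [hR]
      rw [intervalIntegral.integral_finsetSum fun (d : ℕ) _ =>
        (intervalIntegrable_psiRem_sq H d 0 Y).const_mul _]
      simp only [intervalIntegral.integral_const_mul]
      have : ∀ d ∈ Finset.Ioc D W, 1 / (d:ℝ) * ∫ u in (0:ℝ)..Y, psiRem H (u / d) ^ 2 ≤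
          1 / (d:ℝ) * (2 * Y / H) := by
        intro d hd
        have hd2 := Finset.mem_Ioc.1 hd
        refine mul_le_mul_of_nonneg_left (integral_psiRem_div_sq_le hH (by omega) ?_)
          (by positivity)
        exact le_trans (by exact_mod_cast hd2.2) hY
      refine (Finset.sum_le_sum this).trans ?_
      rw [← Finset.sum_mul]
      gcongr
    have i2 : ∫ u in (0:ℝ)..Y, T u ≤
        (1 + Real.log H) * (Y / D + 2 * W * (1 + Real.log W)) := by
      simp only [hT]
      rw [intervalIntegral.integral_finsetSum fun d _ =>
        Continuous.intervalIntegrable (by fun_prop) _ _]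
      simp only [intervalIntegral.integral_const_mul]
      have : ∀ h ∈ Finset.Ioc 0 H, 1 / (h:ℝ) * ∫ u in (0:ℝ)..Y, S h u ^ 2 ≤
          1 / (h:ℝ) * (Y / D + 2 * W * (1 + Real.log W)) := by
        intro h hh
        exact mul_le_mul_of_nonneg_left (integral_sq_sum_sin_le hD hW (Finset.mem_Ioc.1 hh).1
          hcb hY0) (by positivity)
      refine (Finset.sum_le_sum this).trans ?_
      rw [← Finset.sum_mul]
      gcongr
      exact sum_Ioc_one_div_le
    refine (intervalIntegral.integral_mono_on hY0 hPi
      ((hRi.const_mul (2 * (1 + Real.log W))).add (hTi.const_mul (2 * (1 + Real.log H))))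
      fun u _ => hpt u).trans ?_
    rw [intervalIntegral.integral_add (hRi.const_mul _) (hTi.const_mul _),
      intervalIntegral.integral_const_mul, intervalIntegral.integral_const_mul]
    have j1 := mul_le_mul_of_nonneg_left i1 (show 0 ≤ 2 * (1 + Real.log W) by positivity)
    have j2 := mul_le_mul_of_nonneg_left i2 (show 0 ≤ 2 * (1 + Real.log H) by positivity)
    linarith
  have hmarkov := mul_meas_ge_le_integral_of_nonneg (μ := volume.restrict (Set.Ioc 0 Y))
    (f := fun u => P u ^ 2) (Filter.Eventually.of_forall fun u => sq_nonneg _)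
    ((intervalIntegrable_iff_integrableOn_Ioc_of_le hY0).1 hPi) (1 / 16)
  rw [← intervalIntegral.integral_of_le hY0] at hmarkov
  have hset : {u : ℝ | 1 / 4 ≤ |P u|} = {u : ℝ | 1 / 16 ≤ P u ^ 2} := by
    ext u
    change 1 / 4 ≤ |P u| ↔ 1 / 16 ≤ P u ^ 2
    rw [show (1 / 16 : ℝ) = (1 / 4) ^ 2 by norm_num, sq_le_sq,
      abs_of_pos (show (0:ℝ) < 1 / 4 by norm_num)]
  have hms : MeasurableSet {u : ℝ | 1 / 4 ≤ |P u|} := measurableSet_le measurable_const hPm.abs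
  rw [← hset] at hmarkov
  change volume ({u : ℝ | 1 / 4 ≤ |P u|} ∩ Set.Ioc 0 Y) ≤ _
  rw [← Measure.restrict_apply hms]
  refine (ENNReal.le_ofReal_iff_toReal_le (by finiteness) ?_).2 ?_
  swap
  · have := hmarkov.trans hInt
    simp only [Measure.real] at this
    linarith
  positivity

lemma half_mul_le_floor {t : ℝ} (ht : 1 ≤ t) : t / 2 ≤ (⌊t⌋₊ : ℝ) := by
  have h1 : 1 ≤ ⌊t⌋₊ := Nat.one_le_floor_iff _ |>.2 ht
  have h2 : (1 : ℝ) ≤ ⌊t⌋₊ := by exact_mod_cast h1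
  have h3 := Nat.lt_floor_add_one t
  linarith

set_option maxHeartbeats 1000000 in
/-- A choice of cutoffs making every error term negligible. -/
lemma exists_cutoffs {K B s M q : ℝ} (hK : 0 < K) (hM : 1 ≤ M) (hq : 40000 ≤ q)
    (hqB : 12 * B ≤ q) (hs : M * q ^ 2 = s) (hT : 640 * (1 + s ^ 2) ^ 3 ≤ Real.exp M)
    (hC : 20 * K ≤ Real.exp M) :
    ∃ D W : ℕ, 1 ≤ D ∧ D ≤ W ∧ 10 ≤ W ∧ (W : ℝ) ≤ Real.exp (s ^ 2) ∧ Real.exp M ≤ D ∧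
      (∀ u : ℝ, u ≤ Real.exp (s ^ 2) →
        K * (u / W) * Real.exp (-(√(Real.log W) / 10000)) ≤ 1 / 10) ∧
      W + 16 * (2 * (1 + Real.log W) ^ 2 * (2 * Real.exp (s ^ 2) / D)
        + 2 * (1 + Real.log D) ^ 2 * (Real.exp (s ^ 2) / D + 2 * W * (1 + Real.log W)))
        ≤ Real.exp (s ^ 2) * Real.exp (-M) / 2 ∧
      ∀ k : ℕ, (k : ℝ) ≤ B * M →
        2 * (4 * (D * (1 + Real.log D))) ^ (2 * k) ≤ Real.exp (s ^ 2) * Real.exp (-M) / 4 := by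
  have hq0 : 0 < q := by linarith
  have hsq : s / q = M * q := by rw [← hs]; field_simp
  have hMq : 40000 * M ≤ M * q := by nlinarith
  have hs1 : 40000 * (M * q) ≤ s := by rw [← hs]; nlinarith [mul_pos (by linarith : 0 < M) hq0]
  have hMs : M ≤ s := by linarith
  have hs0 : 0 < s := by linarith
  have hsq2 : 40000 * s ≤ s * q := by nlinarith
  have hss : 40000 * (s * q) ≤ s ^ 2 := by
    have : s * q * 40000 ≤ s * q * (M * q) := by
      apply mul_le_mul_of_nonneg_left (by linarith) (by positivity)
    calc 40000 * (s * q) = s * q * 40000 := by ring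
      _ ≤ s * q * (M * q) := this
      _ = s * (M * q ^ 2) := by ring
      _ = s ^ 2 := by rw [hs]; ring
  have e1 : (2 : ℝ) ≤ Real.exp 1 := by have := Real.add_one_le_exp (1 : ℝ); linarith
  set D := ⌈Real.exp (s * q)⌉₊ with hD
  set w := Real.exp (s ^ 2 - M * q) with hw
  set W := ⌊w⌋₊ with hW
  have hDl : Real.exp (s * q) ≤ D := Nat.le_ceil _
  have hDp : (1 : ℝ) ≤ D := (Real.one_le_exp (by positivity)).trans hDl
  have hDu : (D : ℝ) ≤ Real.exp (s * q + 1) := by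
    have h := Nat.ceil_lt_add_one (Real.exp_pos (s * q)).le
    have h1 : (1 : ℝ) ≤ Real.exp (s * q) := Real.one_le_exp (by positivity)
    rw [Real.exp_add]
    nlinarith
  have hw1 : 1 ≤ w := Real.one_le_exp (by linarith)
  have hWl : w / 2 ≤ W := half_mul_le_floor hw1
  have hWu : (W : ℝ) ≤ w := Nat.floor_le (by positivity)
  have hWl' : Real.exp (s ^ 2 - M * q - 1) ≤ W := by
    refine le_trans ?_ hWl
    rw [Real.exp_sub, ← hw]
    gcongr
  have hWpos : (0 : ℝ) < W := (Real.exp_pos _).trans_le hWl'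
  have hDWr : (D : ℝ) ≤ W := hDu.trans (le_trans (Real.exp_le_exp.2 (by linarith)) hWl')
  have hDW : D ≤ W := by exact_mod_cast hDWr
  have hWy : (W : ℝ) ≤ Real.exp (s ^ 2) := hWu.trans (Real.exp_le_exp.2 (by nlinarith))
  have hlogW : Real.log W ≤ s ^ 2 := (Real.log_le_iff_le_exp hWpos).2 hWy
  have hlogD : Real.log D ≤ s ^ 2 := (Real.log_le_log (by linarith) hDWr).trans hlogW
  have hlogD0 : 0 ≤ Real.log D := Real.log_nonneg hDp
  have hlogW0 : 0 ≤ Real.log W := Real.log_nonneg (hDp.trans hDWr)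
  have hlogWl : (s / 2) ^ 2 ≤ Real.log W := by
    have := (Real.le_log_iff_exp_le hWpos).2 hWl'
    nlinarith
  have hsqrt : s / 2 ≤ √(Real.log W) := Real.le_sqrt_of_sq_le hlogWl
  have hMq2 : Real.exp (-(M * q)) ≤ Real.exp (-M) * Real.exp (-M) := by
    rw [← Real.exp_add]; exact Real.exp_le_exp.2 (by linarith)
  have hwe : w = Real.exp (s ^ 2) * Real.exp (-(M * q)) := by
    rw [hw, ← Real.exp_add]; ring_nf
  refine ⟨D, W, by exact_mod_cast hDp, hDW, ?_, hWy, ?_, ?_, ?_, ?_⟩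
  · have : (10 : ℝ) ≤ W := by
      refine le_trans ?_ hWl'
      have := Real.add_one_le_exp (s ^ 2 - M * q - 1)
      linarith
    exact_mod_cast this
  · exact (Real.exp_le_exp.2 (by linarith)).trans hDl
  · intro u hu
    have h1 : u / W ≤ 2 * Real.exp (M * q) := by
      rw [div_le_iff₀ hWpos]
      calc u ≤ Real.exp (s ^ 2) := hu
        _ = 2 * Real.exp (M * q) * (w / 2) := by
          rw [hw, Real.exp_sub]; field_simp
        _ ≤ _ := by gcongr
    have h2 : Real.exp (-(√(Real.log W) / 10000)) ≤ Real.exp (-(s / 20000)) :=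
      Real.exp_le_exp.2 (by linarith)
    calc K * (u / W) * Real.exp (-(√(Real.log W) / 10000))
        ≤ K * (2 * Real.exp (M * q)) * Real.exp (-(s / 20000)) := by gcongr
      _ = 2 * K * Real.exp (M * q - s / 20000) := by
          rw [mul_assoc, mul_assoc, mul_assoc, ← Real.exp_add]; ring_nf
      _ ≤ 2 * K * Real.exp (-M) := by gcongr; linarith
      _ ≤ 1 / 10 := by
          rw [Real.exp_neg, ← div_eq_mul_inv, div_le_iff₀ (Real.exp_pos _)]
          linarith
  · set T := 1 + s ^ 2 with hTd
    have hT1 : 1 ≤ T := by rw [hTd]; nlinarith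
    have hyD : Real.exp (s ^ 2) / D ≤ w := by
      rw [div_le_iff₀ (by linarith)]
      calc Real.exp (s ^ 2) ≤ Real.exp (s ^ 2 - M * q) * Real.exp (s * q) := by
            rw [← Real.exp_add]; exact Real.exp_le_exp.2 (by nlinarith)
        _ ≤ _ := by gcongr
    have h3 : 2 * Real.exp (s ^ 2) / D ≤ 2 * w := by
      rw [mul_div_assoc]; linarith
    have hw0 : 0 < w := by positivity
    calc W + 16 * (2 * (1 + Real.log W) ^ 2 * (2 * Real.exp (s ^ 2) / D)
          + 2 * (1 + Real.log D) ^ 2 * (Real.exp (s ^ 2) / D + 2 * W * (1 + Real.log W)))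
        ≤ w + 16 * (2 * T ^ 2 * (2 * w) + 2 * T ^ 2 * (w + 2 * w * T)) := by
          gcongr <;> linarith
      _ = w * (1 + 96 * T ^ 2 + 64 * T ^ 3) := by ring
      _ ≤ w * (320 * T ^ 3) := by
          gcongr
          nlinarith [pow_le_pow_left₀ zero_le_one hT1 2, pow_le_pow_left₀ zero_le_one hT1 3,
            mul_le_mul_of_nonneg_right hT1 (sq_nonneg T)]
      _ ≤ w * (Real.exp M / 2) := by gcongr; linarith
      _ ≤ Real.exp (s ^ 2) * (Real.exp (-M) * Real.exp (-M)) * (Real.exp M / 2) := by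
          rw [hwe]; gcongr
      _ = _ := by
          rw [Real.exp_neg]; field_simp
  · intro k hk
    have h1 : 4 * (D * (1 + Real.log D)) ≤ Real.exp (3 * (s * q)) := by
      have h2 : 1 + Real.log D ≤ D := by
        have := Real.log_le_sub_one_of_pos (by linarith : (0 : ℝ) < D); linarith
      have e4 : (4 : ℝ) ≤ Real.exp 1 * Real.exp 1 := by nlinarith
      calc 4 * (D * (1 + Real.log D))
          ≤ (Real.exp 1 * Real.exp 1) * (Real.exp (s * q + 1) * Real.exp (s * q + 1)) := by
            gcongr; exact h2.trans hDu
        _ = Real.exp (2 * (s * q) + 4) := by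
            simp only [← Real.exp_add]; ring_nf
        _ ≤ _ := Real.exp_le_exp.2 (by linarith)
    have h3 : (4 * (D * (1 + Real.log D))) ^ (2 * k) ≤ Real.exp (s ^ 2 / 2) := by
      calc (4 * (D * (1 + Real.log D))) ^ (2 * k) ≤ Real.exp (3 * (s * q)) ^ (2 * k) := by
            gcongr
        _ = Real.exp (6 * (s * q) * k) := by
            rw [← Real.exp_nat_mul]; push_cast; ring_nf
        _ ≤ Real.exp (s ^ 2 / 2) := by
            apply Real.exp_le_exp.2
            have h4 : 6 * (s * q) * k ≤ 6 * (s * q) * (B * M) := by gcongr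
            have h5 : s * q * M * (12 * B) ≤ s * q * M * q := by gcongr
            have h6 : s * q * M * q = s ^ 2 := by rw [sq s]; nth_rewrite 3 [← hs]; ring
            linarith
    have h7 : Real.exp (s ^ 2) * Real.exp (-M) / 4
        = Real.exp (s ^ 2 / 2) * (Real.exp (s ^ 2 / 2 - M) / 4) := by
      rw [mul_div_assoc', ← Real.exp_add, ← Real.exp_add]; ring_nf
    have h8 : 8 ≤ Real.exp (s ^ 2 / 2 - M) := by
      have := Real.add_one_le_exp (s ^ 2 / 2 - M); nlinarith
    rw [h7]
    nlinarith [Real.exp_pos (s ^ 2 / 2)]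

lemma exists_cutoffs_of_large {ε : ℝ} (hε : 0 < ε) (hε2 : ε < 1 / 2) {K B : ℝ} (hK : 0 < K)
    (hB : 0 ≤ B) :
    ∃ y₀ : ℝ, 3 ≤ y₀ ∧ ∀ y : ℝ, y₀ ≤ y → ∃ M : ℝ, 1 ≤ M ∧
      (∀ x : ℝ, x ≤ (1 / 2 - ε) * Real.log (Real.log y) → Real.exp x ≤ M) ∧
      ∃ D W : ℕ, 1 ≤ D ∧ D ≤ W ∧ 10 ≤ W ∧ (W : ℝ) ≤ y ∧ Real.exp M ≤ D ∧
      (∀ u : ℝ, u ≤ y → K * (u / W) * Real.exp (-(√(Real.log W) / 10000)) ≤ 1 / 10) ∧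
      W + 16 * (2 * (1 + Real.log W) ^ 2 * (2 * y / D)
        + 2 * (1 + Real.log D) ^ 2 * (y / D + 2 * W * (1 + Real.log W)))
        ≤ y * Real.exp (-M) / 2 ∧
      ∀ k : ℕ, (k : ℝ) ≤ B * M →
        2 * (4 * (D * (1 + Real.log D))) ^ (2 * k) ≤ y * Real.exp (-M) / 4 := by
  set a := 1 / 2 - ε with ha
  have ha0 : 0 < a := by linarith
  set t₀ := 3 + 12 / a ^ 2 + 20 * K / a + 2 * (40000 + 12 * B) / ε with ht₀
  have p1 : 0 < 12 / a ^ 2 := by positivity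
  have p2 : 0 < 20 * K / a := by positivity
  have p3 : 0 < 2 * (40000 + 12 * B) / ε := by positivity
  refine ⟨Real.exp (Real.exp t₀), ?_, fun y hy => ?_⟩
  · have h1 := Real.add_one_le_exp (Real.exp t₀)
    have h2 := Real.add_one_le_exp t₀
    linarith
  have hy0 : 0 < y := (Real.exp_pos _).trans_le hy
  have hL : Real.exp t₀ ≤ Real.log y := (Real.le_log_iff_exp_le hy0).2 hy
  have hL0 : 0 < Real.log y := (Real.exp_pos _).trans_le hL
  set t := Real.log (Real.log y) with ht
  have htt : t₀ ≤ t := (Real.le_log_iff_exp_le hL0).2 hL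
  have het : Real.exp t = Real.log y := Real.exp_log hL0
  have hy' : y = Real.exp (Real.exp (t / 2) ^ 2) := by
    rw [← Real.exp_nat_mul, show ((2 : ℕ) : ℝ) * (t / 2) = t by push_cast; ring, het,
      Real.exp_log hy0]
  have c1 : 12 ≤ a ^ 2 * t := by
    have : 12 / a ^ 2 ≤ t := by linarith
    rw [div_le_iff₀ (by positivity)] at this; linarith
  have c2 : 20 * K ≤ a * t := by
    have : 20 * K / a ≤ t := by linarith
    rw [div_le_iff₀ (by positivity)] at this; linarith
  have c3 : 2 * (40000 + 12 * B) ≤ ε * t := by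
    have : 2 * (40000 + 12 * B) / ε ≤ t := by linarith
    rw [div_le_iff₀ (by positivity)] at this; linarith
  have ht3 : 3 ≤ t := by linarith
  have hat : 0 ≤ a * t := by positivity
  have hMq := Real.quadratic_le_exp_of_nonneg hat
  set M := Real.exp (a * t) with hM
  have hM1 : 1 ≤ M := Real.one_le_exp hat
  have hqq := Real.add_one_le_exp (ε * t / 2)
  have hMe := Real.add_one_le_exp M
  have hKM : 20 * K ≤ Real.exp M := by nlinarith
  have hT : 640 * (1 + Real.exp (t / 2) ^ 2) ^ 3 ≤ Real.exp M := by
    have e2 : Real.exp (t / 2) ^ 2 = Real.exp t := by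
      rw [← Real.exp_nat_mul]; congr 1; push_cast; ring
    have e3 : (5120 : ℝ) ≤ Real.exp 9 := by
      have h := Real.exp_one_gt_d9
      calc (5120 : ℝ) ≤ (2.7 : ℝ) ^ 9 := by norm_num
        _ ≤ Real.exp 1 ^ 9 := by gcongr; linarith
        _ = Real.exp 9 := by rw [← Real.exp_nat_mul]; norm_num
    have e1 : 1 ≤ Real.exp t := Real.one_le_exp (by linarith)
    rw [e2]
    calc 640 * (1 + Real.exp t) ^ 3 ≤ 640 * (2 * Real.exp t) ^ 3 := by gcongr; linarith
      _ = 5120 * Real.exp t ^ 3 := by ring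
      _ ≤ Real.exp 9 * Real.exp t ^ 3 := by gcongr
      _ = Real.exp (9 + 3 * t) := by rw [← Real.exp_nat_mul, ← Real.exp_add]; norm_num
      _ ≤ Real.exp M := by
        apply Real.exp_le_exp.2
        nlinarith
  obtain ⟨D, W, h⟩ := exists_cutoffs (B := B) (q := Real.exp (ε * t / 2))
    (s := Real.exp (t / 2)) hK hM1 (by linarith) (by linarith)
    (by rw [hM, ← Real.exp_nat_mul, ← Real.exp_add]; congr 1; rw [ha]; push_cast; ring)
    hT hKM
  rw [← hy'] at h
  exact ⟨M, hM1, fun x hx => Real.exp_le_exp.2 hx, D, W, h⟩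

lemma volume_fract_eq_zero : volume {u : ℝ | Int.fract u = 0} = 0 := by
  refine (Set.Countable.mono ?_ (Set.countable_range (fun n : ℤ => (n : ℝ)))).measure_zero _
  intro u hu
  obtain ⟨n, hn⟩ := Int.fract_eq_zero_iff.1 hu
  exact ⟨n, hn⟩

lemma Rtilde_le_sub_condAvg {D W z : ℕ} {u : ℝ} (hDW : D ≤ W) (hW : 10 ≤ W) (hu : (W : ℝ) ≤ u)
    (hf : Int.fract u ≠ 0)
    (htail : |∑ d ∈ Finset.Ioc W ⌊u⌋₊, (ArithmeticFunction.moebius d : ℝ) / d * psi (u / d)|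
      ≤ 1 / 10)
    (hP : |∑ d ∈ Finset.Ioc D W, (ArithmeticFunction.moebius d : ℝ) / d * psi (u / d)| < 1 / 4)
    (hA : |condAvg D D u - condAvg D z u| < 1 / 4) :
    Rtilde u < 13 / 10 - condAvg D z u := by
  have hWr : (10 : ℝ) ≤ W := by exact_mod_cast hW
  have h := abs_Rtilde_add_sum_le (hWr.trans hu) hf
  have hWu : W ≤ ⌊u⌋₊ := Nat.le_floor hu
  have hs : ∀ {a b c : ℕ}, a ≤ b → b ≤ c → ∑ d ∈ Finset.Ioc a c,
      (ArithmeticFunction.moebius d : ℝ) / d * psi (u / d)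
      = ∑ d ∈ Finset.Ioc a b, (ArithmeticFunction.moebius d : ℝ) / d * psi (u / d)
        + ∑ d ∈ Finset.Ioc b c, (ArithmeticFunction.moebius d : ℝ) / d * psi (u / d) := by
    intro a b c hab hbc
    rw [← Finset.Ioc_union_Ioc_eq_Ioc hab hbc, Finset.sum_union]
    exact Finset.Ioc_disjoint_Ioc_of_le le_rfl
  rw [hs (Nat.zero_le W) hWu, hs (Nat.zero_le D) hDW, ← condAvg_top] at h
  rw [abs_le] at h htail
  rw [abs_lt] at hP hA
  linarith [h.2, htail.1, hP.1, hA.1]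

lemma volume_le_Rtilde_le {D W z Y : ℕ} {y τ : ℝ} (hD : 1 ≤ D) (hDW : D ≤ W) (hW : 10 ≤ W)
    (hWy : (W : ℝ) ≤ y) (hY : y < Y)
    (htail : ∀ u : ℝ, (W : ℝ) ≤ u → u ≤ y →
      |∑ d ∈ Finset.Ioc W ⌊u⌋₊, (ArithmeticFunction.moebius d : ℝ) / d * psi (u / d)| ≤ 1 / 10) :
    volume {u : ℝ | u ∈ Set.Icc 0 y ∧ τ ≤ Rtilde u} ≤
      ENNReal.ofReal (W + 16 * (2 * (1 + Real.log W) ^ 2 * (2 * y / D)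
        + 2 * (1 + Real.log D) ^ 2 * (y / D + 2 * W * (1 + Real.log W))))
      + volume ({u : ℝ | 1 / 4 ≤ |condAvg D D u - condAvg D z u|} ∩ Set.Ico 0 (Y : ℝ))
      + volume {u : ℝ | u ∈ Set.Icc 0 y ∧ τ - 13 / 10 ≤ -condAvg D z u} := by
  have hlW : 0 ≤ Real.log W := Real.log_natCast_nonneg _
  have hlD : 0 ≤ Real.log D := Real.log_natCast_nonneg _
  have hW0 : (0 : ℝ) ≤ W := Nat.cast_nonneg _
  have hy0 : 0 ≤ y := hW0.trans hWy
  have hsub : {u : ℝ | u ∈ Set.Icc 0 y ∧ τ ≤ Rtilde u} ⊆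
      ((((Set.Icc 0 (W : ℝ)) ∪ {u : ℝ | Int.fract u = 0}) ∪
        ({u : ℝ | 1 / 4 ≤ |∑ d ∈ Finset.Ioc D W,
          (ArithmeticFunction.moebius d : ℝ) / d * psi (u / d)|} ∩ Set.Ioc 0 y)) ∪
        ({u : ℝ | 1 / 4 ≤ |condAvg D D u - condAvg D z u|} ∩ Set.Ico 0 (Y : ℝ))) ∪
        {u : ℝ | u ∈ Set.Icc 0 y ∧ τ - 13 / 10 ≤ -condAvg D z u} := by
    rintro u ⟨⟨hu0, huy⟩, hu⟩
    by_contra hcon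
    simp only [Set.mem_union, not_or] at hcon
    obtain ⟨⟨⟨⟨h1, h2⟩, h3⟩, h4⟩, h5⟩ := hcon
    have hWu : (W : ℝ) < u := by
      by_contra hlt
      exact h1 ⟨hu0, not_lt.1 hlt⟩
    have hP : |∑ d ∈ Finset.Ioc D W,
        (ArithmeticFunction.moebius d : ℝ) / d * psi (u / d)| < 1 / 4 := by
      by_contra hlt
      exact h3 ⟨not_lt.1 hlt, hW0.trans_lt hWu, huy⟩
    have hA : |condAvg D D u - condAvg D z u| < 1 / 4 := by
      by_contra hlt
      exact h4 ⟨not_lt.1 hlt, hu0, huy.trans_lt hY⟩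
    have := Rtilde_le_sub_condAvg hDW hW hWu.le h2 (htail u hWu.le huy) hP hA
    exact h5 ⟨⟨hu0, huy⟩, by linarith⟩
  refine (measure_mono hsub).trans ?_
  refine (measure_union_le _ _).trans (add_le_add ?_ le_rfl)
  refine (measure_union_le _ _).trans (add_le_add ?_ le_rfl)
  refine (measure_union_le _ _).trans ?_
  rw [ENNReal.ofReal_add hW0 (by positivity)]
  refine add_le_add ?_ (volume_quarter_le_abs_sum_psi_le hD (by omega) hD hWy)
  refine (measure_union_le _ _).trans ?_
  rw [volume_fract_eq_zero, add_zero, Real.volume_Icc, sub_zero]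

lemma lt_three_mul_exp_gamma :
    (49 / 100 : ℝ) < 3 * Real.exp Real.eulerMascheroniConstant / π ^ 2 := by
  have h1 := Real.one_half_lt_eulerMascheroniConstant
  have h2 : (1.625 : ℝ) ≤ Real.exp Real.eulerMascheroniConstant := by
    have := Real.quadratic_le_exp_of_nonneg (by linarith : 0 ≤ Real.eulerMascheroniConstant)
    nlinarith
  have h3 : π ^ 2 < 9.9 := by nlinarith [Real.pi_lt_d4, Real.pi_gt_three]
  rw [lt_div_iff₀ (by positivity)]
  linarith

lemma exists_truncation_params {C : ℝ} (hC : 0 < C) :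
    ∃ A : ℝ, 0 < A ∧ A ≤ 1 ∧ ∃ x₀ : ℝ, Real.exp 1 ≤ x₀ ∧ ∀ x : ℝ, x₀ ≤ x →
      8 ≤ A * x ∧ ∃ z k : ℕ, 4 ≤ z ∧ (z : ℝ) ≤ Real.exp x ∧ Real.log z ≤ x - (C + 3) ∧ 1 ≤ k ∧
        (k : ℝ) ≤ 1 / (Real.exp 1 * C) * Real.exp x ∧
        (C * k * (Real.log z / z)) ^ k ≤ Real.exp (-(A * Real.exp x / x)) := by
  set A' := Real.exp (-(C + 3)) / (4 * (Real.exp 1 * C)) with hA'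
  have hA'0 : 0 < A' := by positivity
  set A := min 1 A' with hA
  have hA0 : 0 < A := lt_min one_pos hA'0
  refine ⟨A, hA0, min_le_left _ _, C + 5 + 8 / A + Real.exp 1, ?_, fun x hx => ?_⟩
  · have : 0 < 8 / A := by positivity
    linarith
  have p1 : 0 < 8 / A := by positivity
  have p2 := Real.exp_pos 1
  have hAx : 8 ≤ A * x := by
    have : 8 / A ≤ x := by linarith
    rw [div_le_iff₀ hA0] at this; linarith
  have hx0 : 0 < x := by linarith
  have hxq := Real.quadratic_le_exp_of_nonneg hx0.le
  have hE : x / 2 ≤ Real.exp x / x := by rw [le_div_iff₀ hx0]; nlinarith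
  set v := Real.exp (x - (C + 3)) with hv
  have hv4 : 4 ≤ v := by
    have h := Real.quadratic_le_exp_of_nonneg (by linarith : 0 ≤ x - (C + 3))
    nlinarith
  have hvx : v ≤ Real.exp x := Real.exp_le_exp.2 (by linarith)
  set z := ⌊v⌋₊ with hz
  have hz4 : 4 ≤ z := Nat.le_floor (by exact_mod_cast hv4)
  have hz4r : (4 : ℝ) ≤ z := by exact_mod_cast hz4
  have hzv : (z : ℝ) ≤ v := Nat.floor_le (by positivity)
  have hvz : v / 2 ≤ z := half_mul_le_floor (by linarith)
  have hlz : Real.log z ≤ x - (C + 3) :=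
    (Real.log_le_iff_le_exp (by linarith)).2 hzv
  have hlz1 : 1 ≤ Real.log z := by
    rw [Real.le_log_iff_exp_le (by linarith)]
    have := Real.exp_one_lt_d9; linarith
  set t := z / (Real.exp 1 * C * Real.log z) with ht
  have htl : 2 * A' * (Real.exp x / x) ≤ t := by
    calc 2 * A' * (Real.exp x / x) = (v / 2) / (Real.exp 1 * C * x) := by
          rw [hA', hv, Real.exp_sub, Real.exp_neg]; field_simp; norm_num
      _ ≤ t := by
          rw [ht]; gcongr; linarith
  have hA'x : 8 ≤ A' * x := hAx.trans (by gcongr; exact min_le_right _ _)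
  have ht1 : 1 ≤ t := by
    refine le_trans ?_ htl
    nlinarith
  have hk1 : 1 ≤ ⌊t⌋₊ := Nat.le_floor (by exact_mod_cast ht1)
  have hkt : (⌊t⌋₊ : ℝ) ≤ t := Nat.floor_le (by linarith)
  have htk := half_mul_le_floor ht1
  refine ⟨hAx, z, ⌊t⌋₊, hz4, hzv.trans hvx, hlz, hk1, ?_, ?_⟩
  · calc (⌊t⌋₊ : ℝ) ≤ t := hkt
      _ ≤ Real.exp x / (Real.exp 1 * C * 1) := by
          rw [ht]; gcongr; exact hzv.trans hvx
      _ = _ := by ring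
  · have h1 : C * ⌊t⌋₊ * (Real.log z / z) ≤ Real.exp (-1) := by
      calc C * ⌊t⌋₊ * (Real.log z / z) ≤ C * t * (Real.log z / z) := by gcongr
        _ = Real.exp (-1) := by
          rw [ht, Real.exp_neg]; field_simp
    calc (C * ⌊t⌋₊ * (Real.log z / z)) ^ ⌊t⌋₊ ≤ Real.exp (-1) ^ ⌊t⌋₊ := by gcongr
      _ = Real.exp (-(⌊t⌋₊ : ℝ)) := by rw [← Real.exp_nat_mul]; ring_nf
      _ ≤ _ := by
        apply Real.exp_le_exp.2
        have h2 : A * (Real.exp x / x) ≤ A' * (Real.exp x / x) := by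
          gcongr; exact min_le_right _ _
        rw [mul_div_assoc]
        linarith

set_option maxHeartbeats 1000000 in
lemma volume_le_Rtilde_of_large {ε : ℝ} (hε : 0 < ε) (hε2 : ε < 1 / 2) :
    ∃ A x₀ y₀ : ℝ, 0 < A ∧ Real.exp 1 ≤ x₀ ∧ ∀ y : ℝ, y₀ ≤ y → ∀ x : ℝ, x₀ ≤ x →
      x ≤ (1 / 2 - ε) * Real.log (Real.log y) →
      volume {u : ℝ | u ∈ Set.Icc 0 y ∧
        3 * Real.exp Real.eulerMascheroniConstant / π ^ 2 * x ≤ Rtilde u}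
        ≤ ENNReal.ofReal (y * Real.exp (-(A * Real.exp x / x))) := by
  obtain ⟨C, hC, hCb⟩ := exists_condAvg_bounds
  obtain ⟨K, hK, hKb⟩ := sum_moebius_psi_tail_le
  obtain ⟨A, hA, hA1, x₀, hx₀, hp⟩ := exists_truncation_params hC
  obtain ⟨y₀, hy₀, hcut⟩ := exists_cutoffs_of_large hε hε2 (B := 1 / (Real.exp 1 * C)) hK
    (by positivity)
  refine ⟨A / 2, x₀, y₀, by positivity, hx₀, fun y hy x hx hxy => ?_⟩
  obtain ⟨M, hM1, hxM, D, W, hD, hDW, hW, hWy, hMD, ht, hsum, hpow⟩ := hcut y hy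
  obtain ⟨hAx, z, k, hz4, hzx, hlz, hk1, hkx, hk⟩ := hp x hx
  have hy0 : 0 < y := by linarith
  have hx0 : 1 < x := by
    have := Real.add_one_le_exp (1 : ℝ); linarith
  have hexM : Real.exp x ≤ M := hxM x hxy
  have hzD : z ≤ D := by
    have h1 : M + 1 ≤ Real.exp M := Real.add_one_le_exp M
    have : (z : ℝ) ≤ D := by linarith
    exact_mod_cast this
  obtain ⟨hb, hdev⟩ := hCb z D hz4 hzD
  have hY : y < ((⌊y⌋₊ + 1 : ℕ) : ℝ) := by push_cast; exact Nat.lt_floor_add_one y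
  have hY2 : ((⌊y⌋₊ + 1 : ℕ) : ℝ) ≤ 2 * y := by
    push_cast; have := Nat.floor_le hy0.le; linarith
  have hmain := volume_le_Rtilde_le (z := z)
    (τ := 3 * Real.exp Real.eulerMascheroniConstant / π ^ 2 * x) hD hDW hW hWy hY
    (fun u hu1 hu2 => (hKb W (by omega) u hu1).trans (ht u hu2))
  have hκ := lt_three_mul_exp_gamma
  have hempty : {u : ℝ | u ∈ Set.Icc 0 y ∧
      3 * Real.exp Real.eulerMascheroniConstant / π ^ 2 * x - 13 / 10 ≤ -condAvg D z u} = ∅ := by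
    ext u
    constructor
    · rintro ⟨-, hu⟩
      have h1 := hb u
      have h2 := neg_abs_le (condAvg D z u)
      have h3 : 3 * Real.exp Real.eulerMascheroniConstant / π ^ 2 * (Real.log z + C)
          ≤ 3 * Real.exp Real.eulerMascheroniConstant / π ^ 2 * (x - 3) := by
        gcongr; linarith
      exfalso
      linarith
    · exact fun h => h.elim
  rw [hempty, measure_empty, add_zero] at hmain
  have hkM : (k : ℝ) ≤ 1 / (Real.exp 1 * C) * M := hkx.trans (by gcongr)
  have hpk := hpow k hkM
  set E := Real.exp x / x with hE
  have hEM : E ≤ M := (div_le_self (Real.exp_pos x).le hx0.le).trans hexM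
  have hE0 : 0 < E := by positivity
  have hAE : A * E ≤ E := mul_le_of_le_one_left hE0.le hA1
  have heM : Real.exp (-M) ≤ Real.exp (-(A * E)) := Real.exp_le_exp.2 (by linarith)
  have hEx : x / 2 ≤ E := by
    rw [hE, le_div_iff₀ (by linarith)]
    have := Real.quadratic_le_exp_of_nonneg (by linarith : 0 ≤ x)
    nlinarith
  have h5 : 5 ≤ Real.exp (A * E / 2) := by
    have h6 : 4 ≤ A * E := by
      have := mul_le_mul_of_nonneg_left hEx hA.le
      linarith
    have := Real.quadratic_le_exp_of_nonneg (by positivity : 0 ≤ A * E / 2)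
    nlinarith
  have hke : (C * k * (Real.log z / z)) ^ k ≤ Real.exp (-(A * E)) := by
    rwa [mul_div_assoc] at hk
  have hsplit : Real.exp (-(A / 2 * Real.exp x / x))
      = Real.exp (-(A * E)) * Real.exp (A * E / 2) := by
    rw [← Real.exp_add, hE]; congr 1; ring
  have hlW : 0 ≤ Real.log W := Real.log_natCast_nonneg _
  have hlD : 0 ≤ Real.log D := Real.log_natCast_nonneg _
  have hlz0 : 0 ≤ Real.log z := Real.log_natCast_nonneg _
  refine hmain.trans ((add_le_add le_rfl (hdev k _ hk1)).trans ?_)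
  rw [← ENNReal.ofReal_add (by positivity) (by positivity)]
  apply ENNReal.ofReal_le_ofReal
  rw [hsplit]
  calc _ ≤ y * Real.exp (-M) / 2 + (2 * y * (2 * Real.exp (-(A * E)))
        + y * Real.exp (-M) / 4) := by gcongr
    _ ≤ y * Real.exp (-(A * E)) / 2 + (2 * y * (2 * Real.exp (-(A * E)))
        + y * Real.exp (-(A * E)) / 4) := by gcongr
    _ ≤ y * (Real.exp (-(A * E)) * 5) := by
        have : 0 < y * Real.exp (-(A * E)) := by positivity
        linarith
    _ ≤ _ := by gcongr

lemma psi_neg {v : ℝ} (hv : Int.fract v ≠ 0) : psi (-v) = -psi v := by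
  rw [psi, psi, Int.fract_neg hv]; ring

lemma condAvg_neg {D j : ℕ} {u : ℝ} (hu : Int.fract u ≠ 0) :
    condAvg D j (-u) = -condAvg D j u := by
  rw [condAvg, condAvg, ← Finset.sum_neg_distrib]
  refine Finset.sum_congr rfl fun d hd => ?_
  rw [neg_div, psi_neg, mul_neg]
  intro h
  obtain ⟨n, hn⟩ := Int.fract_eq_zero_iff.1 h
  have h0 : (smoothPart j d : ℝ) ≠ 0 := by
    exact_mod_cast smoothPart_ne_zero j d
  apply hu
  rw [Int.fract_eq_zero_iff]
  refine ⟨n * smoothPart j d, ?_⟩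
  push_cast
  rw [hn]
  field_simp

lemma volume_condAvg_neg_le (D j : ℕ) {y : ℝ} (hy : 0 ≤ y) :
    volume {u : ℝ | u ∈ Set.Icc 0 y ∧ condAvg D j u < 0}
      ≤ ENNReal.ofReal ((y + primorial j) / 2) := by
  set N := primorial j with hN
  have hN0 : 0 < N := primorial_pos j
  have hN0r : (0 : ℝ) < N := by exact_mod_cast hN0
  set P : ℝ := ⌈y / N⌉₊ * N with hP
  have hyP : y ≤ P := by
    have := Nat.le_ceil (y / N)
    rwa [div_le_iff₀ hN0r] at this
  have hPy : P ≤ y + N := by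
    have := (Nat.ceil_lt_add_one (by positivity : 0 ≤ y / N)).le
    calc P ≤ (y / N + 1) * N := by rw [hP]; gcongr
      _ = y + N := by field_simp
  set G := {u : ℝ | u ∈ Set.Icc 0 P ∧ condAvg D j u < 0} with hG
  set G' := {u : ℝ | u ∈ Set.Icc 0 P ∧ 0 < condAvg D j u} with hG'
  have hGm : MeasurableSet G :=
    measurableSet_Icc.inter (measurableSet_lt (measurable_condAvg D j) measurable_const)
  have hGm' : MeasurableSet G' :=
    measurableSet_Icc.inter (measurableSet_lt measurable_const (measurable_condAvg D j))
  have h1 : volume G ≤ volume G' := by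
    rw [← (Measure.measurePreserving_sub_left volume P).measure_preimage hGm.nullMeasurableSet]
    calc volume ((fun x => P - x) ⁻¹' G) ≤ volume (G' ∪ {u : ℝ | Int.fract u = 0}) := by
          apply measure_mono
          rintro v ⟨⟨hv0, hvP⟩, hv⟩
          by_cases hf : Int.fract v = 0
          · exact Or.inr hf
          · left
            refine ⟨⟨by linarith, by linarith⟩, ?_⟩
            have h2 : condAvg D j (P - v) = -condAvg D j v := by
              rw [show P - v = -v + ⌈y / N⌉₊ * (N : ℝ) by rw [hP]; ring,
                condAvg_add (dvd_of_eq hN.symm), condAvg_neg hf]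
            change condAvg D j (P - v) < 0 at hv
            linarith
      _ ≤ volume G' + volume {u : ℝ | Int.fract u = 0} := measure_union_le _ _
      _ = volume G' := by rw [volume_fract_eq_zero, add_zero]
  have hdisj : Disjoint G G' := by
    rw [Set.disjoint_left]
    rintro u ⟨-, h⟩ ⟨-, h'⟩
    linarith
  have h3 : 2 * volume G ≤ ENNReal.ofReal P := by
    calc 2 * volume G ≤ volume G + volume G' := by rw [two_mul]; gcongr
      _ = volume (G ∪ G') := (measure_union hdisj hGm').symm
      _ ≤ volume (Set.Icc 0 P) := by
          apply measure_mono
          rintro u (h | h)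
          · exact h.1
          · exact h.1
      _ = ENNReal.ofReal P := by rw [Real.volume_Icc, sub_zero]
  calc volume {u : ℝ | u ∈ Set.Icc 0 y ∧ condAvg D j u < 0} ≤ volume G := by
        apply measure_mono
        rintro u ⟨⟨h0, hy'⟩, h⟩
        exact ⟨⟨h0, hy'.trans hyP⟩, h⟩
    _ ≤ ENNReal.ofReal P / 2 := by
        rw [ENNReal.le_div_iff_mul_le (by simp) (by simp), mul_comm]; exact h3
    _ = ENNReal.ofReal (P / 2) := by
        rw [ENNReal.ofReal_div_of_pos (by norm_num)]; norm_num
    _ ≤ _ := ENNReal.ofReal_le_ofReal (by linarith)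

lemma exists_log_div_le {δ : ℝ} (hδ : 0 < δ) : ∃ z : ℕ, 4 ≤ z ∧ Real.log z / z ≤ δ := by
  have h := (Real.isLittleO_log_id_atTop.comp_tendsto tendsto_natCast_atTop_atTop).bound hδ
  obtain ⟨z, hz, hz4⟩ := (h.and (Filter.eventually_ge_atTop 4)).exists
  refine ⟨z, hz4, ?_⟩
  have hz0 : (0 : ℝ) < z := by exact_mod_cast (by omega : 0 < z)
  simp only [Function.comp, id, Real.norm_eq_abs, abs_of_pos hz0] at hz
  rw [div_le_iff₀ hz0]
  exact (le_abs_self _).trans hz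

set_option maxHeartbeats 1000000 in
lemma exists_volume_le_Rtilde_le_nine_tenths :
    ∃ y₀ : ℝ, ∀ y : ℝ, y₀ ≤ y →
      volume {u : ℝ | u ∈ Set.Icc 0 y ∧
        3 * Real.exp Real.eulerMascheroniConstant / π ^ 2 * Real.exp 1 ≤ Rtilde u}
        ≤ ENNReal.ofReal (y * (9 / 10)) := by
  obtain ⟨C, hC, hCb⟩ := exists_condAvg_bounds
  obtain ⟨K, hK, hKb⟩ := sum_moebius_psi_tail_le
  obtain ⟨z, hz4, hz⟩ := exists_log_div_le (δ := 1 / (100 * C)) (by positivity)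
  obtain ⟨y₀, hy₀, hcut⟩ := exists_cutoffs_of_large (ε := 1 / 4) (by norm_num) (by norm_num)
    (K := K) (B := 1) hK zero_le_one
  set N := primorial z with hN
  refine ⟨max y₀ (max (40 * N) (Real.exp (Real.exp (4 * z)))), fun y hy => ?_⟩
  have hyN : 40 * (N : ℝ) ≤ y := ((le_max_left _ _).trans (le_max_right _ _)).trans hy
  have hyz : Real.exp (Real.exp (4 * z)) ≤ y :=
    ((le_max_right _ _).trans (le_max_right _ _)).trans hy
  replace hy : y₀ ≤ y := (le_max_left _ _).trans hy
  obtain ⟨M, hM1, hxM, D, W, hD, hDW, hW, hWy, hMD, ht, hsum, hpow⟩ := hcut y hy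
  have hy0 : 0 < y := by linarith
  have hzD : z ≤ D := by
    have h1 : Real.exp (4 * z) ≤ Real.log y := (Real.le_log_iff_exp_le hy0).2 hyz
    have h2 : 4 * (z : ℝ) ≤ Real.log (Real.log y) :=
      (Real.le_log_iff_exp_le ((Real.exp_pos _).trans_le h1)).2 h1
    have h3 := hxM z (by linarith)
    have h4 := Real.add_one_le_exp (z : ℝ)
    have h5 := Real.add_one_le_exp M
    have : (z : ℝ) ≤ D := by linarith
    exact_mod_cast this
  obtain ⟨-, hdev⟩ := hCb z D hz4 hzD
  have hY : y < ((⌊y⌋₊ + 1 : ℕ) : ℝ) := by push_cast; exact Nat.lt_floor_add_one y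
  have hY2 : ((⌊y⌋₊ + 1 : ℕ) : ℝ) ≤ 2 * y := by
    push_cast; have := Nat.floor_le hy0.le; linarith
  have hmain := volume_le_Rtilde_le (z := z)
    (τ := 3 * Real.exp Real.eulerMascheroniConstant / π ^ 2 * Real.exp 1) hD hDW hW hWy hY
    (fun u hu1 hu2 => (hKb W (by omega) u hu1).trans (ht u hu2))
  have hneg : volume {u : ℝ | u ∈ Set.Icc 0 y ∧
      3 * Real.exp Real.eulerMascheroniConstant / π ^ 2 * Real.exp 1 - 13 / 10
        ≤ -condAvg D z u} ≤ ENNReal.ofReal ((y + N) / 2) := by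
    refine (measure_mono ?_).trans (volume_condAvg_neg_le D z hy0.le)
    rintro u ⟨hu, h⟩
    refine ⟨hu, ?_⟩
    have hκ := lt_three_mul_exp_gamma
    have he := Real.exp_one_gt_d9
    have : (49 / 100 : ℝ) * 2.7 ≤
        3 * Real.exp Real.eulerMascheroniConstant / π ^ 2 * Real.exp 1 := by gcongr; linarith
    linarith
  have hpk := hpow 1 (by push_cast; linarith)
  have hlW : 0 ≤ Real.log W := Real.log_natCast_nonneg _
  have hlD : 0 ≤ Real.log D := Real.log_natCast_nonneg _
  have hlz0 : 0 ≤ Real.log z := Real.log_natCast_nonneg _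
  have heM : Real.exp (-M) ≤ 2 / 5 := by
    rw [Real.exp_neg]
    have h1 : (5 / 2 : ℝ) ≤ Real.exp M := by
      have := Real.quadratic_le_exp_of_nonneg (by linarith : 0 ≤ M)
      nlinarith
    calc (Real.exp M)⁻¹ ≤ (5 / 2 : ℝ)⁻¹ := by gcongr
      _ = 2 / 5 := by norm_num
  have hcz : (C * ((1 : ℕ) : ℝ) * (Real.log z / z)) ^ 1 ≤ 1 / 100 := by
    calc (C * ((1 : ℕ) : ℝ) * (Real.log z / z)) ^ 1 = C * (Real.log z / z) := by simp
      _ ≤ C * (1 / (100 * C)) := by gcongr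
      _ = 1 / 100 := by field_simp
  refine hmain.trans ((add_le_add (add_le_add le_rfl (hdev 1 _ le_rfl)) hneg).trans ?_)
  rw [← ENNReal.ofReal_add (by positivity) (by positivity),
    ← ENNReal.ofReal_add (by positivity) (by positivity)]
  apply ENNReal.ofReal_le_ofReal
  calc _ ≤ y * Real.exp (-M) / 2 + (2 * y * (2 * (1 / 100)) + y * Real.exp (-M) / 4)
        + (y + N) / 2 := by gcongr
    _ ≤ y * (2 / 5) / 2 + (2 * y * (2 * (1 / 100)) + y * (2 / 5) / 4) + (y + N) / 2 := by
        gcongr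
    _ ≤ y * (9 / 10) := by linarith

/-- Tail bound for the distribution of `R̃(u)` (Theorem 3). -/
theorem tail_bound_Rtilde :
    ∀ ε : ℝ, 0 < ε → ε < 1/2 →
    ∃ A₁ : ℝ, 0 < A₁ ∧ ∃ y₀ : ℝ, ∀ y : ℝ, y₀ ≤ y →
    ∀ x : ℝ, Real.exp 1 ≤ x → x ≤ (1/2 - ε) * Real.log (Real.log y) →
      volume {u : ℝ | u ∈ Set.Icc 0 y ∧
          3 * Real.exp Real.eulerMascheroniConstant / Real.pi ^ 2 * x ≤ Rtilde u} ≤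
        ENNReal.ofReal (y * Real.exp (-(A₁ * Real.exp x / x))) := by
  intro ε hε hε2
  obtain ⟨A, x₀, y₁, hA, hx₀, hlarge⟩ := volume_le_Rtilde_of_large hε hε2
  obtain ⟨y₂, hsmall⟩ := exists_volume_le_Rtilde_le_nine_tenths
  refine ⟨min A (Real.exp (-x₀) / 10), lt_min hA (by positivity), max 0 (max y₁ y₂),
    fun y hy x hx hxy => ?_⟩
  have hy0 : 0 ≤ y := (le_max_left _ _).trans hy
  have hy1 : y₁ ≤ y := ((le_max_left _ _).trans (le_max_right _ _)).trans hy
  have hy2 : y₂ ≤ y := ((le_max_right _ _).trans (le_max_right _ _)).trans hy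
  have hx1 : 1 ≤ x := by
    have := Real.add_one_le_exp (1 : ℝ); linarith
  rcases le_total x₀ x with h | h
  · refine (hlarge y hy1 x h hxy).trans (ENNReal.ofReal_le_ofReal ?_)
    gcongr
    exact min_le_left _ _
  · have hκ := lt_three_mul_exp_gamma
    calc volume {u : ℝ | u ∈ Set.Icc 0 y ∧
          3 * Real.exp Real.eulerMascheroniConstant / π ^ 2 * x ≤ Rtilde u}
        ≤ volume {u : ℝ | u ∈ Set.Icc 0 y ∧
          3 * Real.exp Real.eulerMascheroniConstant / π ^ 2 * Real.exp 1 ≤ Rtilde u} := by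
          apply measure_mono
          rintro u ⟨hu, hu'⟩
          exact ⟨hu, le_trans (by gcongr) hu'⟩
      _ ≤ ENNReal.ofReal (y * (9 / 10)) := hsmall y hy2
      _ ≤ _ := by
          apply ENNReal.ofReal_le_ofReal
          gcongr
          have h1 : min A (Real.exp (-x₀) / 10) * Real.exp x / x ≤ 1 / 10 := by
            rw [div_le_iff₀ (by linarith)]
            calc min A (Real.exp (-x₀) / 10) * Real.exp x
                ≤ Real.exp (-x₀) / 10 * Real.exp x₀ := by
                  gcongr; exact min_le_right _ _
              _ = 1 / 10 := by rw [Real.exp_neg]; field_simp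
              _ ≤ 1 / 10 * x := by linarith
          have h2 := Real.add_one_le_exp (-(min A (Real.exp (-x₀) / 10) * Real.exp x / x))
          linarith
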